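/- Let Φ and Ψ be linear flows on X = ℝ^d (d ≥ 1). Then each of the following three statements implies the other two: (i) Φ and Ψ are some-Hölder equivalent (Φ ~^{0⁺} Ψ); (ii) Φ and Ψ are equivalent, i.e. some homeomorphism of X maps every Φ-orbit onto a Ψ-orbit; (iii) {dim X_S^Φ, dim X_U^Φ} = {dim X_S^Ψ, dim X_U^Ψ}, and there exists α ∈ ℝ∖{0} such that the generators A^{Φ_C} and α A^{Ψ_C} of the central parts are similar (i.e. Q A^{Φ_C} = α A^{Ψ_C} Q for some linear isomorphism Q : X_C^Φ → X_C^Ψ). -/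

import Mathlib

noncomputable section
namespace LF

open Filter Topology

/-- `ℝ^d` with the Euclidean norm. -/
abbrev Euc (d : ℕ) := EuclideanSpace ℝ (Fin d)

variable {d : ℕ}

/-- The time-`t` map of the linear flow on `ℝ^d` generated by the matrix `A`,
i.e. `x ↦ exp (t A) x`. -/
def linFlow (A : Matrix (Fin d) (Fin d) ℝ) (t : ℝ) (x : Euc d) : Euc d :=
  Matrix.toEuclideanLin (NormedSpace.exp (t • A)) x

/-- The orbit `{Φ_t x : t ∈ ℝ}` of `x` under the linear flow generated by `A`. -/
def flowOrbit (A : Matrix (Fin d) (Fin d) ℝ) (x : Euc d) : Set (Euc d) :=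
  Set.range fun t : ℝ => linFlow A t x

/-- `Φ` is `h`-related to `Ψ`: the homeomorphism `h` maps every orbit of the flow
generated by `A` onto an orbit of the flow generated by `B`. -/
def IsOrbitEquiv (A B : Matrix (Fin d) (Fin d) ℝ) (h : Euc d ≃ₜ Euc d) : Prop :=
  ∀ x : Euc d, h '' flowOrbit A x = flowOrbit B (h x)

/-- `f` satisfies a `β`-Hölder condition on some ball centred at `0`. -/
def HolderNearZero (β : ℝ) (f : Euc d → Euc d) : Prop :=
  ∃ r > (0 : ℝ), ∃ K : ℝ, ∀ x ∈ Metric.ball (0 : Euc d) r, ∀ y ∈ Metric.ball (0 : Euc d) r,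
    dist (f x) (f y) ≤ K * dist x y ^ β

/-- `h ∈ 𝓗_β`: `h 0 = 0` and `h`, `h⁻¹` both satisfy a `β`-Hölder condition near `0`. -/
def MemHolderClass (β : ℝ) (h : Euc d ≃ₜ Euc d) : Prop :=
  h 0 = 0 ∧ HolderNearZero β ⇑h ∧ HolderNearZero β ⇑h.symm

/-- `h ∈ 𝓗_0`: homeomorphisms fixing `0`. -/
def MemH0 (h : Euc d ≃ₜ Euc d) : Prop := h 0 = 0

/-- `h ∈ 𝓗_{0⁺} = ⋃_{γ>0} 𝓗_γ`. -/
def MemH0plus (h : Euc d ≃ₜ Euc d) : Prop := ∃ γ : ℝ, 0 < γ ∧ MemHolderClass γ h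

/-- `h ∈ 𝓗_{1⁻} = ⋂_{0<γ<1} 𝓗_γ`. -/
def MemH1minus (h : Euc d ≃ₜ Euc d) : Prop := ∀ γ : ℝ, 0 < γ → γ < 1 → MemHolderClass γ h

/-- `h ∈ 𝓗_{β⁻} = ⋂_{0<γ<β} 𝓗_γ`. -/
def MemHBelow (β : ℝ) (h : Euc d ≃ₜ Euc d) : Prop :=
  ∀ γ : ℝ, 0 < γ → γ < β → MemHolderClass γ h

/-- `h ∈ 𝓗_{β⁺} = ⋃_{γ>β} 𝓗_γ`. -/
def MemHAbove (β : ℝ) (h : Euc d ≃ₜ Euc d) : Prop :=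
  ∃ γ : ℝ, β < γ ∧ MemHolderClass γ h

/-- `φ ~^⋆ ψ`: `φ` is `h`-related to `ψ` for some `h` in the class `P`. -/
def RelEquivWith (P : (Euc d ≃ₜ Euc d) → Prop) (A B : Matrix (Fin d) (Fin d) ℝ) : Prop :=
  ∃ h : Euc d ≃ₜ Euc d, P h ∧ IsOrbitEquiv A B h

/-- `φ ≃^⋆ ψ`: there are `h` in the class `P` and `α ≠ 0` with
`h (φ t x) = ψ (α t) (h x)` for all `t`, `x`. -/
def SimEquivWith (P : (Euc d ≃ₜ Euc d) → Prop) (A B : Matrix (Fin d) (Fin d) ℝ) : Prop :=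
  ∃ (h : Euc d ≃ₜ Euc d) (α : ℝ), α ≠ 0 ∧ P h ∧
    ∀ (t : ℝ) (x : Euc d), h (linFlow A t x) = linFlow B (α * t) (h x)

/-- The stable set `X_S^Φ = {x : Φ_t x → 0 as t → ∞}`. -/
def stableSet (A : Matrix (Fin d) (Fin d) ℝ) : Set (Euc d) :=
  {x | Tendsto (fun t : ℝ => linFlow A t x) atTop (𝓝 0)}

/-- The unstable set `X_U^Φ = {x : Φ_t x → 0 as t → -∞}`. -/
def unstableSet (A : Matrix (Fin d) (Fin d) ℝ) : Set (Euc d) :=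
  {x | Tendsto (fun t : ℝ => linFlow A t x) atBot (𝓝 0)}

/-- The central set `X_C^Φ = {x : e^{-ε|t|} Φ_t x → 0 as |t| → ∞, for every ε > 0}`. -/
def centralSet (A : Matrix (Fin d) (Fin d) ℝ) : Set (Euc d) :=
  {x | ∀ ε > (0 : ℝ),
    Tendsto (fun t : ℝ => Real.exp (-(ε * |t|)) • linFlow A t x) (atBot ⊔ atTop) (𝓝 0)}

/-- The stable subspace of the flow generated by `A` (the stable set is a subspace,
so taking its span is innocuous). -/
def XS (A : Matrix (Fin d) (Fin d) ℝ) : Submodule ℝ (Euc d) := Submodule.span ℝ (stableSet A)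

/-- The unstable subspace. -/
def XU (A : Matrix (Fin d) (Fin d) ℝ) : Submodule ℝ (Euc d) := Submodule.span ℝ (unstableSet A)

/-- The central subspace. -/
def XC (A : Matrix (Fin d) (Fin d) ℝ) : Submodule ℝ (Euc d) := Submodule.span ℝ (centralSet A)

/-- The hyperbolic subspace `X_H^Φ = X_S^Φ ⊕ X_U^Φ`. -/
def XH (A : Matrix (Fin d) (Fin d) ℝ) : Submodule ℝ (Euc d) := XS A ⊔ XU A

def dimS (A : Matrix (Fin d) (Fin d) ℝ) : ℕ := Module.finrank ℝ (XS A)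
def dimU (A : Matrix (Fin d) (Fin d) ℝ) : ℕ := Module.finrank ℝ (XU A)
def dimHyp (A : Matrix (Fin d) (Fin d) ℝ) : ℕ := Module.finrank ℝ (XH A)

/-- The central-part generators `A^{Φ_C}` and `α A^{Ψ_C}` are similar, i.e.
`Q A_C = (α B_C) Q` for some linear isomorphism `Q : X_C^Φ → X_C^Ψ`. -/
def IsCentralSimilar (A B : Matrix (Fin d) (Fin d) ℝ) (α : ℝ) : Prop :=
  ∃ (hA : ∀ x ∈ XC A, Matrix.toEuclideanLin A x ∈ XC A)
    (hB : ∀ x ∈ XC B, Matrix.toEuclideanLin B x ∈ XC B)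
    (Q : XC A ≃ₗ[ℝ] XC B),
    ∀ x : XC A, Q ((Matrix.toEuclideanLin A).restrict hA x)
      = α • (Matrix.toEuclideanLin B).restrict hB (Q x)

/-- The forward Lyapunov exponent `λ_+^Φ(x) = lim_{t→∞} log ‖Φ_t x‖ / t`
(the limit exists for `x ≠ 0`, so it equals the `limsup` used here). -/
def lyap (A : Matrix (Fin d) (Fin d) ℝ) (x : Euc d) : ℝ :=
  Filter.limsup (fun t : ℝ => Real.log ‖linFlow A t x‖ / t) atTop

/-- The Lyapunov space `L^Φ(s) = {x : λ_+^Φ(x) ≤ s}` (with `λ_+^Φ(0) = -∞`), as a set. -/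
def lyapSet (A : Matrix (Fin d) (Fin d) ℝ) (s : ℝ) : Set (Euc d) :=
  {x | x = 0 ∨ lyap A x ≤ s}

/-- `ℓ^Φ(s) = dim L^Φ(s)` (the Lyapunov set is a subspace, so taking its span is innocuous). -/
def ell (A : Matrix (Fin d) (Fin d) ℝ) (s : ℝ) : ℕ :=
  Module.finrank ℝ (Submodule.span ℝ (lyapSet A s))

/-- The `(j+1)`-st smallest Lyapunov exponent `λ_{j+1}^Φ`, counted with multiplicity. -/
def lyapExp (A : Matrix (Fin d) (Fin d) ℝ) (j : ℕ) : ℝ :=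
  sInf {s : ℝ | j + 1 ≤ ell A s}

/-- The Lyapunov space at `s` of the restriction of the flow to the invariant set `V`. -/
def lyapSetIn (A : Matrix (Fin d) (Fin d) ℝ) (V : Set (Euc d)) (s : ℝ) : Set (Euc d) :=
  {x | x ∈ V ∧ (x = 0 ∨ lyap A x ≤ s)}

def ellIn (A : Matrix (Fin d) (Fin d) ℝ) (V : Set (Euc d)) (s : ℝ) : ℕ :=
  Module.finrank ℝ (Submodule.span ℝ (lyapSetIn A V s))

/-- The `(j+1)`-st smallest Lyapunov exponent of the flow restricted to `V`. -/
def lyapExpIn (A : Matrix (Fin d) (Fin d) ℝ) (V : Set (Euc d)) (j : ℕ) : ℝ :=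
  sInf {s : ℝ | j + 1 ≤ ellIn A V s}

/-- `λ_{j+1}^{Φ_H}`: the `(j+1)`-st smallest Lyapunov exponent of the restriction
of the flow to the hyperbolic subspace. -/
def lyapExpH (A : Matrix (Fin d) (Fin d) ℝ) (j : ℕ) : ℝ :=
  lyapExpIn A (XH A) j

/-- The flow generated by `A` is stable: every orbit tends to `0` as `t → ∞`. -/
def IsStable (A : Matrix (Fin d) (Fin d) ℝ) : Prop := ∀ x : Euc d, x ∈ stableSet A

/-- The flow generated by `A` is unstable: every orbit tends to `0` as `t → -∞`. -/
def IsUnstable (A : Matrix (Fin d) (Fin d) ℝ) : Prop := ∀ x : Euc d, x ∈ unstableSet A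

/-- The flow generated by `A` is hyperbolic: `X = X_S ⊕ X_U`. -/
def IsHyperbolic (A : Matrix (Fin d) (Fin d) ℝ) : Prop := IsCompl (XS A) (XU A)

/-- `ρ_+(Φ,Ψ) = (min_j λ_j^Φ/λ_j^Ψ) / |max_j λ_j^Φ/λ_j^Ψ|`. -/
def rhoPlus (A B : Matrix (Fin d) (Fin d) ℝ) : ℝ :=
  (⨅ j : Fin d, lyapExp A j / lyapExp B j) / |⨆ j : Fin d, lyapExp A j / lyapExp B j|

/-- The Lyapunov cross ratio `ρ(Φ,Ψ) = max {ρ_+(Φ,Ψ), ρ_+(Φ*,Ψ)}`, where `Φ*` is the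
time-reversal of `Φ`, generated by `-A`. -/
def rho (A B : Matrix (Fin d) (Fin d) ℝ) : ℝ := max (rhoPlus A B) (rhoPlus (-A) B)

/-- The minimal period `T_x^Φ = inf {t > 0 : Φ_t x = x} ∈ [0,∞]` (with `inf ∅ = ∞`). -/
def minPeriod (A : Matrix (Fin d) (Fin d) ℝ) (x : Euc d) : EReal :=
  sInf {T : EReal | ∃ t : ℝ, 0 < t ∧ linFlow A t x = x ∧ T = (t : EReal)}

/-- The set of complex eigenvalues of the real matrix `A`. -/
def cSpec {n : ℕ} (A : Matrix (Fin n) (Fin n) ℝ) : Set ℂ :=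
  spectrum ℂ (A.map Complex.ofReal)

/-- `x` is a fixed point of the flow generated by `A`. -/
def IsFixedPt (A : Matrix (Fin d) (Fin d) ℝ) (x : Euc d) : Prop :=
  ∀ t : ℝ, linFlow A t x = x

/-- The nilpotent `m × m` Jordan block `J_m` (ones on the superdiagonal). -/
def jordanNil (m : ℕ) : Matrix (Fin m) (Fin m) ℝ :=
  Matrix.of fun i j => if (i : ℕ) + 1 = (j : ℕ) then 1 else 0

section
open Filter Topology

/-- determinant interpolation -/
lemma det_interp (n : ℕ) (ε : ℝ) (hε : 0 < ε) :
    ∃ w : Fin (n+1) → ℝ, ∑ i, w i = 1 ∧ ∀ M : Matrix (Fin n) (Fin n) ℝ,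
      (1 + M).det = ∑ i : Fin (n+1), w i * (1 + (ε * i / (n+1)) • M).det := by
  set v : Fin (n+1) → ℝ := fun i => ε * i / (n+1) with hv
  have hinj : Set.InjOn v (Finset.univ : Finset (Fin (n+1))) := by
    intro i _ j _ h
    simp only [hv] at h
    have hn : (n:ℝ)+1 ≠ 0 := by positivity
    rw [div_left_inj' hn] at h
    have := mul_left_cancel₀ hε.ne' h
    exact Fin.ext (by exact_mod_cast this)
  refine ⟨fun i => (Lagrange.basis Finset.univ v i).eval 1, ?_, ?_⟩
  · have := Lagrange.sum_basis hinj Finset.univ_nonempty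
    have := congrArg (Polynomial.eval 1) this
    simpa [Polynomial.eval_finsetSum] using this
  · intro M
    set p : Polynomial ℝ := Matrix.det ((Polynomial.X : Polynomial ℝ) • M.map Polynomial.C + (1 : Matrix (Fin n) (Fin n) ℝ).map Polynomial.C) with hp
    have hdeg : p.natDegree ≤ n := by
      have := Polynomial.natDegree_det_X_add_C_le M (1 : Matrix (Fin n) (Fin n) ℝ)
      rw [hp]; simpa using this
    have hev : ∀ t : ℝ, p.eval t = (1 + t • M).det := by
      intro t
      rw [hp, ← Polynomial.coe_evalRingHom, RingHom.map_det]
      congr 1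
      ext i j
      by_cases hij : i = j <;> simp [Matrix.one_apply, hij] <;> ring
    have hlt : p.degree < (Finset.univ : Finset (Fin (n+1))).card := by
      refine lt_of_le_of_lt Polynomial.degree_le_natDegree ?_
      simp only [Finset.card_univ, Fintype.card_fin]
      exact_mod_cast Nat.lt_succ_of_le hdeg
    have := Lagrange.eq_interpolate hinj hlt
    have h1 := congrArg (Polynomial.eval 1) this
    rw [hev, Lagrange.interpolate_apply, Polynomial.eval_finsetSum] at h1
    simp only [Polynomial.eval_mul, Polynomial.eval_C, hev, one_smul] at h1
    rw [h1]
    exact Finset.sum_congr rfl fun i _ => by simp only [hv]; ring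

lemma det_interp' (n : ℕ) (ε : ℝ) (hε : 0 < ε) :
    ∃ w : Fin (n+1) → ℝ, ∑ i, w i = 1 ∧ ∀ L : Euc n →L[ℝ] Euc n,
      (1 + L).det = ∑ i : Fin (n+1), w i * (1 + (ε * i / (n+1)) • L).det := by
  obtain ⟨w, h1, h2⟩ := det_interp n ε hε
  refine ⟨w, h1, fun L => ?_⟩
  have key : ∀ t : ℝ, (1 + t • L).det = (1 + t • LinearMap.toMatrix (EuclideanSpace.basisFun (Fin n) ℝ).toBasis (EuclideanSpace.basisFun (Fin n) ℝ).toBasis (L : Euc n →ₗ[ℝ] Euc n)).det := by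
    intro t
    rw [ContinuousLinearMap.det, ← LinearMap.det_toMatrix (EuclideanSpace.basisFun (Fin n) ℝ).toBasis]
    congr 1
    simp only [ContinuousLinearMap.toLinearMap_add, ContinuousLinearMap.toLinearMap_smul, map_add, map_smul]
    congr 1
    exact LinearMap.toMatrix_one _
  have := key 1
  rw [one_smul, one_smul] at this
  rw [this, h2]
  exact Finset.sum_congr rfl fun i _ => by rw [key]

lemma det_pos_small {n : ℕ} (L : Euc n →L[ℝ] Euc n) (t : ℝ) (ht : 0 ≤ t) (h : t * ‖L‖ < 1) :
    0 < (1 + t • L).det := by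
  by_contra hneg
  push Not at hneg
  have hc : Continuous fun s : ℝ => (1 + s • L).det := by
    have : Continuous fun M : Euc n →L[ℝ] Euc n => M.det := ContinuousLinearMap.continuous_det
    exact this.comp (by fun_prop)
  have := intermediate_value_Icc' ht hc.continuousOn
  have h0 : (0:ℝ) ∈ Set.Icc ((1 + t • L).det) ((1 + (0:ℝ) • L).det) := by
    refine ⟨hneg, ?_⟩
    simp [ContinuousLinearMap.det]
  obtain ⟨s, hs, hs0⟩ := this h0
  simp only at hs0
  have : ¬ IsUnit (1 + s • L) := by
    intro hu
    have hu' : IsUnit ((1 + s • L : Euc n →L[ℝ] Euc n) : Euc n →ₗ[ℝ] Euc n) := by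
      exact hu.map (ContinuousLinearMap.toLinearMapRingHom (R₁ := ℝ) (M₁ := Euc n))
    have := LinearMap.isUnit_det _ hu'
    rw [ContinuousLinearMap.det] at hs0
    rw [hs0] at this
    simp at this
  apply this
  have : ‖-(s • L)‖ < 1 := by
    rw [norm_neg, norm_smul, Real.norm_of_nonneg hs.1]
    refine lt_of_le_of_lt ?_ h
    gcongr
    exact hs.2
  have := isUnit_one_sub_of_norm_lt_one this
  simpa using this

/-- surjectivity of small perturbations of identity -/
lemma pert_image {n : ℕ} (g : Euc n → Euc n) (t C : ℝ) (ht : 0 ≤ t) (ht1 : t < 1) (hC : 0 ≤ C)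
    (htC : t * C ≤ 1/2)
    (hr : ∀ x ∈ Metric.closedBall (0 : Euc n) 1, ‖x + g x‖ = 1)
    (hs : ∀ x ∈ Metric.sphere (0 : Euc n) 1, g x = 0)
    (hlip : ∀ x ∈ Metric.closedBall (0 : Euc n) 1, ∀ y ∈ Metric.closedBall (0 : Euc n) 1,
      ‖g x - g y‖ ≤ C * ‖x - y‖) :
    Set.InjOn (fun x => x + t • g x) (Metric.ball (0 : Euc n) 1) ∧
    (fun x => x + t • g x) '' (Metric.ball (0 : Euc n) 1) = Metric.ball (0 : Euc n) 1 := by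
  set f : Euc n → Euc n := fun x => x + t • g x with hf
  have hap : ApproximatesLinearOn f ((ContinuousLinearEquiv.refl ℝ (Euc n)) : Euc n →L[ℝ] Euc n)
      (Metric.ball (0 : Euc n) 1) (1/2 : NNReal) := by
    intro x hx y hy
    have : f x - f y - (ContinuousLinearEquiv.refl ℝ (Euc n) : Euc n →L[ℝ] Euc n) (x - y) = t • (g x - g y) := by
      simp [hf, smul_sub]; abel
    rw [this, norm_smul, Real.norm_of_nonneg ht]
    have h1 := hlip x (Metric.ball_subset_closedBall hx) y (Metric.ball_subset_closedBall hy)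
    calc t * ‖g x - g y‖ ≤ t * (C * ‖x - y‖) := by gcongr
      _ = (t * C) * ‖x - y‖ := by ring
      _ ≤ (1/2) * ‖x - y‖ := by gcongr
      _ = ((1/2 : NNReal) : ℝ) * ‖x - y‖ := by norm_num
  have hsub : f '' (Metric.ball (0 : Euc n) 1) ⊆ Metric.ball (0 : Euc n) 1 := by
    rintro _ ⟨x, hx, rfl⟩
    have hxx := hr x (Metric.ball_subset_closedBall hx)
    rw [mem_ball_zero_iff] at hx ⊢
    have : f x = (1 - t) • x + t • (x + g x) := by simp only [hf, sub_smul, smul_add, one_smul]; abel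
    rw [this]
    calc ‖(1 - t) • x + t • (x + g x)‖ ≤ ‖(1 - t) • x‖ + ‖t • (x + g x)‖ := norm_add_le _ _
      _ = (1 - t) * ‖x‖ + t := by
        rw [norm_smul, norm_smul, hxx, Real.norm_of_nonneg ht, Real.norm_of_nonneg (by linarith)]; ring
      _ < 1 := by nlinarith
  have hinj : Set.InjOn f (Metric.ball (0 : Euc n) 1) := by
    intro x hx y hy hxy
    have := hap x hx y hy
    rw [hxy, sub_self, zero_sub, norm_neg] at this
    simp only [ContinuousLinearEquiv.coe_refl, ContinuousLinearMap.coe_id', id] at this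
    have h2 : ‖x - y‖ ≤ 1/2 * ‖x - y‖ := by simpa using this
    have : ‖x - y‖ = 0 := le_antisymm (by linarith) (norm_nonneg _)
    exact sub_eq_zero.1 (norm_eq_zero.1 this)
  refine ⟨hinj, ?_⟩
  have hopen : IsOpen (f '' (Metric.ball (0 : Euc n) 1)) := by
    refine hap.open_image (ContinuousLinearEquiv.toNonlinearRightInverse _) Metric.isOpen_ball ?_
    by_cases hsing : Subsingleton (Euc n)
    · exact Or.inl hsing
    · right
      rw [not_subsingleton_iff_nontrivial] at hsing
      have : (ContinuousLinearEquiv.toNonlinearRightInverse (ContinuousLinearEquiv.refl ℝ (Euc n))).nnnorm = 1 := by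
        show ‖((ContinuousLinearEquiv.refl ℝ (Euc n)).symm : Euc n →L[ℝ] Euc n)‖₊ = 1
        have : ‖ContinuousLinearMap.id ℝ (Euc n)‖₊ = 1 := by
          rw [← NNReal.coe_inj]; exact ContinuousLinearMap.norm_id
        exact this
      rw [this]
      rw [← NNReal.coe_lt_coe]
      norm_num
  have hcont : ContinuousOn g (Metric.closedBall (0 : Euc n) 1) := by
    have : LipschitzOnWith ⟨C, hC⟩ g (Metric.closedBall (0 : Euc n) 1) :=
      LipschitzOnWith.of_dist_le_mul fun x hx y hy => by
        rw [dist_eq_norm, dist_eq_norm]; exact hlip x hx y hy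
    exact this.continuousOn
  have hfc : ContinuousOn f (Metric.closedBall (0 : Euc n) 1) := by
    exact continuousOn_id.add (hcont.const_smul t)
  have hcl : IsClosed (f '' (Metric.closedBall (0 : Euc n) 1)) :=
    ((isCompact_closedBall _ _).image_of_continuousOn hfc).isClosed
  refine Set.Subset.antisymm hsub ?_
  have hpre : IsPreconnected (Metric.ball (0 : Euc n) 1) := (convex_ball _ _).isPreconnected
  refine hpre.subset_left_of_subset_union hopen hcl.isOpen_compl ?_ ?_ ?_
  · rw [Set.disjoint_left]
    rintro y ⟨x, hx, rfl⟩ h2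
    exact h2 ⟨x, Metric.ball_subset_closedBall hx, rfl⟩
  · intro y hy
    by_cases h : y ∈ f '' (Metric.closedBall (0 : Euc n) 1)
    · left
      obtain ⟨x, hx, rfl⟩ := h
      refine ⟨x, ?_, rfl⟩
      by_contra hxb
      have hxs : x ∈ Metric.sphere (0 : Euc n) 1 := by
        simp only [mem_closedBall_zero_iff, mem_ball_zero_iff, not_lt, mem_sphere_zero_iff_norm] at hx hxb ⊢
        linarith
      have : f x = x := by simp [hf, hs x hxs]
      rw [this] at hy
      exact hxb hy
    · right; exact h
  · refine ⟨f 0, hsub ⟨0, by simp, rfl⟩, 0, by simp, rfl⟩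

lemma no_retraction {n : ℕ} (r : Euc n → Euc n) (O : Set (Euc n)) (hO : IsOpen O)
    (hBO : Metric.closedBall (0 : Euc n) 1 ⊆ O) (hrC : ContDiffOn ℝ 1 r O)
    (hr : ∀ x ∈ Metric.closedBall (0 : Euc n) 1, ‖r x‖ = 1)
    (hs : ∀ x ∈ Metric.sphere (0 : Euc n) 1, r x = x) : False := by
  set g : Euc n → Euc n := fun x => r x - x with hg
  set D : Euc n → (Euc n →L[ℝ] Euc n) := fun x => fderiv ℝ g x with hD
  have hgC : ContDiffOn ℝ 1 g O := hrC.sub contDiffOn_id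
  have hDc : ContinuousOn D O := hgC.continuousOn_fderiv_of_isOpen hO le_rfl
  have hgd : ∀ x ∈ O, HasFDerivAt g (D x) x := fun x hx =>
    ((hgC.differentiableOn one_ne_zero).differentiableAt (hO.mem_nhds hx)).hasFDerivAt
  obtain ⟨C, hC⟩ := (isCompact_closedBall (0 : Euc n) 1).exists_bound_of_continuousOn (hDc.mono hBO)
  have hC0 : 0 ≤ C := (norm_nonneg _).trans (hC 0 (by simp))
  have hlip : ∀ x ∈ Metric.closedBall (0 : Euc n) 1, ∀ y ∈ Metric.closedBall (0 : Euc n) 1,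
      ‖g x - g y‖ ≤ C * ‖x - y‖ := fun x hx y hy =>
    (convex_closedBall (0 : Euc n) 1).norm_image_sub_le_of_norm_hasFDerivWithin_le
      (fun z hz => (hgd z (hBO hz)).hasFDerivWithinAt) hC hy hx
  set ε : ℝ := 1 / (2 * (C + 1)) with hε
  have hεpos : 0 < ε := by positivity
  have hεC : ε * C ≤ 1/2 := by
    rw [hε, div_mul_eq_mul_div, div_le_iff₀ (by positivity)]; linarith
  have hε1 : ε < 1 := by
    rw [hε, div_lt_one (by positivity)]; linarith
  have hDb : ContinuousOn D (Metric.closedBall (0 : Euc n) 1) := hDc.mono hBO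
  have hintg : ∀ t : ℝ, MeasureTheory.IntegrableOn (fun x => (1 + t • D x).det) (Metric.ball (0 : Euc n) 1) := by
    intro t
    have : ContinuousOn (fun x => (1 + t • D x).det) (Metric.closedBall (0 : Euc n) 1) := by
      refine ContinuousLinearMap.continuous_det.comp_continuousOn ?_
      exact continuousOn_const.add (hDb.const_smul t)
    exact (this.integrableOn_compact (isCompact_closedBall _ _)).mono_set Metric.ball_subset_closedBall
  have hvol : ∀ t : ℝ, 0 ≤ t → t ≤ ε → ∫ x in Metric.ball (0 : Euc n) 1, (1 + t • D x).det
      = MeasureTheory.volume.real (Metric.ball (0 : Euc n) 1) := by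
    intro t ht hte
    have htC : t * C ≤ 1/2 := by nlinarith
    obtain ⟨hinj, him⟩ := pert_image g t C ht (by linarith) hC0 htC
      (fun x hx => by simpa [hg] using hr x hx) (fun x hx => by simp [hg, hs x hx]) hlip
    have hfd : ∀ x ∈ Metric.ball (0 : Euc n) 1, HasFDerivWithinAt (fun x => x + t • g x) (1 + t • D x)
        (Metric.ball (0 : Euc n) 1) x := fun x hx =>
      ((hasFDerivAt_id x).add ((hgd x (hBO (Metric.ball_subset_closedBall hx))).const_smul t)).hasFDerivWithinAt
    have := MeasureTheory.integral_image_eq_integral_abs_det_fderiv_smul MeasureTheory.volume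
      Metric.isOpen_ball.measurableSet hfd hinj (fun _ => (1:ℝ))
    rw [him] at this
    simp only [smul_eq_mul, mul_one, MeasureTheory.integral_const, MeasureTheory.measureReal_restrict_apply_univ] at this
    rw [this]
    refine MeasureTheory.setIntegral_congr_fun Metric.isOpen_ball.measurableSet fun x hx => ?_
    have hDx := hC x (Metric.ball_subset_closedBall hx)
    have hp := det_pos_small (D x) t ht (by
      calc t * ‖D x‖ ≤ t * C := by gcongr
        _ < 1 := by linarith)
    exact (abs_of_pos hp).symm
  obtain ⟨w, hw1, hw2⟩ := det_interp' n ε hεpos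
  have h1 : ∫ x in Metric.ball (0 : Euc n) 1, (1 + D x).det
      = MeasureTheory.volume.real (Metric.ball (0 : Euc n) 1) := by
    have : ∀ x, (1 + D x).det = ∑ i : Fin (n+1), w i * (1 + (ε * i / (n+1)) • D x).det := fun x => hw2 _
    simp_rw [this]
    rw [MeasureTheory.integral_finsetSum _ (fun i _ => (hintg _).const_mul _)]
    have h2 : ∀ i : Fin (n+1), ∫ x in Metric.ball (0 : Euc n) 1, w i * (1 + (ε * i / (n+1)) • D x).det
      = w i * MeasureTheory.volume.real (Metric.ball (0 : Euc n) 1) := by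
      intro i
      rw [MeasureTheory.integral_const_mul, hvol]
      · positivity
      · rw [div_le_iff₀ (by positivity)]
        have : (i : ℝ) ≤ n := by exact_mod_cast Nat.lt_succ_iff.1 i.2
        nlinarith
    rw [Finset.sum_congr rfl fun i _ => h2 i, ← Finset.sum_mul, hw1, one_mul]
  have h0 : ∀ x ∈ Metric.ball (0 : Euc n) 1, (1 + D x).det = 0 := by
    intro x hx
    have hrd : HasFDerivAt r (1 + D x) x := by
      have := (hasFDerivAt_id x).add (hgd x (hBO (Metric.ball_subset_closedBall hx)))
      refine this.congr_of_eventuallyEq (Eventually.of_forall fun y => ?_)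
      simp [hg]
    have hsq : HasFDerivAt (fun y => ‖r y‖^2) (2 • (innerSL ℝ (r x)).comp (1 + D x)) x := hrd.norm_sq
    have hcst : HasFDerivAt (fun y => ‖r y‖^2) (0 : Euc n →L[ℝ] ℝ) x := by
      refine (hasFDerivAt_const (1:ℝ) x).congr_of_eventuallyEq ?_
      filter_upwards [Metric.isOpen_ball.mem_nhds hx] with y hy
      rw [hr y (Metric.ball_subset_closedBall hy)]; norm_num
    have heq := hsq.unique hcst
    have hrx : ‖r x‖ = 1 := hr x (Metric.ball_subset_closedBall hx)
    by_contra hne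
    have hu : IsUnit (LinearMap.det ((1 + D x : Euc n →L[ℝ] Euc n) : Euc n →ₗ[ℝ] Euc n)) := isUnit_iff_ne_zero.2 hne
    have hsurj : Function.Surjective ((1 + D x : Euc n →L[ℝ] Euc n) : Euc n →ₗ[ℝ] Euc n) := by
      have := LinearMap.isUnit_iff_isUnit_det ((1 + D x : Euc n →L[ℝ] Euc n) : Euc n →ₗ[ℝ] Euc n)
      have := this.2 hu
      exact ((Module.End.isUnit_iff _).1 this).2
    obtain ⟨v, hv⟩ := hsurj (r x)
    have h3 := congrArg (fun L : Euc n →L[ℝ] ℝ => L v) heq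
    have hv' : (1 + D x) v = r x := hv
    simp only [smul_apply, ContinuousLinearMap.comp_apply, hv', innerSL_apply_apply,
      real_inner_self_eq_norm_sq, hrx] at h3
    norm_num at h3
  have h2 : ∫ x in Metric.ball (0 : Euc n) 1, (1 + D x).det = 0 := by
    rw [MeasureTheory.setIntegral_congr_fun Metric.isOpen_ball.measurableSet h0]; simp
  rw [h2] at h1
  have hpos : 0 < MeasureTheory.volume.real (Metric.ball (0 : Euc n) 1) := by
    rw [MeasureTheory.measureReal_def]
    exact ENNReal.toReal_pos (Metric.measure_ball_pos _ _ one_pos).ne' MeasureTheory.measure_ball_lt_top.ne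
  linarith
end

section
open Filter Topology

lemma brouwer_smooth {n : ℕ} (g : Euc n → Euc n) (hg : ContDiff ℝ 1 g)
    (h1 : ∀ x ∈ Metric.closedBall (0 : Euc n) 1, ‖g x‖ < 1) :
    ∃ x ∈ Metric.closedBall (0 : Euc n) 1, g x = x := by
  by_contra hno
  push Not at hno
  set u : Euc n → Euc n := fun x => x - g x with hu
  set b : Euc n → ℝ := fun x => inner ℝ x (u x) with hb
  set disc : Euc n → ℝ := fun x => b x ^ 2 + ‖u x‖ ^ 2 * (1 - ‖x‖ ^ 2) with hdisc
  have huC : ContDiff ℝ 1 u := contDiff_id.sub hg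
  have hbC : ContDiff ℝ 1 b := contDiff_id.inner ℝ huC
  have hdC : ContDiff ℝ 1 disc := (hbC.pow 2).add ((huC.norm_sq ℝ).mul (contDiff_const.sub (contDiff_id.norm_sq ℝ)))
  set O : Set (Euc n) := {x | u x ≠ 0} ∩ {x | 0 < disc x} with hO
  have hOo : IsOpen O := (isOpen_ne_fun huC.continuous continuous_const).inter
    (isOpen_lt continuous_const hdC.continuous)
  set s : Euc n → ℝ := fun x => (-b x + √(disc x)) / ‖u x‖ ^ 2 with hs
  have hune : ∀ x ∈ Metric.closedBall (0 : Euc n) 1, u x ≠ 0 := fun x hx h =>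
    hno x hx (sub_eq_zero.1 h).symm
  have hbpos : ∀ x, ‖x‖ = 1 → 0 < b x := by
    intro x hx
    have hgx := h1 x (by simp [hx])
    have : inner ℝ x (g x) ≤ ‖x‖ * ‖g x‖ := real_inner_le_norm _ _
    simp only [hb, hu, inner_sub_right, real_inner_self_eq_norm_sq]
    rw [hx] at this ⊢
    linarith
  have hKO : Metric.closedBall (0 : Euc n) 1 ⊆ O := by
    intro x hx
    refine ⟨hune x hx, ?_⟩
    rw [mem_closedBall_zero_iff] at hx
    simp only [Set.mem_ofPred_eq, hdisc]
    rcases hx.lt_or_eq with h | h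
    · have : 0 < ‖u x‖ := norm_pos_iff.2 (hune x (by simpa using hx))
      have h2 : 0 < 1 - ‖x‖^2 := by nlinarith [norm_nonneg x]
      positivity
    · have := hbpos x h
      rw [h]; norm_num; exact pow_pos this 2
  refine no_retraction (fun x => x + s x • u x) O hOo hKO ?_ ?_ ?_
  · have hsq : ContDiffOn ℝ 1 (fun x => √(disc x)) O :=
      hdC.contDiffOn.sqrt (fun x hx => hx.2.ne')
    have hsC : ContDiffOn ℝ 1 s O := by
      refine (hbC.neg.contDiffOn.add hsq).div (huC.norm_sq ℝ).contDiffOn fun x hx => ?_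
      exact pow_ne_zero 2 (norm_ne_zero_iff.2 hx.1)
    exact contDiffOn_id.add (hsC.smul huC.contDiffOn)
  · intro x hx
    have hO := hKO hx
    have hd0 : 0 ≤ disc x := le_of_lt hO.2
    have hu0 : ‖u x‖ ≠ 0 := norm_ne_zero_iff.2 hO.1
    have hq := Real.sq_sqrt hd0
    have hsu : s x * ‖u x‖^2 = -b x + √(disc x) := by
      simp only [hs]; field_simp
    have : ‖x + s x • u x‖^2 = 1 := by
      rw [norm_add_sq_real, inner_smul_right, norm_smul, mul_pow, Real.norm_eq_abs, sq_abs]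
      have hb' : inner ℝ x (u x) = b x := rfl
      rw [hb']
      have hq2 : √(disc x)^2 = b x ^ 2 + ‖u x‖ ^ 2 * (1 - ‖x‖ ^ 2) := hq
      have : ‖u x‖^2 * (‖x‖^2 + 2 * (s x * b x) + s x ^2 * ‖u x‖^2 - 1) = 0 := by
        have e : √(disc x) = s x * ‖u x‖^2 + b x := by linarith
        rw [e] at hq2
        linear_combination hq2
      have := (mul_eq_zero.1 this).resolve_left (pow_ne_zero 2 hu0)
      linarith
    nlinarith [norm_nonneg (x + s x • u x)]
  · intro x hx
    rw [mem_sphere_zero_iff_norm] at hx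
    have hbp := hbpos x hx
    have : disc x = b x ^ 2 := by simp [hdisc, hx]
    have : s x = 0 := by
      simp only [hs, this, Real.sqrt_sq hbp.le]; simp
    simp [this]

lemma brouwer {n : ℕ} (F : Euc n → Euc n) (hF : Continuous F)
    (h1 : ∀ x ∈ Metric.closedBall (0 : Euc n) 1, ‖F x‖ ≤ 1) :
    ∃ x ∈ Metric.closedBall (0 : Euc n) 1, F x = x := by
  by_contra hno
  push Not at hno
  obtain ⟨x0, hx0, hmin⟩ := (isCompact_closedBall (0 : Euc n) 1).exists_isMinOn ⟨0, by simp⟩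
    ((hF.sub continuous_id).norm.continuousOn)
  set δ := ‖F x0 - x0‖ with hδ
  have hδ0 : 0 < δ := norm_pos_iff.2 (sub_ne_zero.2 (hno x0 hx0))
  set η := δ / 4 with hη
  have hη0 : 0 < η := by positivity
  obtain ⟨G, hG, hGF⟩ := hF.exists_contDiff_approx 1 (ε := fun _ => η) continuous_const (fun _ => hη0)
  have hGF' : ∀ x, ‖G x - F x‖ < η := fun x => by rw [← dist_eq_norm]; exact hGF.1 x
  have hGn : ∀ x ∈ Metric.closedBall (0 : Euc n) 1, ‖G x‖ < 1 + η := fun x hx => by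
    have := norm_sub_norm_le (G x) (F x)
    linarith [hGF' x, h1 x hx]
  obtain ⟨x, hx, hfix⟩ := brouwer_smooth (fun x => (1/(1+η)) • G x) (hG.const_smul _) (by
    intro x hx
    rw [norm_smul, Real.norm_of_nonneg (by positivity), one_div, inv_mul_lt_iff₀ (by positivity)]
    simpa using hGn x hx)
  have hG' : G x = (1+η) • x := by
    conv_rhs => rw [← hfix]
    rw [smul_smul, mul_one_div_cancel (by positivity), one_smul]
  have h3 : ‖F x - x‖ ≤ 2 * η := by
    have : F x - x = -(G x - F x) + η • x := by rw [hG', add_smul, one_smul]; abel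
    rw [this]
    refine (norm_add_le _ _).trans ?_
    rw [norm_neg, norm_smul, Real.norm_of_nonneg hη0.le]
    rw [mem_closedBall_zero_iff] at hx
    nlinarith [hGF' x]
  have : δ ≤ ‖F x - x‖ := hmin hx
  linarith

lemma inv_dim_aux {m n : ℕ} (f : Euc m → Euc n) (hf : Continuous f) (hi : Function.Injective f) :
    m ≤ n := by
  by_contra hlt
  push Not at hlt
  set K := Metric.closedBall (0 : Euc m) 1 with hK
  have : CompactSpace K := isCompact_iff_compactSpace.1 (isCompact_closedBall _ _)
  have hcl : IsClosedEmbedding (fun x : K => f x) :=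
    (hf.comp continuous_subtype_val).isClosedEmbedding (hi.comp Subtype.val_injective)
  obtain ⟨G, hG⟩ := ContinuousMap.exists_extension hcl (⟨Subtype.val, continuous_subtype_val⟩ : C(K, Euc m))
  have hGf : ∀ x ∈ K, G (f x) = x := fun x hx => by
    have := congrArg (fun g : C(K, Euc m) => g ⟨x, hx⟩) hG
    simpa using this
  obtain ⟨g, hg, hgG, -⟩ := G.continuous.exists_contDiff_approx 1 (ε := fun _ => 1/2) continuous_const
    (fun _ => by norm_num)
  have hd := ContDiff.dense_compl_range_of_finrank_lt_finrank (f := g) hg (by simpa using hlt)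
  obtain ⟨p, hp, hp2⟩ := hd.exists_dist_lt (0 : Euc m) (ε := 1/2) (by norm_num)
  obtain ⟨x, hx, hxf⟩ := brouwer (fun x => x - (g (f x) - p))
    (continuous_id.sub ((hg.continuous.comp hf).sub continuous_const)) (by
      intro x hx
      have e : x - (g (f x) - p) = -(g (f x) - G (f x)) + p := by rw [hGf x hx]; abel
      rw [e]
      refine (norm_add_le _ _).trans ?_
      have h1 := hgG (f x)
      rw [dist_eq_norm] at h1
      rw [dist_zero_left] at hp2
      rw [norm_neg]
      linarith)
  apply hp
  refine ⟨f x, ?_⟩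
  have : g (f x) - p = 0 := by simpa using hxf
  exact sub_eq_zero.1 this

lemma finrank_le_of_injOn {d : ℕ} (V W : Submodule ℝ (Euc d)) (h : Euc d → Euc d) (hc : Continuous h)
    (hi : Function.Injective h) (hm : ∀ x ∈ V, h x ∈ W) :
    Module.finrank ℝ V ≤ Module.finrank ℝ W := by
  have eV : Euc (Module.finrank ℝ V) ≃L[ℝ] V := ContinuousLinearEquiv.ofFinrankEq (by simp)
  have eW : W ≃L[ℝ] Euc (Module.finrank ℝ W) := ContinuousLinearEquiv.ofFinrankEq (by simp)
  refine inv_dim_aux (fun x => eW ⟨h (eV x), hm _ (eV x).2⟩) ?_ ?_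
  · refine eW.continuous.comp (Continuous.subtype_mk ?_ _)
    exact hc.comp (continuous_subtype_val.comp eV.continuous)
  · intro x y hxy
    have := eW.injective hxy
    have := hi (Subtype.ext_iff.1 this)
    exact eV.injective (Subtype.ext this)

/-- Invariance of dimension. -/
lemma finrank_eq_of_image {d : ℕ} (V W : Submodule ℝ (Euc d)) (h : Euc d ≃ₜ Euc d)
    (hVW : ∀ x, x ∈ V ↔ h x ∈ W) : Module.finrank ℝ V = Module.finrank ℝ W := by
  refine le_antisymm (finrank_le_of_injOn V W h h.continuous h.injective fun x hx => (hVW x).1 hx)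
    (finrank_le_of_injOn W V h.symm h.symm.continuous h.symm.injective fun x hx => ?_)
  rw [hVW]; simpa using hx
end

section
open Filter Topology Polynomial

/-- Taylor coefficient functional. -/
def tayF (l : ℂ) (k : ℕ) : ℝ[X] →ₗ[ℝ] ℂ where
  toFun q := (taylor l (q.map Complex.ofRealHom)).coeff k
  map_add' q r := by simp
  map_smul' a q := by
    rw [Polynomial.smul_eq_C_mul]
    simp [taylor_mul]

lemma tayF_X (l : ℂ) (k : ℕ) (q : ℝ[X]) :
    tayF l (k+1) (X * q) = l * tayF l (k+1) q + tayF l k q := by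
  simp [tayF, taylor_mul, add_mul]
  ring

lemma tayF_X0 (l : ℂ) (q : ℝ[X]) :
    tayF l 0 (X * q) = l * tayF l 0 q := by
  simp [tayF]

lemma tayF_zero_iff (l : ℂ) (e : ℕ) (q : ℝ[X]) :
    (∀ k < e, tayF l k q = 0) ↔ (X - C l)^e ∣ q.map Complex.ofRealHom := by
  have : (∀ k < e, tayF l k q = 0) ↔ X^e ∣ taylor l (q.map Complex.ofRealHom) := by
    rw [X_pow_dvd_iff]; rfl
  rw [this]
  constructor
  · rintro ⟨r, hr⟩
    refine ⟨taylor (-l) r, ?_⟩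
    have := congrArg (taylor (-l)) hr
    rw [taylor_taylor] at this
    simpa [taylor_mul, sub_eq_add_neg] using this
  · rintro ⟨r, hr⟩
    refine ⟨taylor l r, ?_⟩
    rw [hr]; simp [taylor_mul]

lemma dvd_of_root_pow (p : ℝ[X]) (hp : Irreducible p) (l : ℂ) (hl : aeval l p = 0) (e : ℕ) :
    ∀ q : ℝ[X], (X - C l)^e ∣ q.map Complex.ofRealHom → p^e ∣ q := by
  induction e with
  | zero => intro q _; simp
  | succ e ih =>
    intro q hq
    have hroot : aeval l q = 0 := by
      have h1 : (X - C l) ∣ q.map Complex.ofRealHom := (dvd_pow_self _ (Nat.succ_ne_zero e)).trans hq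
      rw [dvd_iff_isRoot, IsRoot, eval_map] at h1
      exact h1
    have hpq : p ∣ q := by
      have h1 := minpoly.dvd ℝ l hroot
      have h2 := minpoly.dvd ℝ l hl
      have hi : Irreducible (minpoly ℝ l) := minpoly.irreducible ⟨p * C p.leadingCoeff⁻¹, monic_mul_leadingCoeff_inv hp.ne_zero, by
        rw [← aeval_def, map_mul, hl, zero_mul]⟩
      exact ((hi.associated_of_dvd hp h2).symm.dvd).trans h1
    obtain ⟨q', rfl⟩ := hpq
    have hsep : (p.map Complex.ofRealHom).Separable := (hp.separable).map
    have hdv : (X - C l) ∣ p.map Complex.ofRealHom := by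
      rw [dvd_iff_isRoot, IsRoot, eval_map]; exact hl
    obtain ⟨r, hr⟩ := hdv
    have hcop : IsCoprime (X - C l) r := by
      rw [hr] at hsep
      exact hsep.isCoprime
    rw [Polynomial.map_mul, hr, pow_succ', mul_assoc, mul_dvd_mul_iff_left (X_sub_C_ne_zero l)] at hq
    have := (hcop.pow_left (m := e)).dvd_of_dvd_mul_left hq
    rw [pow_succ']
    exact mul_dvd_mul_left p (ih q' this)

lemma pow_dvd_of_dvd (p : ℝ[X]) (l : ℂ) (hl : aeval l p = 0) (e : ℕ)
    (q : ℝ[X]) (h : p^e ∣ q) : (X - C l)^e ∣ q.map Complex.ofRealHom := by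
  have hdv : (X - C l) ∣ p.map Complex.ofRealHom := by
    rw [dvd_iff_isRoot, IsRoot, eval_map]; exact hl
  have h2 := Polynomial.map_dvd Complex.ofRealHom h
  rw [Polynomial.map_pow] at h2
  exact (pow_dvd_pow_of_dvd hdv e).trans h2

lemma exists_root_im (p : ℝ[X]) (hp : Irreducible p) : ∃ l : ℂ, 0 ≤ l.im ∧ aeval l p = 0 := by
  have hd : (p.map Complex.ofRealHom).degree ≠ 0 := by
    rw [degree_map]
    intro h
    exact hp.not_isUnit (isUnit_iff_degree_eq_zero.2 h)
  obtain ⟨z, hz⟩ := IsAlgClosed.exists_root _ hd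
  have hz' : aeval z p = 0 := by
    rw [IsRoot, eval_map] at hz; exact hz
  rcases le_total 0 z.im with h | h
  · exact ⟨z, h, hz'⟩
  · refine ⟨(starRingEnd ℂ) z, by simpa using h, ?_⟩
    rw [aeval_conj, hz']; simp

def Kval (l : ℂ) : Submodule ℝ ℂ where
  carrier := {z | l.im = 0 → z.im = 0}
  add_mem' := by intro a b ha hb h; simp [ha h, hb h]
  zero_mem' := by intro _; simp
  smul_mem' := by intro c x hx h; simp [hx h]

/-- dimension of the value space -/
def ed (l : ℂ) : ℕ := if l.im = 0 then 1 else 2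

lemma finrank_Kval (l : ℂ) : Module.finrank ℝ (Kval l) = ed l := by
  by_cases h : l.im = 0
  · have e : Kval l ≃ₗ[ℝ] ℝ := 
      { toFun := fun z => z.1.re
        map_add' := by intros; simp
        map_smul' := by intros; simp
        invFun := fun x => ⟨x, fun _ => by simp⟩
        left_inv := fun z => Subtype.ext (Complex.ext (by simp) (by simpa using (z.2 h).symm))
        right_inv := fun x => by simp }
    rw [e.finrank_eq]; simp [ed, h]
  · have : Kval l = ⊤ := by
      ext z; simp only [Submodule.mem_top, iff_true]; exact fun h' => absurd h' h
    rw [this, finrank_top, Complex.finrank_real_complex]; simp [ed, h]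

lemma tayF_mem (l : ℂ) (k : ℕ) (q : ℝ[X]) : tayF l k q ∈ Kval l := by
  intro h
  have : l = ((l.re : ℝ) : ℂ) := Complex.ext (by simp) (by simpa using h)
  show ((taylor l (q.map Complex.ofRealHom)).coeff k).im = 0
  have h2 : taylor l (q.map Complex.ofRealHom) = (taylor l.re q).map Complex.ofRealHom := by
    conv_lhs => rw [this]
    rw [taylor_apply, taylor_apply, map_comp]; simp
  rw [h2, coeff_map]; simp

lemma ed_le_natDegree (p : ℝ[X]) (hp : Irreducible p) (l : ℂ) (hl : aeval l p = 0) : ed l ≤ p.natDegree := by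
  have h1 : 1 ≤ p.natDegree := hp.natDegree_pos
  by_contra hlt
  push Not at hlt
  unfold ed at hlt
  split_ifs at hlt with h
  · omega
  · have : p.natDegree = 1 := by omega
    obtain ⟨a, ha, b, hab⟩ := natDegree_eq_one.1 this
    rw [← hab] at hl
    simp at hl
    apply h
    have := congrArg Complex.im hl
    simp at this
    exact this.resolve_left ha

/-- One block of the normal form. -/
lemma block_exists (p : ℝ[X]) (hp : Irreducible p) (e : ℕ) :
    ∃ (l : ℂ) (c : ℕ → (ℝ[X] ⧸ (Submodule.span ℝ[X] {p^e} : Submodule ℝ[X] ℝ[X])) →ₗ[ℝ] ℂ), 0 ≤ l.im ∧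
      (∀ j x, c j ((X : ℝ[X]) • x) = l * c j x + c (j+1) x) ∧
      (∀ j x, e ≤ j → c j x = 0) ∧ (∀ j x, l.im = 0 → (c j x).im = 0) ∧
      (∀ x, (∀ j < e, c j x = 0) → x = 0) ∧
      (∀ a : ℕ → ℂ, (∀ j, l.im = 0 → (a j).im = 0) → ∃ x, ∀ j < e, c j x = a j) := by
  obtain ⟨l, hl0, hl⟩ := exists_root_im p hp
  set I : Submodule ℝ[X] ℝ[X] := Submodule.span ℝ[X] {p^e} with hI
  have hmem : ∀ q, q ∈ I ↔ ∀ k < e, tayF l k q = 0 := by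
    intro q
    rw [tayF_zero_iff, hI, Submodule.mem_span_singleton]
    constructor
    · rintro ⟨a, rfl⟩
      exact pow_dvd_of_dvd p l hl e _ ⟨a, by simp [mul_comm]⟩
    · intro h
      obtain ⟨a, ha⟩ := dvd_of_root_pow p hp l hl e q h
      exact ⟨a, by rw [ha, smul_eq_mul, mul_comm]⟩
  have hle : ∀ k < e, I.restrictScalars ℝ ≤ LinearMap.ker (tayF l k) := by
    intro k hk q hq
    exact (hmem q).1 hq k hk
  set c : ℕ → (ℝ[X] ⧸ I) →ₗ[ℝ] ℂ := fun j => if h : j < e then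
    ((I.restrictScalars ℝ).liftQ (tayF l (e-1-j)) (hle _ (by omega))).comp
      (Submodule.Quotient.restrictScalarsEquiv ℝ I).symm.toLinearMap else 0 with hc
  have hcq : ∀ j < e, ∀ q : ℝ[X], c j (Submodule.Quotient.mk q) = tayF l (e-1-j) q := by
    intro j hj q
    simp only [hc, hj, dif_pos]
    rfl
  have hc0 : ∀ j, e ≤ j → ∀ x, c j x = 0 := by
    intro j hj x
    simp only [hc, not_lt.2 hj, dif_neg, not_false_iff]; rfl
  have hcm : ∀ j x, c j x ∈ Kval l := by
    intro j x
    obtain ⟨q, rfl⟩ := Submodule.Quotient.mk_surjective _ x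
    by_cases hj : j < e
    · rw [hcq j hj]; exact tayF_mem _ _ _
    · rw [hc0 j (not_lt.1 hj)]; exact Submodule.zero_mem _
  have hinj : ∀ x, (∀ j < e, c j x = 0) → x = 0 := by
    intro x hx
    obtain ⟨q, rfl⟩ := Submodule.Quotient.mk_surjective _ x
    rw [Submodule.Quotient.mk_eq_zero, hmem]
    intro k hk
    have := hx (e-1-k) (by omega)
    rw [hcq _ (by omega)] at this
    rwa [show e - 1 - (e-1-k) = k by omega] at this
  refine ⟨l, c, hl0, ?_, fun j x h => hc0 j h x, fun j x => hcm j x, hinj, ?_⟩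
  · intro j x
    obtain ⟨q, rfl⟩ := Submodule.Quotient.mk_surjective _ x
    rw [← Submodule.Quotient.mk_smul, smul_eq_mul]
    by_cases hj : j < e
    · by_cases hj1 : j + 1 < e
      · rw [hcq j hj, hcq j hj, hcq _ hj1, show e - 1 - j = (e - 1 - (j+1)) + 1 by omega, tayF_X]
      · rw [hcq j hj, hcq j hj, hc0 _ (not_lt.1 hj1), show e - 1 - j = 0 by omega, tayF_X0, add_zero]
    · rw [hc0 _ (not_lt.1 hj), hc0 _ (not_lt.1 hj), hc0 (j+1) (by omega)]; simp
  · intro a ha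
    let T : (ℝ[X] ⧸ I) →ₗ[ℝ] (Fin e → Kval l) :=
      LinearMap.pi fun j => (c j).codRestrict (Kval l) (hcm j)
    have hT : Function.Injective T := by
      rw [← LinearMap.ker_eq_bot, LinearMap.ker_eq_bot']
      intro x hx
      apply hinj
      intro j hj
      have := congrFun hx ⟨j, hj⟩
      exact congrArg Subtype.val this
    have hfin : Module.Finite ℝ (ℝ[X] ⧸ I) := Module.Finite.of_injective T hT
    have hdim : Module.finrank ℝ (ℝ[X] ⧸ I) = Module.finrank ℝ (Fin e → Kval l) := by
      have h1 : Module.finrank ℝ (ℝ[X] ⧸ I) = (p^e).natDegree := finrank_quotient_span_eq_natDegree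
      have h2 : Module.finrank ℝ (Fin e → Kval l) = e * ed l := by
        rw [Module.finrank_pi_fintype]; simp [finrank_Kval]
      refine le_antisymm (LinearMap.finrank_le_finrank_of_injective hT) ?_
      rw [h1, h2, natDegree_pow]
      exact Nat.mul_le_mul_left _ (ed_le_natDegree p hp l hl)
    have hsurj := (LinearMap.injective_iff_surjective_of_finrank_eq_finrank hdim).1 hT
    obtain ⟨x, hx⟩ := hsurj (fun j => ⟨a j, ha j⟩)
    refine ⟨x, fun j hj => ?_⟩
    have := congrFun hx ⟨j, hj⟩
    exact congrArg Subtype.val this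

/-- The generator as an operator. -/
abbrev opA (A : Matrix (Fin d) (Fin d) ℝ) : Euc d →ₗ[ℝ] Euc d := Matrix.toEuclideanLin A

/-- Real Jordan normal form coordinates for `A`. -/
structure NF (A : Matrix (Fin d) (Fin d) ℝ) where
  β : Type
  fin : Fintype β
  lam : β → ℂ
  m : β → ℕ
  c : β → ℕ → Euc d →ₗ[ℝ] ℂ
  im_nonneg : ∀ b, 0 ≤ (lam b).im
  c_A : ∀ b j x, c b j (opA A x) = lam b * c b j x + c b (j+1) x
  c_top : ∀ b j x, m b ≤ j → c b j x = 0
  c_real : ∀ b j x, (lam b).im = 0 → (c b j x).im = 0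
  inj : ∀ x, (∀ b j, j < m b → c b j x = 0) → x = 0
  surj : ∀ a : β → ℕ → ℂ, (∀ b j, (lam b).im = 0 → (a b j).im = 0) →
    ∃ x, ∀ b j, j < m b → c b j x = a b j

theorem exists_NF (A : Matrix (Fin d) (Fin d) ℝ) : Nonempty (NF A) := by
  classical
  obtain ⟨ι, hι, p, hp, e, ⟨E⟩⟩ := Module.equiv_directSum_of_isTorsion
    (R := ℝ[X]) (M := Module.AEval' (opA A))
    (Module.AEval.isTorsion_of_finiteDimensional ℝ (Euc d) (opA A))
  choose l c h0 hX htop hre hinj hsurj using fun i => block_exists (p i) (hp i) (e i)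
  let F : Euc d ≃ₗ[ℝ] (∀ i, ℝ[X] ⧸ (Submodule.span ℝ[X] {p i ^ e i} : Submodule ℝ[X] ℝ[X])) :=
    (Module.AEval'.of (opA A)).trans ((E.trans (DirectSum.linearEquivFunOnFintype ℝ[X] ι _)).restrictScalars ℝ)
  have hF : ∀ x, F (opA A x) = (X : ℝ[X]) • F x := by
    intro x
    simp only [F, LinearEquiv.trans_apply, LinearEquiv.restrictScalars_apply]
    rw [← Module.AEval'.X_smul_of, map_smul, map_smul]
  refine ⟨⟨ι, hι, l, e, fun i j => (c i j).comp ((LinearMap.proj i).comp F.toLinearMap), h0, ?_, ?_, ?_, ?_, ?_⟩⟩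
  · intro i j x
    have := hX i j (F x i)
    simp only [LinearMap.comp_apply, LinearEquiv.coe_coe, LinearMap.proj_apply, hF]
    exact this
  · intro i j x h
    exact htop i j _ h
  · intro i j x h
    exact hre i j _ h
  · intro x hx
    have : F x = 0 := by
      funext i
      exact hinj i _ (hx i)
    simpa using this
  · intro a ha
    choose y hy using fun i => hsurj i (a i) (ha i)
    refine ⟨F.symm y, fun i j hj => ?_⟩
    simp only [LinearMap.comp_apply, LinearEquiv.coe_coe, LinearMap.proj_apply, LinearEquiv.apply_symm_apply]
    exact hy i j hj
end

section
open Filter Topology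

section basics
variable (A : Matrix (Fin d) (Fin d) ℝ)

lemma toEuclideanLin_mul_apply (M N : Matrix (Fin d) (Fin d) ℝ) (x : Euc d) :
    Matrix.toEuclideanLin (M * N) x = Matrix.toEuclideanLin M (Matrix.toEuclideanLin N x) := by
  simp [Matrix.toLpLin_apply, Matrix.mulVec_mulVec]

@[simp] lemma linFlow_zero (x : Euc d) : linFlow A 0 x = x := by
  simp [linFlow]

lemma linFlow_add (s t : ℝ) (x : Euc d) : linFlow A (s + t) x = linFlow A s (linFlow A t x) := by
  unfold linFlow
  rw [add_smul, Matrix.exp_add_of_commute]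
  · exact toEuclideanLin_mul_apply _ _ _
  · exact (Commute.refl A).smul_left s |>.smul_right t

/-- the flow as a linear map -/
def flowL (t : ℝ) : Euc d →ₗ[ℝ] Euc d := Matrix.toEuclideanLin (NormedSpace.exp (t • A))

lemma flowL_apply (t : ℝ) (x : Euc d) : flowL A t x = linFlow A t x := rfl

lemma linFlow_map_add (t : ℝ) (x y : Euc d) : linFlow A t (x + y) = linFlow A t x + linFlow A t y :=
  map_add (flowL A t) x y
lemma linFlow_map_sub (t : ℝ) (x y : Euc d) : linFlow A t (x - y) = linFlow A t x - linFlow A t y :=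
  map_sub (flowL A t) x y
lemma linFlow_map_smul (t a : ℝ) (x : Euc d) : linFlow A t (a • x) = a • linFlow A t x :=
  map_smul (flowL A t) a x
@[simp] lemma linFlow_map_zero (t : ℝ) : linFlow A t 0 = 0 := map_zero (flowL A t)

lemma linFlow_neg_left (t : ℝ) (x : Euc d) : linFlow (-A) t x = linFlow A (-t) x := by
  simp [linFlow]

lemma linFlow_smul_left (a t : ℝ) (x : Euc d) : linFlow (a • A) t x = linFlow A (a * t) x := by
  simp [linFlow, smul_smul, mul_comm]

@[simp] lemma linFlow_neg_cancel (t : ℝ) (x : Euc d) : linFlow A (-t) (linFlow A t x) = x := by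
  rw [← linFlow_add]; simp
@[simp] lemma linFlow_cancel_neg (t : ℝ) (x : Euc d) : linFlow A t (linFlow A (-t) x) = x := by
  rw [← linFlow_add]; simp

section
attribute [local instance] Matrix.linftyOpNormedRing Matrix.linftyOpNormedAlgebra Matrix.linftyOpNormedAddCommGroup Matrix.linftyOpNormedSpace

lemma hasDerivAt_linFlow (t : ℝ) (x : Euc d) :
    HasDerivAt (fun s => linFlow A s x) (opA A (linFlow A t x)) t := by
  have h := hasDerivAt_exp_smul_const' (𝕂 := ℝ) A t
  let T : Matrix (Fin d) (Fin d) ℝ →ₗ[ℝ] Euc d :=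
    (LinearMap.applyₗ x).comp (Matrix.toEuclideanLin (𝕜 := ℝ) (m := Fin d) (n := Fin d)).toLinearMap
  have h2 := (LinearMap.toContinuousLinearMap T).hasFDerivAt.comp_hasDerivAt t h
  refine h2.congr_deriv ?_
  exact toEuclideanLin_mul_apply _ _ _

end

lemma continuous_linFlow_t (x : Euc d) : Continuous fun t => linFlow A t x :=
  continuous_iff_continuousAt.2 fun t => (hasDerivAt_linFlow A t x).continuousAt

lemma continuous_linFlow_x (t : ℝ) : Continuous (linFlow A t) :=
  (flowL A t).continuous_of_finiteDimensional

lemma flow_bound : ∃ K : ℝ, 0 < K ∧ ∀ t x, ‖linFlow A t x‖ ≤ Real.exp (K * |t|) * ‖x‖ := by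
  let T := LinearMap.toContinuousLinearMap (opA A)
  refine ⟨‖T‖ + 1, by positivity, ?_⟩
  have key : ∀ (B : Matrix (Fin d) (Fin d) ℝ) (C : ℝ), 0 ≤ C → (∀ y, ‖opA B y‖ ≤ C * ‖y‖) → ∀ t, 0 ≤ t → ∀ x, ‖linFlow B t x‖ ≤ Real.exp (C * t) * ‖x‖ := by
    intro B C hC hB t ht x
    have := norm_le_gronwallBound_of_norm_deriv_right_le (f := fun s => linFlow B s x)
      (f' := fun s => opA B (linFlow B s x)) (δ := ‖x‖) (K := C) (ε := 0) (a := 0) (b := t)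
      (continuous_linFlow_t B x).continuousOn (fun s _ => (hasDerivAt_linFlow B s x).hasDerivWithinAt)
      (by simp) (fun s _ => by simpa using hB _) t ⟨ht, le_rfl⟩
    rw [gronwallBound_ε0] at this
    simpa [mul_comm] using this
  have hT : ∀ y, ‖opA A y‖ ≤ (‖T‖ + 1) * ‖y‖ := fun y => by
    have := T.le_opNorm y
    have h2 : T y = opA A y := rfl
    rw [h2] at this
    nlinarith [norm_nonneg y]
  intro t x
  rcases le_total 0 t with h | h
  · rw [abs_of_nonneg h]; exact key A _ (by positivity) hT t h x
  · rw [abs_of_nonpos h]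
    have := key (-A) (‖T‖+1) (by positivity) (fun y => by simpa using hT y) (-t) (by linarith) x
    simpa [linFlow_neg_left] using this

lemma continuous_linFlow : Continuous fun p : ℝ × Euc d => linFlow A p.1 p.2 := by
  obtain ⟨K, hK, hb⟩ := flow_bound A
  rw [continuous_iff_continuousAt]
  rintro ⟨t, x⟩
  rw [ContinuousAt, tendsto_iff_norm_sub_tendsto_zero]
  have h1 : Tendsto (fun p : ℝ × Euc d => Real.exp (K * |p.1|) * ‖p.2 - x‖ + ‖linFlow A p.1 x - linFlow A t x‖)
      (𝓝 (t, x)) (𝓝 (Real.exp (K * |t|) * ‖x - x‖ + ‖linFlow A t x - linFlow A t x‖)) := by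
    have hc : Continuous (fun p : ℝ × Euc d => Real.exp (K * |p.1|) * ‖p.2 - x‖ + ‖linFlow A p.1 x - linFlow A t x‖) := by
      have := (continuous_linFlow_t A x).comp (continuous_fst (X := ℝ) (Y := Euc d))
      have h2 : Continuous fun p : ℝ × Euc d => linFlow A p.1 x := this
      fun_prop
    exact hc.tendsto _
  simp only [sub_self, norm_zero, mul_zero, add_zero] at h1
  refine squeeze_zero (fun _ => norm_nonneg _) (fun p => ?_) h1
  have : linFlow A p.1 p.2 - linFlow A t x = linFlow A p.1 (p.2 - x) + (linFlow A p.1 x - linFlow A t x) := by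
    rw [linFlow_map_sub]; abel
  rw [this]
  exact (norm_add_le _ _).trans (add_le_add_left (hb _ _) _)

attribute [local irreducible] linFlow in
lemma cont_linFlow {Z : Type*} [TopologicalSpace Z] {f : Z → ℝ} {g : Z → Euc d}
    (hf : Continuous f) (hg : Continuous g) : Continuous fun z => linFlow A (f z) (g z) := by
  have h1 : Continuous fun z => (f z, g z) := hf.prodMk hg
  exact (continuous_linFlow A).comp h1

attribute [local irreducible] linFlow in
lemma tendsto_linFlow {Z : Type*} {l : Filter Z} {f : Z → ℝ} {g : Z → Euc d} {t : ℝ} {x : Euc d}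
    (hf : Tendsto f l (𝓝 t)) (hg : Tendsto g l (𝓝 x)) :
    Tendsto (fun z => linFlow A (f z) (g z)) l (𝓝 (linFlow A t x)) := by
  have h1 : Tendsto (fun z => (f z, g z)) l (𝓝 (t, x)) := hf.prodMk_nhds hg
  exact ((continuous_linFlow A).tendsto (t, x)).comp h1

lemma linFlow_opA (t : ℝ) (x : Euc d) : linFlow A t (opA A x) = opA A (linFlow A t x) := by
  have h1 := hasDerivAt_linFlow A t x
  have h2 : HasDerivAt (fun s => linFlow A s x) (linFlow A t (opA A x)) t := by
    have h3 := hasDerivAt_linFlow A 0 x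
    simp only [linFlow_zero] at h3
    have h4 : HasDerivAt (fun s : ℝ => linFlow A (s - t) x) (opA A x) t := by
      exact HasDerivAt.comp_sub_const t t (by simpa using h3)
    have h5 := (LinearMap.toContinuousLinearMap (flowL A t)).hasFDerivAt.comp_hasDerivAt t h4
    refine (h5.congr_of_eventuallyEq (Eventually.of_forall fun s => ?_))
    show linFlow A s x = linFlow A t (linFlow A (s - t) x)
    rw [← linFlow_add]; congr 1; ring
  exact h2.unique h1

lemma isFixedPt_iff (x : Euc d) : IsFixedPt A x ↔ opA A x = 0 := by
  constructor
  · intro h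
    have h1 := hasDerivAt_linFlow A 0 x
    have h2 : (fun s => linFlow A s x) = fun _ => x := funext h
    rw [h2, linFlow_zero] at h1
    exact h1.unique (hasDerivAt_const _ _)
  · intro h t
    have h0 : ∀ s, HasDerivAt (fun s => linFlow A s x) 0 s := fun s => by
      have := hasDerivAt_linFlow A s x
      rwa [← linFlow_opA, h, linFlow_map_zero] at this
    have := is_const_of_deriv_eq_zero (f := fun s => linFlow A s x) (fun s => (h0 s).differentiableAt)
      (fun s => (h0 s).deriv) t 0
    simpa using this
end basics
end

section
open Filter Topology
attribute [local irreducible] linFlow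

lemma chain_formula (F : ℕ → ℝ → ℂ) (m : ℕ) (h : ∀ j s, HasDerivAt (F j) (F (j+1) s) s)
    (h0 : ∀ j, m ≤ j → ∀ s, F j s = 0) :
    ∀ N j, m ≤ j + N → ∀ s, F j s = ∑ i ∈ Finset.range N, ((s:ℂ)^i / (i.factorial : ℂ)) * F (j+i) 0 := by
  intro N
  induction N with
  | zero => intro j hj s; simp [h0 j (by omega) s]
  | succ N ih =>
    intro j hj s
    have hd : ∀ i : ℕ, ∀ s : ℝ, HasDerivAt (fun s : ℝ => ((s:ℂ)^(i+1) / ((i+1).factorial : ℂ)))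
        ((s:ℂ)^i / (i.factorial : ℂ)) s := by
      intro i s
      have := ((Complex.ofRealCLM.hasDerivAt (x := s)).pow (i+1)).div_const ((i+1).factorial : ℂ)
      refine this.congr_deriv ?_
      simp only [Complex.ofRealCLM_apply, Nat.factorial_succ, Nat.cast_mul, add_tsub_cancel_right, Complex.ofReal_one, mul_one]
      have : ((i+1 : ℕ) : ℂ) ≠ 0 := Nat.cast_ne_zero.2 (by omega)
      have h2 : (i.factorial : ℂ) ≠ 0 := Nat.cast_ne_zero.2 (Nat.factorial_ne_zero i)
      field_simp
    let G : ℝ → ℂ := fun s => ∑ i ∈ Finset.range (N+1), ((s:ℂ)^i / (i.factorial : ℂ)) * F (j+i) 0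
    have hG : ∀ s, HasDerivAt G (F (j+1) s) s := by
      intro s
      rw [ih (j+1) (by omega) s]
      have e : G = fun s : ℝ => (∑ i ∈ Finset.range N, ((s:ℂ)^(i+1) / ((i+1).factorial : ℂ)) * F (j+(i+1)) 0) + F j 0 := by
        funext s
        simp only [G]
        rw [Finset.sum_range_succ']; simp
      rw [e]
      have h1 := HasDerivAt.fun_sum (u := Finset.range N) (fun i _ => (hd i s).mul_const (F (j+(i+1)) 0))
      refine (h1.add_const _).congr_deriv ?_
      exact Finset.sum_congr rfl fun i _ => by rw [show j + (i+1) = j + 1 + i by ring]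
    have hdiff : ∀ s, HasDerivAt (fun s => F j s - G s) 0 s := fun s => by
      simpa using (h j s).fun_sub (hG s)
    have := is_const_of_deriv_eq_zero (fun s => (hdiff s).differentiableAt) (fun s => (hdiff s).deriv) s 0
    have hG0 : G 0 = F j 0 := by
      simp only [G]
      rw [Finset.sum_range_succ']; simp
    rw [hG0, sub_self] at this
    exact sub_eq_zero.1 this

namespace NF
variable {A : Matrix (Fin d) (Fin d) ℝ} (N : NF A)
attribute [instance] NF.fin

lemma flow (b : N.β) (j : ℕ) (K : ℕ) (hK : N.m b ≤ j + K) (t : ℝ) (x : Euc d) :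
    N.c b j (linFlow A t x) = Complex.exp (N.lam b * t) *
      ∑ i ∈ Finset.range K, ((t:ℂ)^i / (i.factorial : ℂ)) * N.c b (j+i) x := by
  have hcd : ∀ j s, HasDerivAt (fun s : ℝ => N.c b j (linFlow A s x)) (N.lam b * N.c b j (linFlow A s x) + N.c b (j+1) (linFlow A s x)) s := by
    intro j s
    rw [← N.c_A]
    exact (LinearMap.toContinuousLinearMap (N.c b j)).hasFDerivAt.comp_hasDerivAt s (hasDerivAt_linFlow A s x)
  have hexp : ∀ s : ℝ, HasDerivAt (fun s : ℝ => Complex.exp (-(N.lam b) * s)) (Complex.exp (-(N.lam b) * s) * (-(N.lam b) * 1)) s := by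
    intro s
    exact ((Complex.ofRealCLM.hasDerivAt (x := s)).const_mul (-(N.lam b))).cexp
  have := chain_formula (fun j s => Complex.exp (-(N.lam b) * s) * N.c b j (linFlow A s x)) (N.m b)
    (fun j s => ((hexp s).mul (hcd j s)).congr_deriv (by ring))
    (fun j hj s => by simp [N.c_top b j _ hj]) K j hK t
  simp only [linFlow_zero, Complex.ofReal_zero, mul_zero, Complex.exp_zero, one_mul] at this
  rw [← this, ← mul_assoc, ← Complex.exp_add]
  simp

/-- coordinate map -/
def cm : Euc d →ₗ[ℝ] (∀ b, Fin (N.m b) → ℂ) := LinearMap.pi fun b => LinearMap.pi fun j => N.c b j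

lemma cm_inj : Function.Injective N.cm := by
  rw [← LinearMap.ker_eq_bot, LinearMap.ker_eq_bot']
  intro x hx
  exact N.inj x fun b j hj => congrFun (congrFun hx b) ⟨j, hj⟩

lemma ext_c {x y : Euc d} (h : ∀ b j, j < N.m b → N.c b j x = N.c b j y) : x = y :=
  N.cm_inj (funext fun b => funext fun j => h b j j.2)

lemma cm_emb : IsClosedEmbedding N.cm :=
  LinearMap.isClosedEmbedding_of_injective (LinearMap.ker_eq_bot.2 N.cm_inj)

lemma continuous_c (b : N.β) (j : ℕ) : Continuous (N.c b j) := (N.c b j).continuous_of_finiteDimensional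

lemma tendsto_iff {Z : Type*} {l : Filter Z} {f : Z → Euc d} {x : Euc d} :
    Tendsto f l (𝓝 x) ↔ ∀ b j, j < N.m b → Tendsto (fun z => N.c b j (f z)) l (𝓝 (N.c b j x)) := by
  rw [N.cm_emb.tendsto_nhds_iff, tendsto_pi_nhds]
  constructor
  · intro h b j hj
    exact (tendsto_pi_nhds.1 (h b)) ⟨j, hj⟩
  · intro h b
    rw [tendsto_pi_nhds]
    intro j
    exact h b j j.2

lemma c_bound : ∃ C : ℝ, 0 < C ∧ ∀ b j x, ‖N.c b j x‖ ≤ C * ‖x‖ := by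
  let T := LinearMap.toContinuousLinearMap N.cm
  refine ⟨‖T‖ + 1, by positivity, fun b j x => ?_⟩
  by_cases hj : j < N.m b
  · have h1 : ‖N.cm x‖ ≤ ‖T‖ * ‖x‖ := T.le_opNorm x
    have h2 : ‖N.c b j x‖ ≤ ‖N.cm x‖ := (norm_le_pi_norm (N.cm x b) ⟨j, hj⟩).trans (norm_le_pi_norm (N.cm x) b)
    nlinarith [norm_nonneg x]
  · rw [N.c_top b j x (not_lt.1 hj), norm_zero]; positivity

lemma norm_bound : ∃ C : ℝ, 0 < C ∧ ∀ x R, 0 ≤ R → (∀ b j, j < N.m b → ‖N.c b j x‖ ≤ R) → ‖x‖ ≤ C * R := by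
  obtain ⟨K, hK, hL⟩ := N.cm.exists_antilipschitzWith (LinearMap.ker_eq_bot.2 N.cm_inj)
  refine ⟨K, by exact_mod_cast hK, fun x R hR h => ?_⟩
  have h1 := hL.le_mul_norm (map_zero N.cm) x
  refine h1.trans ?_
  gcongr
  rw [pi_norm_le_iff_of_nonneg hR]
  intro b
  rw [pi_norm_le_iff_of_nonneg hR]
  intro j
  exact h b j j.2

/-- coordinate subspaces -/
def Y (I : N.β → ℕ → Prop) : Submodule ℝ (Euc d) where
  carrier := {x | ∀ b j, ¬ I b j → N.c b j x = 0}
  add_mem' := by intro x y hx hy b j h; simp [hx b j h, hy b j h]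
  zero_mem' := by intro b j _; simp
  smul_mem' := by intro a x hx b j h; simp [hx b j h]

lemma mem_Y {I : N.β → ℕ → Prop} {x : Euc d} : x ∈ N.Y I ↔ ∀ b j, ¬ I b j → N.c b j x = 0 := Iff.rfl

open Classical in
lemma finrank_Y (I : N.β → ℕ → Prop) :
    Module.finrank ℝ (N.Y I) = ∑ b, ed (N.lam b) * ((Finset.range (N.m b)).filter (I b)).card := by
  let S := {p : (Σ b, Fin (N.m b)) // I p.1 p.2}
  let T : N.Y I →ₗ[ℝ] (∀ p : S, Kval (N.lam p.1.1)) :=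
    LinearMap.pi fun p => ((N.c p.1.1 p.1.2).comp (N.Y I).subtype).codRestrict _ (fun x => N.c_real _ _ _)
  have hT : Function.Bijective T := by
    constructor
    · rw [← LinearMap.ker_eq_bot, LinearMap.ker_eq_bot']
      intro x hx
      apply Subtype.ext
      apply N.inj
      intro b j hj
      by_cases h : I b j
      · exact congrArg Subtype.val (congrFun hx ⟨⟨b, ⟨j, hj⟩⟩, h⟩)
      · exact x.2 b j h
    · intro a
      obtain ⟨x, hx⟩ := N.surj (fun b j => if h : ∃ hj : j < N.m b, I b j then (a ⟨⟨b, ⟨j, h.1⟩⟩, h.2⟩ : ℂ) else 0) (by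
        intro b j h0
        split_ifs with h
        · exact (a ⟨⟨b, ⟨j, h.1⟩⟩, h.2⟩).2 h0
        · rfl)
      have hxm : x ∈ N.Y I := by
        intro b j h
        by_cases hj : j < N.m b
        · rw [hx b j hj, dif_neg (fun h' => h h'.2)]
        · exact N.c_top b j x (not_lt.1 hj)
      refine ⟨⟨x, hxm⟩, ?_⟩
      funext p
      obtain ⟨⟨b, ⟨j, hj⟩⟩, h⟩ := p
      apply Subtype.ext
      have := hx b j hj
      rw [dif_pos ⟨hj, h⟩] at this
      exact this
  rw [(LinearEquiv.ofBijective T hT).finrank_eq, Module.finrank_pi_fintype]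
  simp only [finrank_Kval]
  have h1 : ∑ p : S, ed (N.lam p.1.1) = ∑ p : (Σ b, Fin (N.m b)), if I p.1 p.2 then ed (N.lam p.1) else 0 := by
    rw [← Finset.sum_filter]
    exact (Finset.sum_subtype (Finset.univ.filter fun p : (Σ b, Fin (N.m b)) => I p.1 p.2) (by simp) (fun p => ed (N.lam p.1))).symm
  rw [h1, Fintype.sum_sigma]
  refine Finset.sum_congr rfl fun b _ => ?_
  rw [Fin.sum_univ_eq_sum_range (fun j => if I b j then ed (N.lam b) else 0), ← Finset.sum_filter, Finset.sum_const, smul_eq_mul, mul_comm]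

end NF
end

section
open Filter Topology
attribute [local irreducible] linFlow

/-- the j-th jet at time `t` of the polynomial with jet `x` at 0 -/
def jet (k : ℕ) (t : ℝ) (x : ℕ → ℂ) (j : ℕ) : ℂ :=
  ∑ i ∈ Finset.range k, ((t:ℂ)^i / (i.factorial : ℂ)) * x (j+i)

open Polynomial in
lemma hermite_inj (r r' : ℕ) (x : ℕ → ℂ) (hx : ∀ i, r + r' ≤ i → x i = 0)
    (h0 : ∀ i < r, x i = 0) (h1 : ∀ i < r', jet (r+r') 1 x i = 0) : ∀ i, x i = 0 := by
  let P : (ℕ → ℂ) → ℂ[X] := fun x => ∑ i ∈ Finset.range (r+r'), C (x i / (i.factorial : ℂ)) * X^i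
  have hder : ∀ y : ℕ → ℂ, (y (r+r') = 0) → derivative (P y) = P (fun i => y (i+1)) := by
    intro y hy
    simp only [P, derivative_sum]
    have e1 : ∑ i ∈ Finset.range (r+r'), derivative (C (y i / (i.factorial : ℂ)) * X^i)
      = ∑ i ∈ Finset.range (r+r'+1), derivative (C (y i / (i.factorial : ℂ)) * X^i) := by
      rw [Finset.sum_range_succ, hy]; simp
    rw [e1, Finset.sum_range_succ']
    simp only [pow_zero, mul_one, derivative_C, add_zero]
    refine Finset.sum_congr rfl fun i _ => ?_
    rw [derivative_C_mul_X_pow]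
    have : ((i+1 : ℕ) : ℂ) ≠ 0 := Nat.cast_ne_zero.2 (by omega)
    have h2 : (i.factorial : ℂ) ≠ 0 := Nat.cast_ne_zero.2 (Nat.factorial_ne_zero i)
    congr 2
    rw [Nat.factorial_succ]; push_cast at this ⊢; field_simp
  have hit : ∀ j, derivative^[j] (P x) = P (fun i => x (i+j)) := by
    intro j
    induction j with
    | zero => rfl
    | succ j ih =>
      rw [Function.iterate_succ_apply', ih, hder (fun i => x (i+j)) (hx _ (by omega))]
      congr 1; funext i; congr 1; ring
  have hev1 : ∀ j, (derivative^[j] (P x)).eval 1 = jet (r+r') 1 x j := by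
    intro j
    rw [hit]
    simp only [P, jet, eval_finsetSum, eval_mul, eval_C, eval_pow, eval_X]
    refine Finset.sum_congr rfl fun i _ => ?_
    rw [add_comm j i]; simp; ring
  have hcoeff : ∀ i < r + r', (P x).coeff i = x i / (i.factorial : ℂ) := by
    intro i hi
    simp only [P, finsetSum_coeff, coeff_C_mul, coeff_X_pow]
    simp [hi]
  have hP0 : P x = 0 := by
    by_contra hne
    have d0 : X^r ∣ P x := by
      rw [X_pow_dvd_iff]; intro i hi; rw [hcoeff i (by omega), h0 i hi, zero_div]
    have d1 : (X - C 1)^r' ∣ P x := by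
      rcases Nat.eq_zero_or_pos r' with h | h
      · simp [h]
      · rw [← le_rootMultiplicity_iff hne]
        have := (lt_rootMultiplicity_iff_isRoot_iterate_derivative (n := r'-1) (t := (1:ℂ)) hne).2
          (fun m hm => by rw [IsRoot, hev1, h1 m (by omega)])
        omega
    have hcop : IsCoprime ((X : ℂ[X])^r) ((X - C 1)^r') := by
      apply IsCoprime.pow
      have := pairwise_coprime_X_sub_C (K := ℂ) (s := id) Function.injective_id (i := (0:ℂ)) (j := 1) zero_ne_one
      simpa [Function.onFun] using this
    have hd := hcop.mul_dvd d0 d1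
    have hdeg : (P x).degree < (r + r' : ℕ) := by
      refine (degree_sum_le _ _).trans_lt ?_
      rw [Finset.sup_lt_iff (WithBot.bot_lt_coe _)]
      intro i hi
      refine (degree_C_mul_X_pow_le _ _).trans_lt ?_
      exact_mod_cast Finset.mem_range.1 hi
    have hd2 : (X^r * (X - C 1)^r' : ℂ[X]).degree = (r + r' : ℕ) := by
      rw [degree_mul, degree_X_pow, degree_pow, degree_X_sub_C]; simp
    exact hne (eq_zero_of_dvd_of_degree_lt hd (by rw [hd2]; exact hdeg))
  intro i
  by_cases hi : i < r + r'
  · have := hcoeff i hi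
    rw [hP0, coeff_zero, eq_comm, div_eq_zero_iff] at this
    exact this.resolve_right (Nat.cast_ne_zero.2 (Nat.factorial_ne_zero i))
  · exact hx i (not_lt.1 hi)

/-- extension by zero -/
def zext (k : ℕ) : (Fin k → ℂ) →ₗ[ℂ] (ℕ → ℂ) where
  toFun x i := if h : i < k then x ⟨i, h⟩ else 0
  map_add' x y := by funext i; by_cases h : i < k <;> simp [h]
  map_smul' a x := by funext i; by_cases h : i < k <;> simp [h]

lemma zext_ge (k : ℕ) (x) (i : ℕ) (h : k ≤ i) : zext k x i = 0 := by
  simp [zext, not_lt.2 h]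
lemma zext_lt (k : ℕ) (x) (i : Fin k) : zext k x i = x i := by
  simp [zext]

lemma jet_add (k t x y j) : jet k t (x + y) j = jet k t x j + jet k t y j := by
  simp [jet, mul_add, Finset.sum_add_distrib]
lemma jet_smul (k t) (a : ℂ) (x j) : jet k t (a • x) j = a * jet k t x j := by
  simp only [jet, Pi.smul_apply, smul_eq_mul, Finset.mul_sum]
  exact Finset.sum_congr rfl fun i _ => by ring

def hermT (r r' : ℕ) : (Fin (r+r') → ℂ) →ₗ[ℂ] ((Fin r → ℂ) × (Fin r' → ℂ)) where
  toFun x := (fun i => zext (r+r') x i, fun i => jet (r+r') 1 (zext (r+r') x) i)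
  map_add' x y := by
    ext i <;> simp [jet_add]
  map_smul' a x := by
    ext i <;> simp [jet_smul]

lemma hermT_inj (r r' : ℕ) : Function.Injective (hermT r r') := by
  rw [← LinearMap.ker_eq_bot, LinearMap.ker_eq_bot']
  intro x hx
  have h := hermite_inj r r' (zext (r+r') x) (fun i hi => zext_ge _ _ _ hi)
    (fun i hi => congrFun (congrArg Prod.fst hx) ⟨i, hi⟩)
    (fun i hi => congrFun (congrArg Prod.snd hx) ⟨i, hi⟩)
  funext i
  have := h i
  rwa [zext_lt] at this

lemma hermT_surj (r r' : ℕ) : Function.Surjective (hermT r r') := by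
  refine (LinearMap.injective_iff_surjective_of_finrank_eq_finrank ?_).1 (hermT_inj r r')
  simp

lemma jet_scale (k : ℕ) (t : ℝ) (x : ℕ → ℂ) (j : ℕ) :
    jet k 1 (fun i => (t:ℂ)^i * x i) j = (t:ℂ)^j * jet k t x j := by
  simp only [jet, Finset.mul_sum]
  refine Finset.sum_congr rfl fun i _ => ?_
  rw [pow_add]; simp; ring

lemma hermite_bound (r r' : ℕ) : ∃ M : ℝ, 0 < M ∧ ∀ (t : ℝ) (x : ℕ → ℂ), (∀ i, r + r' ≤ i → x i = 0) →
    ∀ j, |t|^j * ‖x j‖ ≤ M * (∑ i ∈ Finset.range r, |t|^i * ‖x i‖ + ∑ i ∈ Finset.range r', |t|^i * ‖jet (r+r') t x i‖) := by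
  obtain ⟨K, hK, hL⟩ := (hermT r r').exists_antilipschitzWith (LinearMap.ker_eq_bot.2 (hermT_inj r r'))
  refine ⟨K, by exact_mod_cast hK, fun t x hx j => ?_⟩
  set S := (∑ i ∈ Finset.range r, |t|^i * ‖x i‖ + ∑ i ∈ Finset.range r', |t|^i * ‖jet (r+r') t x i‖) with hS
  have hS1 : 0 ≤ ∑ i ∈ Finset.range r, |t|^i * ‖x i‖ := Finset.sum_nonneg fun i _ => by positivity
  have hS2 : 0 ≤ ∑ i ∈ Finset.range r', |t|^i * ‖jet (r+r') t x i‖ := Finset.sum_nonneg fun i _ => by positivity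
  by_cases hj : j < r + r'
  · let z : Fin (r+r') → ℂ := fun i => (t:ℂ)^(i:ℕ) * x i
    have hz : zext (r+r') z = fun i => (t:ℂ)^i * x i := by
      funext i
      by_cases h : i < r + r'
      · simp [zext, h, z]
      · rw [zext_ge _ _ _ (not_lt.1 h), hx i (not_lt.1 h), mul_zero]
    have h1 := hL.le_mul_norm (map_zero (hermT r r')) z
    have h2 : ‖hermT r r' z‖ ≤ S := by
      rw [Prod.norm_def]
      refine max_le ?_ ?_
      · rw [pi_norm_le_iff_of_nonneg (by positivity)]
        intro i
        have : (hermT r r' z).1 i = (t:ℂ)^(i:ℕ) * x i := by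
          show zext (r+r') z i = _
          rw [hz]
        rw [this, norm_mul, norm_pow, Complex.norm_real, Real.norm_eq_abs]
        refine (Finset.single_le_sum (f := fun i => |t|^i * ‖x i‖) (fun i _ => by positivity) (Finset.mem_range.2 i.2)).trans ?_
        linarith
      · rw [pi_norm_le_iff_of_nonneg (by positivity)]
        intro i
        have : (hermT r r' z).2 i = (t:ℂ)^(i:ℕ) * jet (r+r') t x i := by
          show jet (r+r') 1 (zext (r+r') z) i = _
          rw [hz, jet_scale]
        rw [this, norm_mul, norm_pow, Complex.norm_real, Real.norm_eq_abs]
        refine (Finset.single_le_sum (f := fun i => |t|^i * ‖jet (r+r') t x i‖) (fun i _ => by positivity) (Finset.mem_range.2 i.2)).trans ?_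
        linarith
    have h3 : |t|^j * ‖x j‖ ≤ ‖z‖ := by
      have := norm_le_pi_norm z ⟨j, hj⟩
      simpa [z, norm_mul, norm_pow, Complex.norm_real] using this
    calc |t|^j * ‖x j‖ ≤ ‖z‖ := h3
      _ ≤ K * ‖hermT r r' z‖ := h1
      _ ≤ K * S := by gcongr
  · rw [hx j (not_lt.1 hj)]; simp; positivity

lemma jet_re (k : ℕ) (t : ℝ) (x : ℕ → ℂ) (j : ℕ) :
    jet k t (fun i => ((x i).re : ℂ)) j = ((jet k t x j).re : ℂ) := by
  simp only [jet, Complex.re_sum, Complex.ofReal_sum]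
  refine Finset.sum_congr rfl fun i _ => ?_
  have : (t:ℂ)^i / (i.factorial:ℂ) = ((t^i / (i.factorial:ℝ) : ℝ) : ℂ) := by push_cast; rfl
  rw [this, Complex.re_ofReal_mul, Complex.ofReal_mul]

lemma hermite_solve (r r' : ℕ) (t : ℝ) (ht : t ≠ 0) (a : ℕ → ℂ) : ∃ x : ℕ → ℂ, (∀ i, r + r' ≤ i → x i = 0) ∧
    (∀ i < r, x i = a i) ∧ (∀ i < r', jet (r+r') t x i = 0) ∧ ((∀ i, (a i).im = 0) → ∀ i, (x i).im = 0) := by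
  have htc : (t:ℂ) ≠ 0 := by exact_mod_cast ht
  have main : ∃ x : ℕ → ℂ, (∀ i, r + r' ≤ i → x i = 0) ∧
    (∀ i < r, x i = a i) ∧ (∀ i < r', jet (r+r') t x i = 0) := by
    obtain ⟨z, hz⟩ := hermT_surj r r' (fun i => (t:ℂ)^(i:ℕ) * a i, 0)
    set x : ℕ → ℂ := fun i => ((t:ℂ)^i)⁻¹ * zext (r+r') z i with hx
    have hzx : zext (r+r') z = fun i => (t:ℂ)^i * x i := by
      funext i; simp only [hx]; field_simp
    refine ⟨x, fun i hi => by simp [hx, zext_ge _ _ _ hi], fun i hi => ?_, fun i hi => ?_⟩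
    · have : zext (r+r') z i = (t:ℂ)^i * a i := congrFun (congrArg Prod.fst hz) ⟨i, hi⟩
      simp only [hx, this]; field_simp
    · have : jet (r+r') 1 (zext (r+r') z) i = 0 := congrFun (congrArg Prod.snd hz) ⟨i, hi⟩
      rw [hzx, jet_scale] at this
      exact (mul_eq_zero.1 this).resolve_left (pow_ne_zero _ htc)
  obtain ⟨x, h1, h2, h3⟩ := main
  by_cases ha : ∀ i, (a i).im = 0
  · refine ⟨fun i => ((x i).re : ℂ), fun i hi => by simp [h1 i hi], fun i hi => ?_, fun i hi => ?_, fun _ i => by simp⟩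
    · show ((x i).re : ℂ) = a i
      rw [h2 i hi]; exact Complex.ext (by simp) (by simp [ha i])
    · rw [jet_re, h3 i hi]; simp
  · exact ⟨x, h1, h2, h3, fun h => absurd h ha⟩

lemma jet_bound (k : ℕ) (t : ℝ) (x : ℕ → ℂ) (Q : ℝ) (h : ∀ j, |t|^j * ‖x j‖ ≤ Q) (hQ : 0 ≤ Q) (j : ℕ) :
    |t|^j * ‖jet k t x j‖ ≤ k * Q := by
  rw [jet]
  calc |t|^j * ‖∑ i ∈ Finset.range k, ((t:ℂ)^i / (i.factorial : ℂ)) * x (j+i)‖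
      ≤ |t|^j * ∑ i ∈ Finset.range k, ‖((t:ℂ)^i / (i.factorial : ℂ)) * x (j+i)‖ := by
        gcongr; exact norm_sum_le _ _
    _ ≤ ∑ i ∈ Finset.range k, Q := by
        rw [Finset.mul_sum]
        refine Finset.sum_le_sum fun i _ => ?_
        have h1 := h (j+i)
        have hf : (1:ℝ) ≤ i.factorial := by exact_mod_cast Nat.factorial_pos i
        rw [norm_mul, norm_div, norm_pow, Complex.norm_real, Real.norm_eq_abs, Complex.norm_natCast]
        rw [pow_add] at h1
        have : |t|^j * (|t|^i / (i.factorial:ℝ) * ‖x (j+i)‖) = (|t|^j * |t|^i * ‖x (j+i)‖) / i.factorial := by ring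
        rw [this, div_le_iff₀ (by linarith)]
        nlinarith
    _ = k * Q := by simp

lemma sum_pow_bound (r : ℕ) (t : ℝ) (ht : 1 ≤ t) (f : ℕ → ℝ) (R : ℝ) (hf0 : ∀ i, 0 ≤ f i) (hR : ∀ i, f i ≤ R) :
    t * ∑ i ∈ Finset.range r, t^i * f i ≤ r * R * t^r := by
  rw [Finset.mul_sum]
  calc ∑ i ∈ Finset.range r, t * (t^i * f i) ≤ ∑ i ∈ Finset.range r, t^r * R := by
        refine Finset.sum_le_sum fun i hi => ?_
        have h1 : t^(i+1) ≤ t^r := pow_le_pow_right₀ ht (Finset.mem_range.1 hi)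
        have : t * (t^i * f i) = t^(i+1) * f i := by ring
        rw [this]
        have : 0 ≤ R := (hf0 0).trans (hR 0)
        exact mul_le_mul h1 (hR i) (hf0 i) (by positivity)
    _ = r * R * t^r := by simp; ring

lemma hermite_nec (r r' : ℕ) : ∃ M : ℝ, 0 < M ∧ ∀ (t : ℝ) (x : ℕ → ℂ) (R δ : ℝ), 1 ≤ |t| →
    (∀ i, r + r' ≤ i → x i = 0) → (∀ i, ‖x i‖ ≤ R) → (∀ i, ‖jet (r+r') t x i‖ ≤ δ) →
    (r' ≤ r + 1 → ∀ j, r ≤ j → ‖x j‖ ≤ M * (R / |t| + δ)) ∧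
    (r ≤ r' → ∀ j, r' ≤ j → ‖x j‖ ≤ M * ((R + δ) / |t|)) := by
  obtain ⟨M, hM, hb⟩ := hermite_bound r r'
  refine ⟨M * (r + r' + 1), by positivity, fun t x R δ ht hx hR hδ => ?_⟩
  have hR0 : 0 ≤ R := (norm_nonneg _).trans (hR 0)
  have hδ0 : 0 ≤ δ := (norm_nonneg _).trans (hδ 0)
  have ht0 : 0 < |t| := by linarith
  have key : ∀ j, |t| * (|t|^j * ‖x j‖) ≤ M * (r * R * |t|^r + r' * δ * |t|^r') := by
    intro j
    have h1 := hb t x hx j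
    have h2 := sum_pow_bound r |t| ht (fun i => ‖x i‖) R (fun i => norm_nonneg _) hR
    have h3 := sum_pow_bound r' |t| ht (fun i => ‖jet (r+r') t x i‖) δ (fun i => norm_nonneg _) hδ
    calc |t| * (|t|^j * ‖x j‖) ≤ |t| * (M * (∑ i ∈ Finset.range r, |t|^i * ‖x i‖ + ∑ i ∈ Finset.range r', |t|^i * ‖jet (r+r') t x i‖)) := mul_le_mul_of_nonneg_left h1 ht0.le
      _ = M * (|t| * (∑ i ∈ Finset.range r, |t|^i * ‖x i‖) + |t| * ∑ i ∈ Finset.range r', |t|^i * ‖jet (r+r') t x i‖) := by ring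
      _ ≤ _ := by gcongr
  constructor
  · intro hrr j hj
    have h1 : |t|^r ≤ |t|^j := pow_le_pow_right₀ ht hj
    have h2 : |t|^r' ≤ |t|^(j+1) := pow_le_pow_right₀ ht (by omega)
    have h3 : |t| * (|t|^j * ‖x j‖) ≤ |t| * |t|^j * (M * (r * R/|t| + r' * δ)) := by
      refine (key j).trans ?_
      calc M * (r * R * |t|^r + r' * δ * |t|^r') ≤ M * (r * R * |t|^j + r' * δ * |t|^(j+1)) := by gcongr
        _ = _ := by rw [pow_succ]; field_simp
    rw [← mul_assoc] at h3
    have h4 := le_of_mul_le_mul_left h3 (by positivity)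
    refine h4.trans ?_
    rw [mul_assoc]
    gcongr
    have : 0 ≤ R / |t| := by positivity
    have e : r * R / |t| = r * (R/|t|) := by ring
    rw [e]
    have : (0:ℝ) ≤ r := by positivity
    have : (0:ℝ) ≤ r' := by positivity
    nlinarith [mul_nonneg (show (0:ℝ) ≤ r from by positivity) hδ0, mul_nonneg (show (0:ℝ) ≤ r' from by positivity) (show 0 ≤ R/|t| by positivity)]
  · intro hrr j hj
    have h1 : |t|^r ≤ |t|^j := pow_le_pow_right₀ ht (by omega)
    have h2 : |t|^r' ≤ |t|^j := pow_le_pow_right₀ ht (by omega)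
    have h3 : |t| * (|t|^j * ‖x j‖) ≤ |t| * |t|^j * (M * ((r * R + r' * δ) / |t|)) := by
      refine (key j).trans ?_
      calc M * (r * R * |t|^r + r' * δ * |t|^r') ≤ M * (r * R * |t|^j + r' * δ * |t|^j) := by gcongr
        _ = _ := by field_simp
    rw [← mul_assoc] at h3
    have h4 := le_of_mul_le_mul_left h3 (by positivity)
    refine h4.trans ?_
    rw [mul_assoc]
    gcongr
    rw [← mul_div_assoc]
    gcongr
    have h5 : (0:ℝ) ≤ r * δ := by positivity
    have h6 : (0:ℝ) ≤ r' * R := by positivity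
    nlinarith

lemma hermite_suff (r r' : ℕ) (a : ℕ → ℂ) : ∃ C : ℝ, 0 < C ∧ ∀ t : ℝ, 1 ≤ t → ∃ x : ℕ → ℂ,
    (∀ i, r + r' ≤ i → x i = 0) ∧ (∀ i < r, x i = a i) ∧ ((∀ i, (a i).im = 0) → ∀ i, (x i).im = 0) ∧
    (∀ i, r ≤ i → ‖x i‖ ≤ C / t) ∧ (r ≤ r' + 1 → ∀ j, ‖jet (r+r') t x j‖ ≤ C) ∧
    (r ≤ r' → ∀ j, ‖jet (r+r') t x j‖ ≤ C / t) := by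
  obtain ⟨M, hM, hb⟩ := hermite_bound r r'
  set R := ∑ i ∈ Finset.range r, ‖a i‖ with hR
  have hR0 : 0 ≤ R := Finset.sum_nonneg fun i _ => norm_nonneg _
  set Q := M * (r * R) + 1 with hQ
  have hQ0 : 0 < Q := by positivity
  refine ⟨(r + r' + 1) * Q, by positivity, fun t ht => ?_⟩
  have ht0 : 0 < t := by linarith
  obtain ⟨x, h1, h2, h3, h4⟩ := hermite_solve r r' t ht0.ne' a
  have hb' : ∀ j, t * (t^j * ‖x j‖) ≤ Q * t^r := by
    intro j
    have := hb t x h1 j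
    rw [abs_of_pos ht0] at this
    have e1 : ∑ i ∈ Finset.range r', t^i * ‖jet (r+r') t x i‖ = 0 :=
      Finset.sum_eq_zero fun i hi => by rw [h3 i (Finset.mem_range.1 hi)]; simp
    have e2 : ∑ i ∈ Finset.range r, t^i * ‖x i‖ = ∑ i ∈ Finset.range r, t^i * (if i < r then ‖a i‖ else 0) :=
      Finset.sum_congr rfl fun i hi => by rw [h2 i (Finset.mem_range.1 hi), if_pos (Finset.mem_range.1 hi)]
    rw [e1, e2, add_zero] at this
    have h5 := sum_pow_bound r t ht (fun i => if i < r then ‖a i‖ else 0) R (fun i => by split_ifs <;> positivity)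
      (fun i => by
        split_ifs with hi
        · exact Finset.single_le_sum (f := fun i => ‖a i‖) (fun i _ => norm_nonneg _) (Finset.mem_range.2 hi)
        · exact hR0)
    calc t * (t^j * ‖x j‖) ≤ t * (M * ∑ i ∈ Finset.range r, t^i * (if i < r then ‖a i‖ else 0)) := mul_le_mul_of_nonneg_left this ht0.le
      _ = M * (t * ∑ i ∈ Finset.range r, t^i * (if i < r then ‖a i‖ else 0)) := by ring
      _ ≤ M * (r * R * t^r) := by gcongr
      _ ≤ Q * t^r := by rw [hQ]; nlinarith [pow_pos ht0 r]
  have hj : ∀ j, t * (t^j * ‖jet (r+r') t x j‖) ≤ (r+r') * Q * t^r := by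
    intro j
    have h5 := jet_bound (r+r') t x (Q * t^r / t) (fun j => by
      rw [abs_of_pos ht0, le_div_iff₀ ht0, mul_comm]; exact hb' j) (by positivity) j
    rw [abs_of_pos ht0] at h5
    calc t * (t^j * ‖jet (r+r') t x j‖) ≤ t * (((r+r' : ℕ) : ℝ) * (Q * t^r / t)) := mul_le_mul_of_nonneg_left h5 ht0.le
      _ = _ := by push_cast; field_simp
  have hrr : (0:ℝ) ≤ (r:ℝ) + r' := by positivity
  refine ⟨x, h1, h2, h4, fun i hi => ?_, fun hr j => ?_, fun hr j => ?_⟩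
  · rw [le_div_iff₀ ht0]
    have h5 := hb' i
    have h6 : t^r ≤ t^i := pow_le_pow_right₀ ht hi
    have h7 : t^i * (‖x i‖ * t) ≤ t^i * Q := by
      calc t^i * (‖x i‖ * t) = t * (t^i * ‖x i‖) := by ring
        _ ≤ Q * t^r := h5
        _ ≤ Q * t^i := by gcongr
        _ = _ := by ring
    have := le_of_mul_le_mul_left h7 (by positivity)
    nlinarith
  · by_cases hjr : j < r'
    · rw [h3 j hjr, norm_zero]; positivity
    · have h6 : t^r ≤ t^(j+1) := pow_le_pow_right₀ ht (by omega)
      have h7 : t^(j+1) * ‖jet (r+r') t x j‖ ≤ t^(j+1) * ((r+r') * Q) := by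
        calc t^(j+1) * ‖jet (r+r') t x j‖ = t * (t^j * ‖jet (r+r') t x j‖) := by ring
          _ ≤ (r+r') * Q * t^r := hj j
          _ ≤ (r+r') * Q * t^(j+1) := by gcongr
          _ = _ := by ring
      have := le_of_mul_le_mul_left h7 (by positivity)
      nlinarith
  · by_cases hjr : j < r'
    · rw [h3 j hjr, norm_zero]; positivity
    · rw [le_div_iff₀ ht0]
      have h6 : t^r ≤ t^j := pow_le_pow_right₀ ht (by omega)
      have h7 : t^j * (‖jet (r+r') t x j‖ * t) ≤ t^j * ((r+r') * Q) := by
        calc t^j * (‖jet (r+r') t x j‖ * t) = t * (t^j * ‖jet (r+r') t x j‖) := by ring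
          _ ≤ (r+r') * Q * t^r := hj j
          _ ≤ (r+r') * Q * t^j := by gcongr
          _ = _ := by ring
      have := le_of_mul_le_mul_left h7 (by positivity)
      nlinarith
end

section
open Filter Topology
attribute [local irreducible] linFlow

variable {d : ℕ}

def opW (A : Matrix (Fin d) (Fin d) ℝ) (L : Filter ℝ) (S : Set (Euc d)) : Set (Euc d) :=
  {x | x ∈ S ∧ ∃ (u : ℕ → Euc d) (t : ℕ → ℝ) (z : Euc d), (∀ n, u n ∈ S) ∧ Tendsto u atTop (𝓝 x) ∧
    Tendsto t atTop L ∧ Tendsto (fun n => linFlow A (t n) (u n)) atTop (𝓝 z)}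

def opE (A : Matrix (Fin d) (Fin d) ℝ) (L : Filter ℝ) (S : Set (Euc d)) : Set (Euc d) :=
  {x | x ∈ S ∧ ∃ (u : ℕ → Euc d) (t : ℕ → ℝ), (∀ n, u n ∈ S) ∧ Tendsto u atTop (𝓝 x) ∧
    Tendsto t atTop L ∧ Tendsto (fun n => linFlow A (t n) (u n)) atTop (𝓝 0)}

lemma exp_jet_tendsto (a : ℂ) (k j : ℕ) (s : ℕ → ℝ) (y : ℕ → ℕ → ℂ) (R : ℝ) (hy : ∀ n i, ‖y n i‖ ≤ R)
    (h : Tendsto (fun n => a.re * s n) atTop atBot) :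
    Tendsto (fun n => Complex.exp (a * s n) * jet k (s n) (y n) j) atTop (𝓝 0) := by
  have ha : a.re ≠ 0 := by
    intro h0
    simp only [h0, zero_mul] at h
    obtain ⟨n, hn⟩ := (h.eventually (eventually_lt_atBot 0)).exists
    exact lt_irrefl _ hn
  have hu : Tendsto (fun n => -(a.re * s n)) atTop atTop := tendsto_neg_atBot_atTop.comp h
  simp only [jet, Finset.mul_sum]
  rw [show (0:ℂ) = ∑ i ∈ Finset.range k, 0 by simp]
  refine tendsto_finsetSum _ fun i _ => ?_
  have h1 := ((Real.tendsto_pow_mul_exp_neg_atTop_nhds_zero i).comp hu).norm.mul_const (R / |a.re|^i)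
  rw [norm_zero, zero_mul] at h1
  refine squeeze_zero_norm (fun n => ?_) h1
  have hf : (1:ℝ) ≤ i.factorial := by exact_mod_cast Nat.factorial_pos i
  have hR : 0 ≤ R := (norm_nonneg _).trans (hy 0 0)
  rw [norm_mul, norm_mul, norm_div, norm_pow, Complex.norm_exp, Complex.norm_natCast, Complex.norm_real]
  simp only [Function.comp, norm_mul, norm_pow, norm_neg, neg_neg, Complex.re_mul_ofReal, Real.norm_eq_abs, Real.abs_exp]
  have hp : 0 < |a.re|^i := by positivity
  have e : (|a.re| * |s n|)^i * Real.exp (a.re * s n) * (R / |a.re|^i) = Real.exp (a.re * s n) * (|s n|^i * R) := by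
    rw [mul_pow]; field_simp
  rw [e]
  gcongr
  · exact div_le_self (by positivity) hf
  · exact hy _ _

namespace NF
variable {A : Matrix (Fin d) (Fin d) ℝ} (N : NF A)

abbrev Yk (k : N.β → ℕ) : Submodule ℝ (Euc d) := N.Y (fun b j => j < k b)

lemma mem_Yk {k : N.β → ℕ} {x : Euc d} : x ∈ N.Yk k ↔ ∀ b j, k b ≤ j → N.c b j x = 0 := by
  simp [Yk, mem_Y]

lemma flow_jet (b : N.β) (j K : ℕ) (t : ℝ) (x : Euc d) (hx : ∀ i, K ≤ i → N.c b i x = 0) :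
    N.c b j (linFlow A t x) = Complex.exp (N.lam b * t) * jet K t (fun i => N.c b i x) j := by
  rw [N.flow b j (N.m b + K) (by omega) t x, jet]
  congr 1
  symm
  refine Finset.sum_subset (Finset.range_mono (by omega)) fun i _ hi => ?_
  rw [hx _ (by simp at hi; omega), mul_zero]

def kW (k : N.β → ℕ) (b : N.β) : ℕ :=
  if (N.lam b).re < 0 then k b else if 0 < (N.lam b).re then 0 else (k b + 1) / 2
def kE (k : N.β → ℕ) (b : N.β) : ℕ :=
  if (N.lam b).re < 0 then k b else if 0 < (N.lam b).re then 0 else k b / 2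

lemma norm_exp_central (b : N.β) (h : (N.lam b).re = 0) (t : ℝ) : ‖Complex.exp (N.lam b * t)‖ = 1 := by
  rw [Complex.norm_exp]; simp [h]


lemma bdd_of_tendsto {u : ℕ → Euc d} {x : Euc d} (h : Tendsto u atTop (𝓝 x)) : ∃ R : ℝ, 0 ≤ R ∧ ∀ n, ‖u n‖ ≤ R := by
  obtain ⟨R, hR⟩ := (Metric.isBounded_range_of_tendsto u h).exists_norm_le
  exact ⟨R, (norm_nonneg _).trans (hR (u 0) ⟨0, rfl⟩), fun n => hR _ ⟨n, rfl⟩⟩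

lemma nec {L : Filter ℝ} (hL : L ≤ cocompact ℝ) (k : N.β → ℕ)
    (hU : L ≤ atTop ∨ ∀ b, 0 < (N.lam b).re → k b = 0) {x z : Euc d} {u : ℕ → Euc d} {t : ℕ → ℝ}
    (hx : x ∈ N.Yk k) (hu : ∀ n, u n ∈ N.Yk k) (hux : Tendsto u atTop (𝓝 x)) (ht : Tendsto t atTop L)
    (hz : Tendsto (fun n => linFlow A (t n) (u n)) atTop (𝓝 z)) :
    x ∈ N.Yk (N.kW k) ∧ (z = 0 → x ∈ N.Yk (N.kE k)) := by
  obtain ⟨C, hC, hcb⟩ := N.c_bound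
  obtain ⟨R, hR0, hR⟩ := bdd_of_tendsto hux
  obtain ⟨R', hR0', hR'⟩ := bdd_of_tendsto hz
  have htn : Tendsto (fun n => |t n|) atTop atTop := (tendsto_norm_cocompact_atTop (E := ℝ)).comp (ht.mono_right hL)
  have ht1 : ∀ᶠ n in atTop, 1 ≤ |t n| := htn.eventually_ge_atTop 1
  have hlim : ∀ b j, Tendsto (fun n => N.c b j (u n)) atTop (𝓝 (N.c b j x)) := fun b j =>
    ((N.continuous_c b j).tendsto x).comp hux
  have hzero : ∀ b j (f : ℕ → ℝ), (∀ᶠ n in atTop, ‖N.c b j (u n)‖ ≤ f n) → Tendsto f atTop (𝓝 0) → N.c b j x = 0 :=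
    fun b j f h1 h2 => tendsto_nhds_unique (hlim b j) (squeeze_zero_norm' h1 h2)
  have hunst : ∀ b, 0 < (N.lam b).re → ∀ j, N.c b j x = 0 := by
    intro b hb j
    rcases hU with hU | hU
    · refine tendsto_nhds_unique (hlim b j) ?_
      have := exp_jet_tendsto (N.lam b) (N.m b) j (fun n => -(t n)) (fun n i => N.c b i (linFlow A (t n) (u n))) (C * R')
        (fun n i => (hcb _ _ _).trans (by gcongr; exact hR' n))
        (by
          simp only [mul_neg]
          exact tendsto_neg_atTop_atBot.comp (Tendsto.const_mul_atTop hb (ht.mono_right hU)))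
      refine this.congr fun n => ?_
      rw [← N.flow_jet b j (N.m b) _ _ (fun i hi => N.c_top b i _ hi), linFlow_neg_cancel]
    · exact N.mem_Yk.1 hx b j (by rw [hU b hb]; omega)
  have hR2 : ∀ b n i, ‖N.c b i (u n)‖ ≤ C * R := fun b n i => (hcb _ _ _).trans (by gcongr; exact hR n)
  have hjet : ∀ b, (N.lam b).re = 0 → ∀ n i, ‖jet (k b / 2 + (k b + 1)/2) (t n) (fun i => N.c b i (u n)) i‖ ≤ C * ‖linFlow A (t n) (u n)‖ := by
    intro b hb n i
    have h1 := N.flow_jet b i (k b) (t n) (u n) (fun i hi => N.mem_Yk.1 (hu n) b i hi)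
    have h2 := congrArg norm h1
    rw [norm_mul, N.norm_exp_central b hb, one_mul] at h2
    rw [show k b / 2 + (k b + 1)/2 = k b by omega, ← h2]
    exact hcb _ _ _
  constructor
  · rw [mem_Yk]
    intro b j hj
    rw [kW] at hj
    split_ifs at hj with h1 h2
    · exact N.mem_Yk.1 hx b j hj
    · exact hunst b h2 j
    · have hb : (N.lam b).re = 0 := le_antisymm (not_lt.1 h2) (not_lt.1 h1)
      obtain ⟨M, hM, hh⟩ := hermite_nec (k b / 2) ((k b + 1)/2)
      refine hzero b j (fun n => M * ((C * R + C * R') / |t n|)) ?_ ?_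
      · filter_upwards [ht1] with n hn
        refine (hh (t n) (fun i => N.c b i (u n)) (C * R) (C * R') hn (fun i hi => N.mem_Yk.1 (hu n) b i (by omega)) (hR2 b n) (fun i => (hjet b hb n i).trans ?_)).2 (by omega) j hj
        gcongr; exact hR' n
      · simpa using (Tendsto.const_div_atTop htn (C * R + C * R')).const_mul M
  · intro hz0
    rw [mem_Yk]
    intro b j hj
    rw [kE] at hj
    split_ifs at hj with h1 h2
    · exact N.mem_Yk.1 hx b j hj
    · exact hunst b h2 j
    · have hb : (N.lam b).re = 0 := le_antisymm (not_lt.1 h2) (not_lt.1 h1)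
      obtain ⟨M, hM, hh⟩ := hermite_nec (k b / 2) ((k b + 1)/2)
      refine hzero b j (fun n => M * ((C * R) / |t n| + C * ‖linFlow A (t n) (u n)‖)) ?_ ?_
      · filter_upwards [ht1] with n hn
        exact (hh (t n) (fun i => N.c b i (u n)) (C * R) _ hn (fun i hi => N.mem_Yk.1 (hu n) b i (by omega)) (hR2 b n) (hjet b hb n)).1 (by omega) j hj
      · rw [hz0] at hz
        simpa using ((Tendsto.const_div_atTop htn (C * R)).add (hz.norm.const_mul C)).const_mul M

/-- sufficiency construction -/
lemma suff (k r : N.β → ℕ) (hkm : ∀ b, k b ≤ N.m b) (hr : ∀ b, (N.lam b).re = 0 → 2 * r b ≤ k b + 1)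
    {x : Euc d} (hxk : x ∈ N.Yk k) (hxU : ∀ b j, 0 < (N.lam b).re → N.c b j x = 0)
    (hx : ∀ b j, (N.lam b).re = 0 → r b ≤ j → N.c b j x = 0) :
    ∃ u : ℕ → Euc d, (∀ n, u n ∈ N.Yk k) ∧ Tendsto u atTop (𝓝 x) ∧
      (∃ R, ∀ n : ℕ, ‖linFlow A ((n:ℝ)+1) (u n)‖ ≤ R) ∧
      ((∀ b, (N.lam b).re = 0 → 2 * r b ≤ k b) → Tendsto (fun n : ℕ => linFlow A ((n:ℝ)+1) (u n)) atTop (𝓝 0)) := by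
  have H : ∀ b, ∃ C : ℝ, 0 < C ∧ ∀ t : ℝ, 1 ≤ t → ∃ y : ℕ → ℂ, ((N.lam b).im = 0 → ∀ i, (y i).im = 0) ∧ (∀ i, k b ≤ i → y i = 0) ∧
      ((N.lam b).re ≠ 0 → ∀ i, y i = N.c b i x) ∧
      (∀ i, ‖y i - N.c b i x‖ ≤ C / t) ∧ ((N.lam b).re = 0 → ∀ j, ‖jet (k b) t y j‖ ≤ C) ∧
      ((N.lam b).re = 0 → 2 * r b ≤ k b → ∀ j, ‖jet (k b) t y j‖ ≤ C / t) := by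
    intro b
    by_cases hb : (N.lam b).re = 0
    · obtain ⟨C, hC, hh⟩ := hermite_suff (r b) (k b - r b) (fun i => N.c b i x)
      have h2 := hr b hb
      refine ⟨C, hC, fun t ht => ?_⟩
      obtain ⟨y, y1, y2, y3, y4, y5, y6⟩ := hh t ht
      have e : r b + (k b - r b) = k b := by omega
      rw [e] at y1 y5 y6
      refine ⟨y, fun h => y3 (fun i => N.c_real b i x h), y1, fun h => absurd hb h, fun i => ?_, fun _ => y5 (by omega), fun _ h3 => y6 (by omega)⟩
      by_cases hi : i < r b
      · rw [y2 i hi, sub_self, norm_zero]; positivity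
      · rw [hx b i hb (not_lt.1 hi), sub_zero]; exact y4 i (not_lt.1 hi)
    · refine ⟨1, one_pos, fun t ht => ⟨fun i => N.c b i x, fun h i => N.c_real b i x h, fun i hi => N.mem_Yk.1 hxk b i hi, fun _ i => rfl, fun i => ?_, fun h => absurd h hb, fun h => absurd h hb⟩⟩
      rw [sub_self, norm_zero]; positivity
  choose C hC H using H
  have hn1 : ∀ n : ℕ, (1:ℝ) ≤ (n:ℝ) + 1 := fun n => by have : (0:ℝ) ≤ n := by positivity
                                                       linarith
  choose! y y1 y2 y3 y4 y5 y6 using H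
  have H2 : ∀ n : ℕ, ∃ u : Euc d, ∀ b j, j < N.m b → N.c b j u = y b ((n:ℝ)+1) j := fun n =>
    N.surj (fun b j => y b ((n:ℝ)+1) j) (fun b j h => y1 b _ (hn1 n) h j)
  choose u hu using H2
  have hu' : ∀ n b j, N.c b j (u n) = y b ((n:ℝ)+1) j := by
    intro n b j
    by_cases hj : j < N.m b
    · exact hu n b j hj
    · rw [N.c_top b j _ (not_lt.1 hj), y2 b _ (hn1 n) j ((hkm b).trans (not_lt.1 hj))]
  have htn : Tendsto (fun n : ℕ => (n:ℝ)+1) atTop atTop := tendsto_atTop_add_const_right _ _ tendsto_natCast_atTop_atTop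
  have huk : ∀ n, u n ∈ N.Yk k := fun n => by
    rw [mem_Yk]; intro b j hj; rw [hu', y2 b _ (hn1 n) j hj]
  have hfl : ∀ (n : ℕ) b j, N.c b j (linFlow A ((n:ℝ)+1) (u n)) = Complex.exp (N.lam b * ((n:ℝ)+1 : ℝ)) * jet (k b) ((n:ℝ)+1) (y b ((n:ℝ)+1)) j := by
    intro n b j
    rw [N.flow_jet b j (k b) _ _ (fun i hi => N.mem_Yk.1 (huk n) b i hi)]
    congr 2; funext i; exact hu' n b i
  have hstab : ∀ b j, (N.lam b).re ≠ 0 → Tendsto (fun n : ℕ => N.c b j (linFlow A ((n:ℝ)+1) (u n))) atTop (𝓝 0) := by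
    intro b j hb
    simp only [hfl]
    rcases lt_or_gt_of_ne hb with h | h
    · refine exp_jet_tendsto (N.lam b) (k b) j (fun n : ℕ => (n:ℝ)+1) (fun n => y b ((n:ℝ)+1)) (N.c_bound.choose * ‖x‖) (fun n i => ?_) ?_
      · rw [y3 b _ (hn1 n) hb]; exact N.c_bound.choose_spec.2 b i x
      · exact Tendsto.const_mul_atTop_of_neg h htn
    · have : ∀ n : ℕ, jet (k b) ((n:ℝ)+1) (y b ((n:ℝ)+1)) j = 0 := by
        intro n
        rw [jet]; refine Finset.sum_eq_zero fun i _ => ?_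
        rw [y3 b _ (hn1 n) hb, hxU b _ h, mul_zero]
      simp [this]
  refine ⟨u, huk, ?_, ?_, ?_⟩
  · rw [N.tendsto_iff]
    intro b j _
    rw [tendsto_iff_norm_sub_tendsto_zero]
    refine squeeze_zero (fun n => norm_nonneg _) (fun n => ?_) (Tendsto.const_div_atTop htn (C b))
    rw [hu']; exact y4 b _ (hn1 n) j
  · have H3 : ∀ b j, ∃ R : ℝ, ∀ n : ℕ, ‖N.c b j (linFlow A ((n:ℝ)+1) (u n))‖ ≤ R := by
      intro b j
      by_cases hb : (N.lam b).re = 0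
      · refine ⟨C b, fun n => ?_⟩
        rw [hfl, norm_mul, N.norm_exp_central b hb, one_mul]
        exact y5 b _ (hn1 n) hb j
      · obtain ⟨R, hR⟩ := (Metric.isBounded_range_of_tendsto _ (hstab b j hb)).exists_norm_le
        exact ⟨R, fun n => hR _ ⟨n, rfl⟩⟩
    choose R hR using H3
    obtain ⟨D, hD, hnb⟩ := N.norm_bound
    refine ⟨D * ∑ b, ∑ j ∈ Finset.range (N.m b), |R b j|, fun n => hnb _ _ (by positivity) fun b j hj => ?_⟩
    refine ((hR b j n).trans (le_abs_self _)).trans ?_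
    refine (Finset.single_le_sum (f := fun j => |R b j|) (fun _ _ => abs_nonneg _) (Finset.mem_range.2 hj)).trans ?_
    exact Finset.single_le_sum (f := fun b => ∑ j ∈ Finset.range (N.m b), |R b j|) (fun _ _ => by positivity) (Finset.mem_univ b)
  · intro hr2
    rw [N.tendsto_iff]
    intro b j _
    rw [map_zero]
    by_cases hb : (N.lam b).re = 0
    · refine squeeze_zero_norm (fun n => ?_) (Tendsto.const_div_atTop htn (C b))
      rw [hfl, norm_mul, N.norm_exp_central b hb, one_mul]
      exact y6 b _ (hn1 n) hb (hr2 b hb) j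
    · exact hstab b j hb

theorem opW_Yk {L : Filter ℝ} (hL1 : atTop ≤ L) (hL : L ≤ cocompact ℝ) (k : N.β → ℕ) (hkm : ∀ b, k b ≤ N.m b)
    (hU : L ≤ atTop ∨ ∀ b, 0 < (N.lam b).re → k b = 0) :
    opW A L (N.Yk k) = N.Yk (N.kW k) := by
  ext x
  constructor
  · rintro ⟨hx, u, t, z, h1, h2, h3, h4⟩
    exact (N.nec hL k hU hx h1 h2 h3 h4).1
  · intro hx
    have hx' := N.mem_Yk.1 hx
    have hxk : x ∈ N.Yk k := by
      rw [mem_Yk]; intro b j hj; apply hx'; rw [kW]; split_ifs <;> omega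
    obtain ⟨u, h1, h2, ⟨R, h3⟩, -⟩ := N.suff k (N.kW k) hkm (fun b hb => by rw [kW]; simp [hb]; omega) hxk
      (fun b j hb => hx' b j (by rw [kW]; simp [hb, not_lt.2 hb.le])) (fun b j _ h => hx' b j h)
    obtain ⟨z, -, φ, hφ, hz⟩ := tendsto_subseq_of_bounded (Metric.isBounded_closedBall (x := (0:Euc d)) (r := R)) (x := fun n : ℕ => linFlow A ((n:ℝ)+1) (u n))
      (fun n => by simpa using h3 n)
    refine ⟨hxk, u ∘ φ, fun n => (φ n : ℝ) + 1, z, fun n => h1 _, h2.comp hφ.tendsto_atTop, ?_, hz⟩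
    refine Tendsto.mono_right ?_ hL1
    exact tendsto_atTop_add_const_right _ _ (tendsto_natCast_atTop_atTop.comp hφ.tendsto_atTop)

theorem opE_Yk {L : Filter ℝ} (hL1 : atTop ≤ L) (hL : L ≤ cocompact ℝ) (k : N.β → ℕ) (hkm : ∀ b, k b ≤ N.m b)
    (hU : L ≤ atTop ∨ ∀ b, 0 < (N.lam b).re → k b = 0) :
    opE A L (N.Yk k) = N.Yk (N.kE k) := by
  ext x
  constructor
  · rintro ⟨hx, u, t, h1, h2, h3, h4⟩
    exact (N.nec hL k hU hx h1 h2 h3 h4).2 rfl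
  · intro hx
    have hx' := N.mem_Yk.1 hx
    have hxk : x ∈ N.Yk k := by
      rw [mem_Yk]; intro b j hj; apply hx'; rw [kE]; split_ifs <;> omega
    obtain ⟨u, h1, h2, -, h3⟩ := N.suff k (N.kE k) hkm (fun b hb => by rw [kE]; simp [hb]; omega) hxk
      (fun b j hb => hx' b j (by rw [kE]; simp [hb, not_lt.2 hb.le])) (fun b j _ h => hx' b j h)
    refine ⟨hxk, u, fun n => (n : ℝ) + 1, fun n => h1 _, h2, ?_, h3 (fun b hb => by rw [kE]; simp [hb]; omega)⟩
    refine Tendsto.mono_right ?_ hL1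
    exact tendsto_atTop_add_const_right _ _ tendsto_natCast_atTop_atTop

end NF
end

section
open Filter Topology
attribute [local irreducible] linFlow

variable {d : ℕ}

lemma linFlow_mem_orbit (A : Matrix (Fin d) (Fin d) ℝ) (t : ℝ) (x : Euc d) : linFlow A t x ∈ flowOrbit A x := ⟨t, rfl⟩

lemma countable_isolated (φ ψ : ℝ → ℝ) (h : ∀ s, HasDerivAt φ (ψ s) s) (c : ℝ) : {s | φ s = c ∧ ψ s ≠ 0}.Countable := by
  refine (countable_setOfPred_isolated_right_within (s := {s | φ s = c ∧ ψ s ≠ 0})).mono ?_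
  intro s hs
  refine ⟨hs, ?_⟩
  have h1 := (h s).eventually_ne (c := c) hs.2
  have h2 : ∀ᶠ z in 𝓝[{s | φ s = c ∧ ψ s ≠ 0} ∩ Set.Ioi s] s, φ z ≠ c :=
    nhdsWithin_mono s (fun z hz => ne_of_gt hz.2) h1
  have h3 : ∀ᶠ z in 𝓝[{s | φ s = c ∧ ψ s ≠ 0} ∩ Set.Ioi s] s, φ z = c :=
    eventually_nhdsWithin_of_forall fun z hz => hz.1.1
  rw [← Filter.empty_mem_iff_bot]
  filter_upwards [h2, h3] with z hz1 hz2 using hz1 hz2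

lemma hasDerivAt_ell (B : Matrix (Fin d) (Fin d) ℝ) (w y : Euc d) (s : ℝ) :
    HasDerivAt (fun s => inner ℝ w (linFlow B s y)) (inner ℝ w (opA B (linFlow B s y))) s :=
  (innerSL ℝ w).hasFDerivAt.comp_hasDerivAt s (hasDerivAt_linFlow B s y)

lemma continuous_opA (B : Matrix (Fin d) (Fin d) ℝ) : Continuous (opA B) := (opA B).continuous_of_finiteDimensional

lemma flowbox (B : Matrix (Fin d) (Fin d) ℝ) (y0 : Euc d) (h : opA B y0 ≠ 0) :
    ∃ V : Set (Euc d), IsOpen V ∧ y0 ∈ V ∧ ∃ σ : Euc d → ℝ, ContinuousOn σ V ∧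
      ∀ y', ∀ C ⊆ V, IsPreconnected C → C ⊆ flowOrbit B y' →
        ∀ y ∈ C, ∀ z ∈ C, z = linFlow B (σ y - σ z) y := by
  set w := opA B y0 with hw
  set D : ℝ × Euc d → ℝ := fun p => inner ℝ w (opA B (linFlow B p.1 p.2)) with hD
  set f : ℝ × Euc d → ℝ := fun p => inner ℝ w (linFlow B p.1 p.2) - inner ℝ w y0 with hf
  have hDc : Continuous D := continuous_const.inner ((continuous_opA B).comp (continuous_linFlow B))
  have hfc : Continuous f := (continuous_const.inner (continuous_linFlow B)).sub continuous_const
  have hder : ∀ y s, HasDerivAt (fun s => f (s, y)) (D (s, y)) s := fun y s =>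
    (hasDerivAt_ell B w y s).sub_const _
  have hD0 : 0 < D (0, y0) := by
    simp only [hD, linFlow_zero, ← hw]
    exact real_inner_self_pos.2 h
  have hDn : ∀ᶠ p in 𝓝 ((0:ℝ), y0), 0 < D p := hDc.continuousAt.eventually (lt_mem_nhds hD0)
  rw [nhds_prod_eq] at hDn
  obtain ⟨p1, hp1, p2, hp2, hDp⟩ := eventually_prod_iff.1 hDn
  obtain ⟨ε', hε', hball⟩ := Metric.eventually_nhds_iff.1 hp1
  set ε := ε' / 2 with hε
  have hε0 : 0 < ε := by positivity
  have hIcc : ∀ s ∈ Set.Icc (-ε) ε, p1 s := fun s hs => hball (by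
    rw [Real.dist_eq, sub_zero, abs_lt]; constructor <;> linarith [hs.1, hs.2])
  have mono : ∀ y, p2 y → StrictMonoOn (fun s => f (s, y)) (Set.Icc (-ε) ε) := fun y hy =>
    strictMonoOn_of_deriv_pos (convex_Icc _ _) (fun s _ => (hder y s).continuousAt.continuousWithinAt)
      (fun s hs => by rw [(hder y s).deriv]; exact hDp (hIcc s (interior_subset hs)) hy)
  have hy0 : p2 y0 := hp2.self_of_nhds
  have f0 : f (0, y0) = 0 := by simp [hf]
  have hneg : f (-ε, y0) < 0 := by
    rw [← f0]; exact mono y0 hy0 ⟨le_refl _, by linarith⟩ ⟨by linarith, hε0.le⟩ (by linarith)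
  have hpos : 0 < f (ε, y0) := by
    rw [← f0]; exact mono y0 hy0 ⟨by linarith, hε0.le⟩ ⟨by linarith, le_refl _⟩ hε0
  have hcy : ∀ s, Continuous fun y => f (s, y) := fun s => hfc.comp (by fun_prop)
  have hV : ∀ᶠ y in 𝓝 y0, p2 y ∧ f (-ε, y) < 0 ∧ 0 < f (ε, y) :=
    hp2.and (((hcy _).continuousAt.eventually (gt_mem_nhds hneg)).and ((hcy _).continuousAt.eventually (lt_mem_nhds hpos)))
  obtain ⟨V, hVs, hVo, hV0⟩ := eventually_nhds_iff.1 hV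
  have hex : ∀ y ∈ V, ∃ s ∈ Set.Ioo (-ε) ε, f (s, y) = 0 := fun y hy => by
    obtain ⟨-, h1, h2⟩ := hVs y hy
    exact intermediate_value_Ioo (by linarith) (hfc.comp (by fun_prop : Continuous fun s : ℝ => (s, y))).continuousOn ⟨h1, h2⟩
  choose! σ hσ1 hσ2 using hex
  have hσc : ContinuousOn σ V := by
    intro y1 hy1
    refine ContinuousAt.continuousWithinAt ?_
    rw [Metric.continuousAt_iff']
    intro η hη
    obtain ⟨l1, l2⟩ := hσ1 y1 hy1
    obtain ⟨a, ha1, ha2⟩ : ∃ a, max (-ε) (σ y1 - η) < a ∧ a < σ y1 := exists_between (max_lt l1 (by linarith))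
    obtain ⟨b, hb1, hb2⟩ : ∃ b, σ y1 < b ∧ b < min ε (σ y1 + η) := exists_between (lt_min l2 (by linarith))
    have ha3 := (le_max_left _ _).trans_lt ha1
    have ha4 := (le_max_right _ _).trans_lt ha1
    have hb3 := hb2.trans_le (min_le_left _ _)
    have hb4 := hb2.trans_le (min_le_right _ _)
    have hm := mono y1 (hVs y1 hy1).1
    have h1 : f (a, y1) < 0 := by
      rw [← hσ2 y1 hy1]; exact hm ⟨by linarith, by linarith⟩ ⟨by linarith, by linarith⟩ ha2
    have h2 : 0 < f (b, y1) := by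
      rw [← hσ2 y1 hy1]; exact hm ⟨by linarith, by linarith⟩ ⟨by linarith, by linarith⟩ hb1
    filter_upwards [hVo.mem_nhds hy1, (hcy a).continuousAt.eventually (gt_mem_nhds h1), (hcy b).continuousAt.eventually (lt_mem_nhds h2)] with y hy g1 g2
    have hm' := mono y (hVs y hy).1
    obtain ⟨k1, k2⟩ := hσ1 y hy
    have g3 : a < σ y := by
      rw [← hm'.lt_iff_lt ⟨by linarith, by linarith⟩ ⟨by linarith, by linarith⟩]
      simp only [hσ2 y hy]; exact g1
    have g4 : σ y < b := by
      rw [← hm'.lt_iff_lt ⟨by linarith, by linarith⟩ ⟨by linarith, by linarith⟩]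
      simp only [hσ2 y hy]; exact g2
    rw [Real.dist_eq, abs_lt]; constructor <;> linarith
  refine ⟨V, hVo, hV0, σ, hσc, fun y' C hCV hC hCo y hy z hz => ?_⟩
  have key : linFlow B (σ y) y = linFlow B (σ z) z := by
    have hpc : IsPreconnected ((fun y => linFlow B (σ y) y) '' C) :=
      hC.image _ ((continuous_linFlow B).comp_continuousOn ((hσc.mono hCV).prodMk continuousOn_id))
    have hcount : {s : ℝ | inner ℝ w (linFlow B s y') = inner ℝ w y0 ∧ inner ℝ w (opA B (linFlow B s y')) ≠ 0}.Countable :=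
      countable_isolated _ _ (fun s => hasDerivAt_ell B w y' s) _
    have hsub : (fun y => linFlow B (σ y) y) '' C ⊆ (fun s => linFlow B s y') '' {s : ℝ | inner ℝ w (linFlow B s y') = inner ℝ w y0 ∧ inner ℝ w (opA B (linFlow B s y')) ≠ 0} := by
      rintro _ ⟨v, hv, rfl⟩
      obtain ⟨r, hr⟩ := hCo hv
      have e : linFlow B (σ v + r) y' = linFlow B (σ v) v := by rw [linFlow_add, ← hr]
      refine ⟨σ v + r, ⟨?_, ?_⟩, e⟩
      · rw [e]; have := hσ2 v (hCV hv); simp only [hf] at this; linarith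
      · rw [e]; exact (hDp (hIcc _ (Set.Ioo_subset_Icc_self (hσ1 v (hCV hv)))) (hVs v (hCV hv)).1).ne'
    exact (hcount.image _).isTotallyDisconnected _ hsub hpc ⟨y, hy, rfl⟩ ⟨z, hz, rfl⟩
  rw [sub_eq_neg_add, linFlow_add, key, linFlow_neg_cancel]

def LiftOn (B : Matrix (Fin d) (Fin d) ℝ) (g : ℝ → Euc d) (a b : ℝ) : Prop :=
  ∃ τ : ℝ → ℝ, Continuous τ ∧ τ a = 0 ∧ ∀ t ∈ Set.Icc a b, g t = linFlow B (τ t) (g a)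

lemma LiftOn.trans {B : Matrix (Fin d) (Fin d) ℝ} {g : ℝ → Euc d} {a b c : ℝ} (hab : a ≤ b)
    (h1 : LiftOn B g a b) (h2 : LiftOn B g b c) : LiftOn B g a c := by
  obtain ⟨τ, hc, h0, h⟩ := h1
  obtain ⟨τ', hc', h0', h'⟩ := h2
  refine ⟨fun t => τ (min t b) + τ' (max t b), by fun_prop, by simp [hab, h0, h0'], fun t ht => ?_⟩
  rcases le_total t b with htb | htb
  · simp only [min_eq_left htb, max_eq_right htb, h0', add_zero]; exact h t ⟨ht.1, htb⟩
  · simp only [min_eq_right htb, max_eq_left htb]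
    rw [add_comm, linFlow_add, ← h b ⟨hab, le_refl _⟩]; exact h' t ⟨htb, ht.2⟩

lemma lift_Icc (B : Matrix (Fin d) (Fin d) ℝ) (g : ℝ → Euc d) (hg : Continuous g)
    (hnf : ∀ t, opA B (g t) ≠ 0) (y : Euc d) (ho : ∀ t, g t ∈ flowOrbit B y) {a b : ℝ} (hab : a ≤ b) : LiftOn B g a b := by
  choose V hVo hV0 σ hσ hV using fun t => flowbox B (g t) (hnf t)
  obtain ⟨t, t0, tm, ⟨m, hm⟩, hc⟩ := exists_monotone_Icc_subset_open_cover_Icc hab (c := fun s : ℝ => {u : Set.Icc a b | g u ∈ V s})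
    (fun s => (hVo s).preimage (hg.comp continuous_subtype_val)) (fun u _ => Set.mem_iUnion.2 ⟨u, hV0 u⟩)
  have hstep : ∀ n, LiftOn B g (t n) (t (n+1)) := by
    intro n
    obtain ⟨s, hs⟩ := hc n
    have hle : (t n : ℝ) ≤ t (n+1) := tm (Nat.le_succ n)
    have hin : ∀ u ∈ Set.Icc (t n : ℝ) (t (n+1)), g u ∈ V s := by
      intro u hu
      exact hs (show (⟨u, (t n).2.1.trans hu.1, hu.2.trans (t (n+1)).2.2⟩ : Set.Icc a b) ∈ Set.Icc (t n) (t (n+1)) from ⟨hu.1, hu.2⟩)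
    refine ⟨fun u => σ s (g (t n)) - σ s (g (max (t n) (min (t (n+1)) u))), ?_, ?_, ?_⟩
    · refine continuous_const.sub ?_
      refine (hσ s).comp_continuous (hg.comp (by fun_prop)) fun u => hin _ ⟨le_max_left _ _, max_le hle (min_le_left _ _)⟩
    · simp [hle]
    · intro u hu
      have e : max (t n : ℝ) (min (t (n+1)) u) = u := by rw [min_eq_right hu.2, max_eq_right hu.1]
      simp only [e]
      exact hV s y (g '' Set.Icc (t n) (t (n+1))) (by rintro _ ⟨u, hu, rfl⟩; exact hin u hu)
        (isPreconnected_Icc.image _ hg.continuousOn) (by rintro _ ⟨u, hu, rfl⟩; exact ho u) _ ⟨t n, ⟨le_refl _, hle⟩, rfl⟩ _ ⟨u, hu, rfl⟩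
  have hall : ∀ n, LiftOn B g a (t n) := by
    intro n
    induction n with
    | zero => rw [t0]; exact ⟨fun _ => 0, continuous_const, rfl, fun u hu => by rw [linFlow_zero, le_antisymm hu.2 hu.1]⟩
    | succ n ih => exact ih.trans (t n).2.1 (hstep n)
  have := hall m
  rwa [hm m le_rfl] at this

lemma lift_unique (B : Matrix (Fin d) (Fin d) ℝ) (y : Euc d) (hy : opA B y ≠ 0) (S : Set ℝ) (hS : IsPreconnected S)
    (τ τ' : ℝ → ℝ) (h : ContinuousOn τ S) (h' : ContinuousOn τ' S) (heq : ∀ t ∈ S, linFlow B (τ t) y = linFlow B (τ' t) y)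
    {s t : ℝ} (hs : s ∈ S) (ht : t ∈ S) (h0 : τ s = τ' s) : τ t = τ' t := by
  have hpc : IsPreconnected ((fun t => τ t - τ' t) '' S) := hS.image _ (h.sub h')
  have hfix : ∀ t ∈ S, linFlow B (τ t - τ' t) y = y := by
    intro t ht
    rw [sub_eq_neg_add, linFlow_add, heq t ht, linFlow_neg_cancel]
  have hcount : {s : ℝ | inner ℝ (opA B y) (linFlow B s y) = inner ℝ (opA B y) y ∧ inner ℝ (opA B y) (opA B (linFlow B s y)) ≠ 0}.Countable :=
      countable_isolated _ _ (fun s => hasDerivAt_ell B _ y s) _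
  have hsub : (fun t => τ t - τ' t) '' S ⊆ {s : ℝ | inner ℝ (opA B y) (linFlow B s y) = inner ℝ (opA B y) y ∧ inner ℝ (opA B y) (opA B (linFlow B s y)) ≠ 0} := by
    rintro _ ⟨t, ht, rfl⟩
    simp only [Set.mem_ofPred_eq, hfix t ht, true_and]
    exact (real_inner_self_pos.2 hy).ne'
  have := hcount.isTotallyDisconnected _ hsub hpc ⟨s, hs, rfl⟩ ⟨t, ht, rfl⟩
  simp only [h0, sub_self] at this
  linarith

lemma lift_exists (B : Matrix (Fin d) (Fin d) ℝ) (g : ℝ → Euc d) (hg : Continuous g)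
    (hnf : ∀ t, opA B (g t) ≠ 0) (y : Euc d) (ho : ∀ t, g t ∈ flowOrbit B y) :
    ∃ τ : ℝ → ℝ, Continuous τ ∧ τ 0 = 0 ∧ ∀ t, g t = linFlow B (τ t) (g 0) := by
  have H : ∀ n : ℕ, ∃ τ : ℝ → ℝ, Continuous τ ∧ τ 0 = 0 ∧ ∀ t ∈ Set.Icc (-(n:ℝ)) n, g t = linFlow B (τ t) (g 0) := by
    intro n
    have hn : (0:ℝ) ≤ n := by positivity
    obtain ⟨τ, h1, h2, h3⟩ := lift_Icc B g hg hnf y ho (show -(n:ℝ) ≤ n by linarith)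
    refine ⟨fun t => τ t - τ 0, by fun_prop, by simp, fun t ht => ?_⟩
    show g t = linFlow B (τ t - τ 0) (g 0)
    rw [sub_eq_add_neg, linFlow_add, h3 0 ⟨by linarith, hn⟩, linFlow_neg_cancel]; exact h3 t ht
  choose τ h1 h2 h3 using H
  have hun : ∀ (n m : ℕ) (t : ℝ), |t| ≤ n → n ≤ m → τ n t = τ m t := by
    intro n m t ht hnm
    have hnm' : (n:ℝ) ≤ m := by exact_mod_cast hnm
    have hn : (0:ℝ) ≤ n := by positivity
    refine lift_unique B (g 0) (hnf 0) (Set.Icc (-(n:ℝ)) n) isPreconnected_Icc (τ n) (τ m) (h1 n).continuousOn (h1 m).continuousOn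
      (fun s hs => ?_) (s := 0) ⟨by linarith, hn⟩ (abs_le.1 ht) (by rw [h2, h2])
    rw [← h3 n s hs, ← h3 m s ⟨by linarith [hs.1], by linarith [hs.2]⟩]
  refine ⟨fun t => τ ⌈|t|⌉₊ t, ?_, by simpa using h2 0, fun t => h3 _ t (abs_le.1 (Nat.le_ceil _))⟩
  rw [continuous_iff_continuousAt]
  intro t
  have : (fun t => τ ⌈|t|⌉₊ t) =ᶠ[𝓝 t] τ (⌈|t|⌉₊ + 1) := by
    have h4 : ∀ᶠ s in 𝓝 t, |s| < |t| + 1 := continuous_abs.continuousAt.eventually (gt_mem_nhds (by linarith))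
    filter_upwards [h4] with s hs
    refine hun _ _ s (Nat.le_ceil _) ?_
    refine (Nat.ceil_mono hs.le).trans ?_
    rw [Nat.ceil_add_one (abs_nonneg _)]
  exact ((h1 _).continuousAt).congr this.symm
end

section
open Filter Topology
attribute [local irreducible] linFlow

variable {d : ℕ} {A B : Matrix (Fin d) (Fin d) ℝ} {h : Euc d ≃ₜ Euc d}

lemma flow_opA_ne {x : Euc d} (hx : opA A x ≠ 0) (t : ℝ) : opA A (linFlow A t x) ≠ 0 := by
  rw [← linFlow_opA]
  intro h0
  apply hx
  rw [← linFlow_neg_cancel A t (opA A x), h0, linFlow_map_zero]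

lemma flow_opA_ne_iff {x : Euc d} (t : ℝ) : opA A (linFlow A t x) ≠ 0 ↔ opA A x ≠ 0 := by
  refine ⟨fun h1 => ?_, fun h1 => flow_opA_ne h1 t⟩
  have := flow_opA_ne h1 (-t)
  rwa [linFlow_neg_cancel] at this

lemma orbit_flow (x : Euc d) (t : ℝ) : flowOrbit A (linFlow A t x) = flowOrbit A x := by
  ext y
  constructor
  · rintro ⟨s, rfl⟩; exact ⟨s + t, by simp only [linFlow_add]⟩
  · rintro ⟨s, rfl⟩; exact ⟨s - t, by simp only [sub_eq_add_neg, linFlow_add, linFlow_neg_cancel]⟩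

lemma IsOrbitEquiv.symm (hO : IsOrbitEquiv A B h) : IsOrbitEquiv B A h.symm := by
  intro y
  have := hO (h.symm y)
  rw [h.apply_symm_apply] at this
  rw [← this, ← Set.image_comp]; simp

lemma IsOrbitEquiv.mem (hO : IsOrbitEquiv A B h) (x : Euc d) (t : ℝ) : h (linFlow A t x) ∈ flowOrbit B (h x) := by
  rw [← hO x]; exact ⟨_, ⟨t, rfl⟩, rfl⟩

lemma IsOrbitEquiv.fixed (hO : IsOrbitEquiv A B h) {x : Euc d} (hx : opA A x = 0) : opA B (h x) = 0 := by
  rw [← isFixedPt_iff] at hx ⊢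
  intro t
  have : linFlow B t (h x) ∈ h '' flowOrbit A x := by rw [hO x]; exact ⟨t, rfl⟩
  obtain ⟨_, ⟨s, rfl⟩, hs⟩ := this
  rw [← hs]; simp only [hx s]

lemma IsOrbitEquiv.fixed_iff (hO : IsOrbitEquiv A B h) {x : Euc d} : opA B (h x) = 0 ↔ opA A x = 0 := by
  refine ⟨fun h1 => ?_, hO.fixed⟩
  have := hO.symm.fixed h1
  rwa [h.symm_apply_apply] at this

lemma tau_ex (hO : IsOrbitEquiv A B h) (x : Euc d) :
    ∃ τ : ℝ → ℝ, Continuous τ ∧ τ 0 = 0 ∧ ∀ t, h (linFlow A t x) = linFlow B (τ t) (h x) := by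
  by_cases hx : opA A x = 0
  · refine ⟨fun _ => 0, continuous_const, rfl, fun t => ?_⟩
    rw [linFlow_zero, (isFixedPt_iff A x).2 hx t]
  · obtain ⟨τ, h1, h2, h3⟩ := lift_exists B (fun t => h (linFlow A t x)) (h.continuous.comp (continuous_linFlow_t A x))
      (fun t => by rw [Ne, hO.fixed_iff]; exact flow_opA_ne hx t) (h x) (fun t => hO.mem x t)
    simp only [linFlow_zero] at h3
    exact ⟨τ, h1, h2, h3⟩

def tau (hO : IsOrbitEquiv A B h) (x : Euc d) : ℝ → ℝ := (tau_ex hO x).choose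
lemma tau_continuous (hO : IsOrbitEquiv A B h) (x : Euc d) : Continuous (tau hO x) := (tau_ex hO x).choose_spec.1
@[simp] lemma tau_zero (hO : IsOrbitEquiv A B h) (x : Euc d) : tau hO x 0 = 0 := (tau_ex hO x).choose_spec.2.1
lemma tau_spec (hO : IsOrbitEquiv A B h) (x : Euc d) (t : ℝ) : h (linFlow A t x) = linFlow B (tau hO x t) (h x) :=
  (tau_ex hO x).choose_spec.2.2 t

lemma tau_uniqueOn (hO : IsOrbitEquiv A B h) {x : Euc d} (hx : opA A x ≠ 0) (S : Set ℝ) (hS : IsPreconnected S) (h0 : (0:ℝ) ∈ S)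
    (τ : ℝ → ℝ) (hτ : ContinuousOn τ S) (hτ0 : τ 0 = 0) (hh : ∀ t ∈ S, h (linFlow A t x) = linFlow B (τ t) (h x)) {t : ℝ} (ht : t ∈ S) :
    tau hO x t = τ t :=
  lift_unique B (h x) (by rwa [Ne, hO.fixed_iff]) S hS _ _ (tau_continuous hO x).continuousOn hτ
    (fun s hs => by rw [← tau_spec, hh s hs]) h0 ht (by rw [tau_zero, hτ0])

lemma tau_cocycle (hO : IsOrbitEquiv A B h) {x : Euc d} (hx : opA A x ≠ 0) (t s : ℝ) :
    tau hO x (t + s) = tau hO x t + tau hO (linFlow A t x) s := by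
  have := tau_uniqueOn hO (flow_opA_ne hx t) Set.univ isPreconnected_univ trivial (fun s => tau hO x (t + s) - tau hO x t)
    (((tau_continuous hO x).comp (by fun_prop)).sub continuous_const).continuousOn (by simp)
    (fun s _ => by
      rw [← linFlow_add, add_comm s t, tau_spec hO, tau_spec hO x t, ← linFlow_add]; congr 1; ring) (t := s) trivial
  linarith

lemma tau_inv (hO : IsOrbitEquiv A B h) (hO' : IsOrbitEquiv B A h.symm) {x : Euc d} (hx : opA A x ≠ 0) (t : ℝ) :
    tau hO' (h x) (tau hO x t) = t := by
  have hc := (tau_continuous hO' (h x)).comp (tau_continuous hO x)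
  refine lift_unique A x hx Set.univ isPreconnected_univ (fun t => tau hO' (h x) (tau hO x t)) id hc.continuousOn continuousOn_id
    (fun s _ => ?_) (s := 0) trivial trivial (by simp)
  have := tau_spec hO' (h x) (tau hO x s)
  rw [← tau_spec, h.symm_apply_apply, h.symm_apply_apply] at this
  exact this.symm

lemma tau_inv' (hO : IsOrbitEquiv A B h) (hO' : IsOrbitEquiv B A h.symm) {x : Euc d} (hx : opA A x ≠ 0) (t : ℝ) :
    tau hO x (tau hO' (h x) t) = t := by
  have hx' : opA B (h x) ≠ 0 := by rwa [Ne, hO.fixed_iff]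
  have hc := (tau_continuous hO x).comp (tau_continuous hO' (h x))
  refine lift_unique B (h x) hx' Set.univ isPreconnected_univ (fun t => tau hO x (tau hO' (h x) t)) id hc.continuousOn continuousOn_id
    (fun s _ => ?_) (s := 0) trivial trivial (by simp)
  have := tau_spec hO' (h x) s
  rw [h.symm_apply_apply] at this
  simp only [← tau_spec, ← this, h.apply_symm_apply, id]

lemma tau_mono_or (hO : IsOrbitEquiv A B h) {x : Euc d} (hx : opA A x ≠ 0) : StrictMono (tau hO x) ∨ StrictAnti (tau hO x) :=
  (tau_continuous hO x).strictMono_of_inj (fun a b hab => by rw [← tau_inv hO hO.symm hx a, hab, tau_inv hO hO.symm hx b])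

lemma tau_strictMono (hO : IsOrbitEquiv A B h) {x : Euc d} (hx : opA A x ≠ 0) (h1 : 0 < tau hO x 1) : StrictMono (tau hO x) := by
  rcases tau_mono_or hO hx with h2 | h2
  · exact h2
  · have := h2 (show (0:ℝ) < 1 by norm_num); rw [tau_zero] at this; linarith
lemma tau_strictAnti (hO : IsOrbitEquiv A B h) {x : Euc d} (hx : opA A x ≠ 0) (h1 : tau hO x 1 < 0) : StrictAnti (tau hO x) := by
  rcases tau_mono_or hO hx with h2 | h2
  · have := h2 (show (0:ℝ) < 1 by norm_num); rw [tau_zero] at this; linarith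
  · exact h2
lemma tau_one_ne (hO : IsOrbitEquiv A B h) {x : Euc d} (hx : opA A x ≠ 0) : tau hO x 1 ≠ 0 := by
  intro h0
  have := tau_inv hO hO.symm hx 1
  rw [h0, tau_zero] at this; norm_num at this

lemma nonfixed_open (A : Matrix (Fin d) (Fin d) ℝ) : IsOpen {x : Euc d | opA A x ≠ 0} :=
  isOpen_ne_fun (continuous_opA A) continuous_const

lemma tau_local (hO : IsOrbitEquiv A B h) {x : Euc d} (hx : opA A x ≠ 0) :
    ∃ δ > 0, ∀ t, |t| < δ → ContinuousAt (fun p : ℝ × Euc d => tau hO p.2 p.1) (t, x) := by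
  obtain ⟨V, hVo, hV0, σ, hσ, hV⟩ := flowbox B (h x) (by rwa [Ne, hO.fixed_iff])
  have hc : Continuous fun p : ℝ × Euc d => h (linFlow A p.1 p.2) := h.continuous.comp (continuous_linFlow A)
  have h1 : ∀ᶠ p in 𝓝 ((0:ℝ), x), h (linFlow A p.1 p.2) ∈ V :=
    hc.continuousAt.eventually (by simpa using hVo.mem_nhds hV0)
  obtain ⟨δ, hδ, h2⟩ := Metric.eventually_nhds_iff.1 h1
  have h2' : ∀ t y, |t| < δ → dist y x < δ → h (linFlow A t y) ∈ V := fun t y ht hy => h2 (y := (t, y)) (by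
    rw [Prod.dist_eq]; exact max_lt (by simpa [Real.dist_eq] using ht) hy)
  refine ⟨δ, hδ, fun t ht => ?_⟩
  have hU : ∀ᶠ p in 𝓝 (t, x), |p.1| < δ ∧ dist p.2 x < δ ∧ opA A p.2 ≠ 0 := by
    have c1 : ContinuousAt (fun p : ℝ × Euc d => |p.1|) (t, x) := by fun_prop
    have c2 : ContinuousAt (fun p : ℝ × Euc d => dist p.2 x) (t, x) := by fun_prop
    have c3 : ContinuousAt (fun p : ℝ × Euc d => p.2) (t, x) := by fun_prop
    exact (c1.eventually (gt_mem_nhds ht)).and ((c2.eventually (gt_mem_nhds (by simpa using hδ))).and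
      (c3.eventually ((nonfixed_open A).mem_nhds hx)))
  have heq : (fun p : ℝ × Euc d => tau hO p.2 p.1) =ᶠ[𝓝 (t, x)] fun p => σ (h p.2) - σ (h (linFlow A p.1 p.2)) := by
    filter_upwards [hU] with p hp
    obtain ⟨p1, p2, p3⟩ := hp
    have hin : ∀ s ∈ Set.Ioo (-δ) δ, h (linFlow A s p.2) ∈ V := fun s hs => h2' s p.2 (abs_lt.2 hs) p2
    have hcs : Continuous fun s => h (linFlow A s p.2) := h.continuous.comp (continuous_linFlow_t A p.2)
    refine tau_uniqueOn hO p3 (Set.Ioo (-δ) δ) isPreconnected_Ioo ⟨by linarith, hδ⟩ (fun s => σ (h p.2) - σ (h (linFlow A s p.2)))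
      (continuousOn_const.sub (hσ.comp hcs.continuousOn hin)) (by simp) (fun s hs => ?_) (abs_lt.1 p1)
    exact hV (h p.2) ((fun s => h (linFlow A s p.2)) '' Set.Ioo (-δ) δ) (by rintro _ ⟨s, hs, rfl⟩; exact hin s hs)
      (isPreconnected_Ioo.image _ hcs.continuousOn) (by rintro _ ⟨s, hs, rfl⟩; exact hO.mem _ _) _
      ⟨0, ⟨by linarith, hδ⟩, by simp⟩ _ ⟨s, hs, rfl⟩
  refine ContinuousAt.congr ?_ heq.symm
  have cσ : ∀ y ∈ V, ContinuousAt σ y := fun y hy => hσ.continuousAt (hVo.mem_nhds hy)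
  refine ContinuousAt.sub ?_ ?_
  · exact ContinuousAt.comp (g := σ) (f := fun p : ℝ × Euc d => h p.2) (cσ _ hV0) (by fun_prop)
  · exact ContinuousAt.comp (g := σ) (f := fun p : ℝ × Euc d => h (linFlow A p.1 p.2)) (cσ _ (h2' t x ht (by simpa using hδ))) hc.continuousAt

lemma tau_contAt_x (hO : IsOrbitEquiv A B h) {x : Euc d} (hx : opA A x ≠ 0) (t : ℝ) :
    ContinuousAt (fun y => tau hO y t) x := by
  have hnear : ∀ _ : ℝ, ∀ᶠ y in 𝓝 x, opA A y ≠ 0 := fun _ => (nonfixed_open A).mem_nhds hx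
  have hstep : ∀ s, ∃ δ > 0, ∀ r, |r| < δ → ContinuousAt (fun y => tau hO (linFlow A s y) r) x := by
    intro s
    obtain ⟨δ, hδ, hl⟩ := tau_local hO (flow_opA_ne hx s)
    refine ⟨δ, hδ, fun r hr => ?_⟩
    exact ContinuousAt.comp (f := fun y => (r, linFlow A s y)) (g := fun p : ℝ × Euc d => tau hO p.2 p.1) (hl r hr)
      (continuousAt_const.prodMk (continuous_linFlow_x A s).continuousAt)
  have hiff : ∀ s, ∃ δ > 0, ∀ r, |r| < δ → (ContinuousAt (fun y => tau hO y (s + r)) x ↔ ContinuousAt (fun y => tau hO y s) x) := by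
    intro s
    obtain ⟨δ, hδ, hl⟩ := hstep s
    refine ⟨δ, hδ, fun r hr => ?_⟩
    have e : (fun y => tau hO y (s + r)) =ᶠ[𝓝 x] fun y => tau hO y s + tau hO (linFlow A s y) r := by
      filter_upwards [hnear s] with y hy using tau_cocycle hO hy s r
    constructor
    · intro h1
      have := (h1.congr e).sub (hl r hr)
      refine this.congr (Eventually.of_forall fun y => ?_)
      simp
    · intro h1
      exact (h1.add (hl r hr)).congr e.symm
  have hclopen : IsClopen {s | ContinuousAt (fun y => tau hO y s) x} := by
    constructor
    · rw [← isOpen_compl_iff, Metric.isOpen_iff]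
      intro s hs
      obtain ⟨δ, hδ, hl⟩ := hiff s
      refine ⟨δ, hδ, fun r hr h1 => hs ?_⟩
      have := hl (r - s) (by simpa [Real.dist_eq] using hr)
      rw [add_sub_cancel] at this
      exact this.1 h1
    · rw [Metric.isOpen_iff]
      intro s hs
      obtain ⟨δ, hδ, hl⟩ := hiff s
      refine ⟨δ, hδ, fun r hr => ?_⟩
      have := hl (r - s) (by simpa [Real.dist_eq] using hr)
      rw [add_sub_cancel] at this
      exact this.2 hs
  have := hclopen.eq_univ ⟨0, by simp only [Set.mem_ofPred_eq, tau_zero]; exact continuousAt_const⟩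
  have ht : t ∈ {s | ContinuousAt (fun y => tau hO y s) x} := by rw [this]; trivial
  exact ht

lemma tau_contAt (hO : IsOrbitEquiv A B h) {x : Euc d} (hx : opA A x ≠ 0) (t : ℝ) :
    ContinuousAt (fun p : ℝ × Euc d => tau hO p.2 p.1) (t, x) := by
  obtain ⟨δ, hδ, hl⟩ := tau_local hO (flow_opA_ne hx t)
  have h1 : ContinuousAt (fun p : ℝ × Euc d => tau hO (linFlow A t p.2) (p.1 - t)) (t, x) :=
    ContinuousAt.comp (f := fun p : ℝ × Euc d => (p.1 - t, linFlow A t p.2)) (g := fun p : ℝ × Euc d => tau hO p.2 p.1) (x := (t, x))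
      (by simpa using hl 0 (by simpa using hδ)) (ContinuousAt.prodMk (by fun_prop) ((continuous_linFlow_x A t).comp continuous_snd).continuousAt)
  have h2 : ContinuousAt (fun p : ℝ × Euc d => tau hO p.2 t) (t, x) :=
    ContinuousAt.comp (f := fun p : ℝ × Euc d => p.2) (g := fun y => tau hO y t) (x := (t, x)) (tau_contAt_x hO hx t) continuousAt_snd
  refine (h2.add h1).congr ?_
  have h3 : ∀ᶠ p in 𝓝 (t, x), opA A p.2 ≠ 0 := (continuousAt_snd (p := (t, x))).eventually ((nonfixed_open A).mem_nhds hx)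
  filter_upwards [h3] with p hp
  have := tau_cocycle hO hp t (p.1 - t)
  rw [add_sub_cancel] at this
  exact this.symm

/-- compatible time filters -/
def GoodL (hO : IsOrbitEquiv A B h) (L : Filter ℝ) : Prop :=
  (L = atTop ∧ ∀ x, opA A x ≠ 0 → 0 < tau hO x 1) ∨ L = cocompact ℝ

lemma GoodL.symm {hO : IsOrbitEquiv A B h} {L : Filter ℝ} (hL : GoodL hO L) : GoodL hO.symm L := by
  rcases hL with ⟨h1, h2⟩ | h1
  · refine Or.inl ⟨h1, fun y hy => ?_⟩
    have hx : opA A (h.symm y) ≠ 0 := by rwa [Ne, hO.symm.fixed_iff]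
    have hm := tau_strictMono hO hx (h2 _ hx)
    rw [← hm.lt_iff_lt, tau_zero]
    have := tau_inv' hO hO.symm hx 1
    rw [h.apply_symm_apply] at this
    rw [this]; exact one_pos
  · exact Or.inr h1

lemma GoodL.atTop_le {hO : IsOrbitEquiv A B h} {L : Filter ℝ} (hL : GoodL hO L) : atTop ≤ L := by
  rcases hL with ⟨h1, -⟩ | h1
  · exact h1.ge
  · rw [h1]; exact atTop_le_cocompact

lemma GoodL.le_cocompact {hO : IsOrbitEquiv A B h} {L : Filter ℝ} (hL : GoodL hO L) : L ≤ cocompact ℝ := by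
  rcases hL with ⟨h1, -⟩ | h1
  · rw [h1]; exact atTop_le_cocompact
  · exact h1.le

lemma tau_sign (hO : IsOrbitEquiv A B h) {x : Euc d} (hx : opA A x ≠ 0) : ∀ᶠ y in 𝓝 x, (0 < tau hO y 1 ↔ 0 < tau hO x 1) ∧ opA A y ≠ 0 := by
  have hc := tau_contAt_x hO hx 1
  have hn := (nonfixed_open A).mem_nhds hx
  rcases lt_or_gt_of_ne (tau_one_ne hO hx) with h1 | h1
  · filter_upwards [hc.eventually (gt_mem_nhds h1), hn] with y hy hy2
    exact ⟨⟨fun h => absurd h (not_lt.2 hy.le), fun h => absurd h (not_lt.2 h1.le)⟩, hy2⟩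
  · filter_upwards [hc.eventually (lt_mem_nhds h1), hn] with y hy hy2
    exact ⟨⟨fun _ => h1, fun _ => hy⟩, hy2⟩

lemma tau_unif (hO : IsOrbitEquiv A B h) {x : Euc d} (hx : opA A x ≠ 0) (M : ℝ) :
    ∃ T : ℝ, ∀ᶠ y in 𝓝 x, ∀ t, T ≤ |t| → M ≤ |tau hO y t| := by
  set M' := |M| + 1 with hM'
  have hMp : 0 < M' := by positivity
  obtain ⟨T1, hT1⟩ : ∃ T1, tau hO x T1 = M' := ⟨_, tau_inv' hO hO.symm hx M'⟩
  obtain ⟨T2, hT2⟩ : ∃ T2, tau hO x T2 = -M' := ⟨_, tau_inv' hO hO.symm hx (-M')⟩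
  have hM2 : |M| < M' := by linarith
  refine ⟨max |T1| |T2|, ?_⟩
  filter_upwards [tau_sign hO hx, (tau_contAt_x hO hx T1).eventually (lt_mem_nhds (show |M| < tau hO x T1 by rw [hT1]; exact hM2)),
    (tau_contAt_x hO hx T2).eventually (gt_mem_nhds (show tau hO x T2 < -|M| by rw [hT2]; linarith))] with y hy h1 h2 t ht
  have ht1 : |T1| ≤ |t| := (le_max_left _ _).trans ht
  have ht2 : |T2| ≤ |t| := (le_max_right _ _).trans ht
  have hMM := le_abs_self M
  rcases tau_mono_or hO hy.2 with hm | hm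
  · rcases le_total 0 t with h0 | h0
    · have := hm.monotone (show T1 ≤ t by rw [abs_of_nonneg h0] at ht1; exact (le_abs_self _).trans ht1)
      exact le_trans (by linarith) (le_abs_self _)
    · have := hm.monotone (show t ≤ T2 by rw [abs_of_nonpos h0] at ht2; linarith [neg_abs_le T2])
      exact le_trans (by linarith) (neg_le_abs _)
  · rcases le_total 0 t with h0 | h0
    · have := hm.antitone (show T2 ≤ t by rw [abs_of_nonneg h0] at ht2; exact (le_abs_self _).trans ht2)
      exact le_trans (by linarith) (neg_le_abs _)
    · have := hm.antitone (show t ≤ T1 by rw [abs_of_nonpos h0] at ht1; linarith [neg_abs_le T1])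
      exact le_trans (by linarith) (le_abs_self _)

lemma tendsto_cocompact_iff_abs {s : ℕ → ℝ} : Tendsto s atTop (cocompact ℝ) ↔ Tendsto (fun n => |s n|) atTop atTop := by
  rw [← Metric.cobounded_eq_cocompact, ← tendsto_norm_atTop_iff_cobounded]; rfl

lemma tendsto_goodL {hO : IsOrbitEquiv A B h} {L : Filter ℝ} (hL : GoodL hO L) {u : ℕ → Euc d} {t : ℕ → ℝ} (ht : Tendsto t atTop L)
    (hu : ∀ᶠ n in atTop, opA A (u n) ≠ 0) (habs : Tendsto (fun n => |tau hO (u n) (t n)|) atTop atTop) :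
    Tendsto (fun n => tau hO (u n) (t n)) atTop L := by
  rcases hL with ⟨h1, h2⟩ | h1
  · subst h1
    refine habs.congr' ?_
    filter_upwards [hu, ht.eventually_gt_atTop 0] with n h3 h4
    rw [abs_of_pos]
    have := tau_strictMono hO h3 (h2 _ h3) h4
    rwa [tau_zero] at this
  · subst h1
    rwa [tendsto_cocompact_iff_abs]

lemma tau_tendsto {hO : IsOrbitEquiv A B h} {L : Filter ℝ} (hL : GoodL hO L) {u : ℕ → Euc d} {t : ℕ → ℝ} {x : Euc d} (hx : opA A x ≠ 0)
    (hu : Tendsto u atTop (𝓝 x)) (ht : Tendsto t atTop L) : Tendsto (fun n => tau hO (u n) (t n)) atTop L := by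
  refine tendsto_goodL hL ht (hu.eventually ((nonfixed_open A).mem_nhds hx)) ?_
  have ht' := tendsto_cocompact_iff_abs.1 (ht.mono_right hL.le_cocompact)
  rw [tendsto_atTop]
  intro M
  obtain ⟨T, hT⟩ := tau_unif hO hx M
  filter_upwards [hu.eventually hT, ht'.eventually_ge_atTop T] with n h1 h2 using h1 _ h2

lemma opW_image_sub {hO : IsOrbitEquiv A B h} {L : Filter ℝ} (hL : GoodL hO L) (S : Set (Euc d)) :
    h '' opW A L S ⊆ opW B L (h '' S) := by
  rintro _ ⟨x, ⟨hx, u, t, z, h1, h2, h3, h4⟩, rfl⟩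
  refine ⟨⟨x, hx, rfl⟩, ?_⟩
  by_cases hf : opA A x = 0
  · refine ⟨fun _ => h x, fun n => (n:ℝ), h x, fun _ => ⟨x, hx, rfl⟩, tendsto_const_nhds, tendsto_natCast_atTop_atTop.mono_right hL.atTop_le, ?_⟩
    simp only [(isFixedPt_iff B (h x)).2 (hO.fixed hf) _]
    exact tendsto_const_nhds
  · refine ⟨fun n => h (u n), fun n => tau hO (u n) (t n), h z, fun n => ⟨_, h1 n, rfl⟩, (h.continuous.tendsto x).comp h2, tau_tendsto hL hf h2 h3, ?_⟩
    simp only [← tau_spec]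
    exact (h.continuous.tendsto z).comp h4

lemma opW_image {hO : IsOrbitEquiv A B h} {L : Filter ℝ} (hL : GoodL hO L) (S : Set (Euc d)) :
    h '' opW A L S = opW B L (h '' S) := by
  refine (opW_image_sub hL S).antisymm ?_
  have := opW_image_sub hL.symm (h '' S)
  rw [← Set.image_comp] at this
  simp only [Homeomorph.symm_comp_self, Set.image_id] at this
  have h2 := Set.image_mono (f := h) this
  rwa [← Set.image_comp, Homeomorph.self_comp_symm, Set.image_id] at h2

lemma opE_image_sub (h0 : h 0 = 0) {hO : IsOrbitEquiv A B h} {L : Filter ℝ} (hL : GoodL hO L) (S : Set (Euc d)) :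
    h '' opE A L S ⊆ opE B L (h '' S) := by
  rintro _ ⟨x, ⟨hx, u, t, h1, h2, h3, h4⟩, rfl⟩
  refine ⟨⟨x, hx, rfl⟩, ?_⟩
  by_cases hx0 : x = 0
  · refine ⟨fun _ => h x, fun n => (n:ℝ), fun _ => ⟨x, hx, rfl⟩, tendsto_const_nhds, tendsto_natCast_atTop_atTop.mono_right hL.atTop_le, ?_⟩
    simp [hx0, h0]
  have hflow : Tendsto (fun n => linFlow B (tau hO (u n) (t n)) (h (u n))) atTop (𝓝 0) := by
    simp only [← tau_spec]
    have := (h.continuous.tendsto 0).comp h4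
    rwa [h0] at this
  refine ⟨fun n => h (u n), fun n => tau hO (u n) (t n), fun n => ⟨_, h1 n, rfl⟩, (h.continuous.tendsto x).comp h2, ?_, hflow⟩
  by_cases hf : opA A x = 0
  · have hxp : 0 < ‖x‖ := norm_pos_iff.2 hx0
    have hhx0 : h x ≠ 0 := fun hh => hx0 (h.injective (by rw [hh, h0]))
    have hnf : ∀ᶠ n in atTop, opA A (u n) ≠ 0 := by
      filter_upwards [h2.norm.eventually (lt_mem_nhds (show ‖x‖/2 < ‖x‖ by linarith)), h4.norm.eventually (gt_mem_nhds (show ‖(0:Euc d)‖ < ‖x‖/2 by simp [hxp]))] with n k1 k2 k3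
      rw [(isFixedPt_iff A (u n)).2 k3] at k2
      linarith
    refine tendsto_goodL hL h3 hnf ?_
    obtain ⟨K, hK, hKb⟩ := flow_bound B
    rw [tendsto_atTop]
    intro M
    have hhp : 0 < ‖h x‖ := norm_pos_iff.2 hhx0
    have hl1 : Tendsto (fun n => ‖h (u n)‖) atTop (𝓝 ‖h x‖) := ((h.continuous.tendsto x).comp h2).norm
    have hl2 := hflow.norm
    rw [norm_zero] at hl2
    have hcp : 0 < Real.exp (-(K * M)) * (‖h x‖/2) := by positivity
    filter_upwards [hl1.eventually (lt_mem_nhds (show ‖h x‖/2 < ‖h x‖ by linarith)), hl2.eventually (gt_mem_nhds hcp)] with n k1 k2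
    by_contra hlt
    rw [not_le] at hlt
    have k3 := hKb (-(tau hO (u n) (t n))) (linFlow B (tau hO (u n) (t n)) (h (u n)))
    rw [linFlow_neg_cancel, abs_neg] at k3
    have k4 : Real.exp (K * |tau hO (u n) (t n)|) ≤ Real.exp (K * M) := Real.exp_le_exp.2 (by gcongr)
    have k5 : ‖h (u n)‖ ≤ Real.exp (K * M) * ‖linFlow B (tau hO (u n) (t n)) (h (u n))‖ := k3.trans (by gcongr)
    have k6 : Real.exp (K * M) * ‖linFlow B (tau hO (u n) (t n)) (h (u n))‖ < Real.exp (K * M) * (Real.exp (-(K * M)) * (‖h x‖/2)) := by gcongr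
    rw [← mul_assoc, ← Real.exp_add, add_neg_cancel, Real.exp_zero, one_mul] at k6
    linarith
  · exact tau_tendsto hL hf h2 h3

lemma opE_image (h0 : h 0 = 0) {hO : IsOrbitEquiv A B h} {L : Filter ℝ} (hL : GoodL hO L) (S : Set (Euc d)) :
    h '' opE A L S = opE B L (h '' S) := by
  refine (opE_image_sub h0 hL S).antisymm ?_
  have h0' : h.symm 0 = 0 := by rw [h.symm_apply_eq, h0]
  have := opE_image_sub h0' hL.symm (h '' S)
  rw [← Set.image_comp] at this
  simp only [Homeomorph.symm_comp_self, Set.image_id] at this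
  have h2 := Set.image_mono (f := h) this
  rwa [← Set.image_comp, Homeomorph.self_comp_symm, Set.image_id] at h2
end

section
open Filter Topology
attribute [local irreducible] linFlow
variable {d : ℕ} {A : Matrix (Fin d) (Fin d) ℝ}

lemma jet_trunc {K n : ℕ} (hn : n ≤ K) (t : ℝ) (x : ℕ → ℂ) (j : ℕ) (h : ∀ i, n ≤ i → x (j+i) = 0) :
    jet K t x j = ∑ i ∈ Finset.range n, ((t:ℂ)^i / (i.factorial : ℂ)) * x (j+i) := by
  rw [jet]; symm
  refine Finset.sum_subset (fun i hi => by simp at hi ⊢; omega) fun i _ hi => ?_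
  rw [h i (by simpa using hi), mul_zero]

namespace NF
variable (N : NF A)

lemma top_ind (b : N.β) {x : Euc d} (h : ∀ K, (∀ j, K < j → N.c b j x = 0) → N.c b K x = 0) (j : ℕ) : N.c b j x = 0 := by
  have : ∀ n j, N.m b ≤ j + n → N.c b j x = 0 := by
    intro n
    induction n with
    | zero => intro j hj; exact N.c_top b j x hj
    | succ n ih =>
      intro j hj
      exact h j fun i hi => ih i (by omega)
  exact this (N.m b) j (by omega)

lemma flow_top (b : N.β) {x : Euc d} (K : ℕ) (h : ∀ j, K < j → N.c b j x = 0) (t : ℝ) :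
    N.c b K (linFlow A t x) = Complex.exp (N.lam b * t) * N.c b K x := by
  rw [N.flow_jet b K (K+1) t x (fun i hi => h i hi), jet_trunc (n := 1) (by omega) _ _ _ (fun i hi => h _ (by omega))]
  simp

lemma flow_top2 (b : N.β) {x : Euc d} (K : ℕ) (h : ∀ j, K + 1 < j → N.c b j x = 0) (t : ℝ) :
    N.c b K (linFlow A t x) = Complex.exp (N.lam b * t) * (N.c b K x + t * N.c b (K+1) x) := by
  rw [N.flow_jet b K (K+2) t x (fun i hi => h i hi), jet_trunc (n := 2) (by omega) _ _ _ (fun i hi => h _ (by omega))]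
  simp [Finset.sum_range_succ]

/-- scaling of the normal form -/
def smul (α : ℝ) (hα : α ≠ 0) : NF (α • A) where
  β := N.β
  fin := N.fin
  lam b := if 0 < α then α * N.lam b else α * (starRingEnd ℂ) (N.lam b)
  m := N.m
  c b j := (α ^ j) • (if 0 < α then N.c b j else (Complex.conjAe.toLinearMap).comp (N.c b j))
  im_nonneg b := by
    split_ifs with h
    · simpa using mul_nonneg h.le (N.im_nonneg b)
    · have := N.im_nonneg b
      simp; nlinarith [not_lt.1 h]
  c_A b j x := by
    have e : opA (α • A) x = α • opA A x := by simp [opA]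
    rw [e]
    split_ifs with h
    · simp [N.c_A, pow_succ]; ring
    · simp [N.c_A, pow_succ]; ring
  c_top b j x h := by
    split_ifs <;> simp [N.c_top b j x h]
  c_real b j x h := by
    have : (N.lam b).im = 0 := by
      split_ifs at h <;> simpa [hα] using h
    have := N.c_real b j x this
    split_ifs <;> simp [this, ← Complex.ofReal_pow]
  inj x h := by
    refine N.inj x fun b j hj => ?_
    have := h b j hj
    split_ifs at this <;> simpa [hα] using this
  surj a ha := by
    obtain ⟨x, hx⟩ := N.surj (fun b j => if 0 < α then ((α:ℂ)^j)⁻¹ * a b j else ((α:ℂ)^j)⁻¹ * (starRingEnd ℂ) (a b j)) (by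
      intro b j h
      have h1 := ha b j (by split_ifs <;> simp [h])
      have e : ((α:ℂ)^j)⁻¹ = (((α^j)⁻¹ : ℝ) : ℂ) := by push_cast; rfl
      split_ifs <;> rw [e, Complex.im_ofReal_mul] <;> simp [h1])
    refine ⟨x, fun b j hj => ?_⟩
    have hα' : (α:ℂ) ≠ 0 := by exact_mod_cast hα
    have := hx b j hj
    split_ifs at this ⊢ with h0 <;> simp [this, hα'] 

lemma smul_c_eq_zero (α : ℝ) (hα : α ≠ 0) (b : N.β) (j : ℕ) (x : Euc d) : (N.smul α hα).c b j x = 0 ↔ N.c b j x = 0 := by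
  simp only [smul]
  split_ifs <;> simp [hα]

lemma smul_re (α : ℝ) (hα : α ≠ 0) (b : N.β) : ((N.smul α hα).lam b).re = α * (N.lam b).re := by
  simp only [smul]; split_ifs <;> simp

lemma smul_Y (α : ℝ) (hα : α ≠ 0) (I : N.β → ℕ → Prop) : (N.smul α hα).Y I = N.Y I := by
  ext x
  show (∀ b j, ¬ I b j → (N.smul α hα).c b j x = 0) ↔ (∀ b j, ¬ I b j → N.c b j x = 0)
  exact forall_congr' fun b => forall_congr' fun j => imp_congr_right fun _ => N.smul_c_eq_zero α hα b j x

lemma mem_ker (x : Euc d) : opA A x = 0 ↔ x ∈ N.Y (fun b j => j = 0 ∧ N.lam b = 0) := by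
  rw [mem_Y]
  constructor
  · intro h b j hj
    have h1 : ∀ j, N.lam b * N.c b j x + N.c b (j+1) x = 0 := fun j => by rw [← N.c_A, h, map_zero]
    by_cases h0 : N.lam b = 0
    · obtain ⟨i, rfl⟩ : ∃ i, j = i + 1 := Nat.exists_eq_succ_of_ne_zero fun h => hj ⟨h, h0⟩
      simpa [h0] using h1 i
    · refine N.top_ind b (fun K hK => ?_) j
      have := h1 K
      rw [hK (K+1) (by omega), add_zero] at this
      exact (mul_eq_zero.1 this).resolve_left h0
  · intro h
    refine N.inj _ fun b j _ => ?_
    rw [N.c_A, h b (j+1) (by simp), add_zero]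
    by_cases h0 : N.lam b = 0
    · simp [h0]
    · rw [h b j (by tauto), mul_zero]

lemma mem_P {T : ℝ} (hT : T ≠ 0) (x : Euc d) : linFlow A T x = x ↔ x ∈ N.Y (fun b j => j = 0 ∧ Complex.exp (N.lam b * T) = 1) := by
  rw [mem_Y]
  constructor
  · intro h b j hj
    have h2 : ∀ j, 0 < j → N.c b j x = 0 := by
      have : ∀ j, N.c b (j+1) x = 0 := by
        intro j
        have : ∀ n j, N.m b ≤ j + n → N.c b (j+1) x = 0 := by
          intro n
          induction n with
          | zero => intro j hj; exact N.c_top b _ x (by omega)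
          | succ n ih =>
            intro j hj
            by_contra hne
            have hz : ∀ i, j + 1 < i → N.c b i x = 0 := by
              intro i hi
              have := ih (i-1) (by omega)
              rwa [Nat.sub_add_cancel (by omega)] at this
            have e1 := N.flow_top b (j+1) hz T
            rw [h] at e1
            have e2 : Complex.exp (N.lam b * T) = 1 := by
              have : (Complex.exp (N.lam b * T) - 1) * N.c b (j+1) x = 0 := by linear_combination -e1
              have := (mul_eq_zero.1 this).resolve_right hne
              linear_combination this
            have e3 := N.flow_top2 b j hz T
            rw [h, e2, one_mul] at e3
            simp at e3
            rcases e3 with e3 | e3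
            · exact hT e3
            · exact hne e3
        exact this (N.m b) j (by omega)
      intro j hj
      obtain ⟨i, rfl⟩ := Nat.exists_eq_succ_of_ne_zero hj.ne'
      exact this i
    rcases Nat.eq_zero_or_pos j with rfl | hp
    · have e1 := N.flow_top b 0 h2 T
      rw [h] at e1
      have : (Complex.exp (N.lam b * T) - 1) * N.c b 0 x = 0 := by linear_combination -e1
      refine (mul_eq_zero.1 this).resolve_left fun h3 => hj ⟨rfl, by linear_combination h3⟩
    · exact h2 j hp
  · intro h
    refine N.ext_c fun b j _ => ?_
    rcases Nat.eq_zero_or_pos j with rfl | hp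
    · rw [N.flow_top b 0 (fun j hj => h b j (by simp; omega)) T]
      by_cases h0 : Complex.exp (N.lam b * T) = 1
      · rw [h0, one_mul]
      · rw [h b 0 (by tauto), mul_zero]
    · rw [N.flow_top b j (fun i hi => h b i (by simp; omega)) T, h b j (by simp; omega), mul_zero]

lemma exp_one_re {l : ℂ} {T : ℝ} (hT : T ≠ 0) (h : Complex.exp (l * T) = 1) : l.re = 0 := by
  have := congrArg norm h
  rw [Complex.norm_exp, norm_one, Real.exp_eq_one_iff] at this
  simpa [hT] using this

/-- bounded orbits subspace -/
abbrev Bd : Submodule ℝ (Euc d) := N.Y (fun b j => j = 0 ∧ (N.lam b).re = 0)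

lemma flow_Bd {x : Euc d} (hx : x ∈ N.Bd) (t : ℝ) (b : N.β) : N.c b 0 (linFlow A t x) = Complex.exp (N.lam b * t) * N.c b 0 x :=
  N.flow_top b 0 (fun j hj => hx b j (by omega)) t

lemma flow_mem_Bd {x : Euc d} (hx : x ∈ N.Bd) (t : ℝ) : linFlow A t x ∈ N.Bd := by
  intro b j hj
  rw [N.flow_top b j, hx b j hj, mul_zero]
  intro i hi
  exact hx b i fun h => by omega

lemma norm_flow_Bd {x : Euc d} (hx : x ∈ N.Bd) (t : ℝ) (b : N.β) (j : ℕ) : ‖N.c b j (linFlow A t x)‖ = ‖N.c b j x‖ := by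
  by_cases h : j = 0 ∧ (N.lam b).re = 0
  · rw [h.1, N.flow_Bd hx, norm_mul, N.norm_exp_central b h.2, one_mul]
  · rw [N.flow_mem_Bd hx t b j h, hx b j h]

lemma Bd_bound : ∃ C : ℝ, 0 < C ∧ ∀ x ∈ N.Bd, ∀ t, ‖linFlow A t x‖ ≤ C * ‖x‖ := by
  obtain ⟨C, hC, h1⟩ := N.c_bound
  obtain ⟨C', hC', h2⟩ := N.norm_bound
  refine ⟨C' * C, by positivity, fun x hx t => ?_⟩
  rw [mul_assoc]
  refine h2 _ _ (by positivity) fun b j _ => ?_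
  rw [N.norm_flow_Bd hx]
  exact h1 b j x

lemma mem_Bd (x : Euc d) : x ∈ N.Bd ↔ Bornology.IsBounded (flowOrbit A x) := by
  constructor
  · intro hx
    obtain ⟨C, hC, h⟩ := N.Bd_bound
    rw [isBounded_iff_forall_norm_le]
    exact ⟨C * ‖x‖, by rintro _ ⟨t, rfl⟩; exact h x hx t⟩
  · intro hb
    obtain ⟨R, hR⟩ := isBounded_iff_forall_norm_le.1 hb
    obtain ⟨C, hC, hcb⟩ := N.c_bound
    have hR' : ∀ b j t, ‖N.c b j (linFlow A t x)‖ ≤ C * R := fun b j t => (hcb b j _).trans (by gcongr; exact hR _ ⟨t, rfl⟩)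
    have key : ∀ b, (N.lam b).re ≠ 0 → ∀ j, N.c b j x = 0 := by
      intro b hb
      refine N.top_ind b fun K hK => ?_
      by_contra hne
      have hp : 0 < ‖N.c b K x‖ := norm_pos_iff.2 hne
      have : ∀ s : ℝ, Real.exp s * ‖N.c b K x‖ ≤ C * R := by
        intro s
        have := hR' b K (s / (N.lam b).re)
        rw [N.flow_top b K hK, norm_mul, Complex.norm_exp] at this
        have e : (N.lam b * ((s / (N.lam b).re : ℝ) : ℂ)).re = s := by
          rw [Complex.re_mul_ofReal]; field_simp
        rwa [e] at this
      have h3 := this (C * R / ‖N.c b K x‖)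
      have h4 := Real.add_one_le_exp (C * R / ‖N.c b K x‖)
      have h5 : (C * R / ‖N.c b K x‖ + 1) * ‖N.c b K x‖ ≤ C * R := le_trans (by gcongr) h3
      rw [add_mul, div_mul_cancel₀ _ hp.ne'] at h5
      linarith
    intro b j hj
    by_cases hre : (N.lam b).re = 0
    · have hj : j ≠ 0 := fun h => hj ⟨h, hre⟩
      have : ∀ n j, N.m b ≤ j + n → N.c b (j+1) x = 0 := by
        intro n
        induction n with
        | zero => intro j hj; exact N.c_top b _ x (by omega)
        | succ n ih =>
          intro j hj
          by_contra hne
          have hz : ∀ i, j + 1 < i → N.c b i x = 0 := by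
            intro i hi
            have := ih (i-1) (by omega)
            rwa [Nat.sub_add_cancel (by omega)] at this
          have hp : 0 < ‖N.c b (j+1) x‖ := norm_pos_iff.2 hne
          have hb2 : ∀ t : ℝ, |t| * ‖N.c b (j+1) x‖ - ‖N.c b j x‖ ≤ C * R := by
            intro t
            have e3 := N.flow_top2 b j hz t
            have h4 := hR' b j t
            rw [e3, norm_mul, N.norm_exp_central b hre, one_mul] at h4
            have h5 := norm_sub_norm_le ((t:ℂ) * N.c b (j+1) x) (-N.c b j x)
            rw [norm_neg, norm_mul, Complex.norm_real, Real.norm_eq_abs, sub_neg_eq_add, add_comm (_ * _)] at h5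
            exact h5.trans h4
          have := hb2 ((C * R + ‖N.c b j x‖ + 1) / ‖N.c b (j+1) x‖)
          have h6 := le_abs_self ((C * R + ‖N.c b j x‖ + 1) / ‖N.c b (j+1) x‖)
          have h7 : (C * R + ‖N.c b j x‖ + 1) / ‖N.c b (j+1) x‖ * ‖N.c b (j+1) x‖ ≤ |(C * R + ‖N.c b j x‖ + 1) / ‖N.c b (j+1) x‖| * ‖N.c b (j+1) x‖ := by gcongr
          rw [div_mul_cancel₀ _ hp.ne'] at h7
          linarith
      have := this (N.m b) (j-1) (by omega)
      rwa [Nat.sub_add_cancel (by omega)] at this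
    · exact key b hre j

lemma exists_proj (I : N.β → ℕ → Prop) : ∃ P : Euc d →ₗ[ℝ] Euc d, ∀ x b j, (I b j → N.c b j (P x) = N.c b j x) ∧ (¬ I b j → N.c b j (P x) = 0) := by
  classical
  have h : ∀ x, ∃ y, ∀ b j, j < N.m b → N.c b j y = if I b j then N.c b j x else 0 := fun x => N.surj _ (by
    intro b j hl; split_ifs
    · exact N.c_real b j x hl
    · simp)
  choose f hf using h
  refine ⟨{ toFun := f, map_add' := ?_, map_smul' := ?_ }, ?_⟩
  · intro x y; refine N.ext_c fun b j hj => ?_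
    rw [map_add, hf _ _ _ hj, hf _ _ _ hj, hf _ _ _ hj]; split_ifs <;> simp
  · intro a x; refine N.ext_c fun b j hj => ?_
    simp only [RingHom.id_apply]
    rw [map_smul, hf _ _ _ hj, hf _ _ _ hj]; split_ifs <;> simp
  · intro x b j
    simp only [LinearMap.coe_mk, AddHom.coe_mk]
    by_cases hj : j < N.m b
    · rw [hf _ _ _ hj]; constructor <;> intro h <;> simp [h]
    · rw [N.c_top b j _ (not_lt.1 hj), N.c_top b j _ (not_lt.1 hj)]; simp

end NF
end

section
open Filter Topology
attribute [local irreducible] linFlow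
variable {d : ℕ} {A B : Matrix (Fin d) (Fin d) ℝ}

namespace NF
variable (N : NF A)

lemma smul_Y_re {α : ℝ} (hα : α ≠ 0) {p q : ℝ → Prop} (h : ∀ r, p (α * r) ↔ q r) :
    (N.smul α hα).Y (fun b _ => p ((N.smul α hα).lam b).re) = N.Y (fun b _ => q (N.lam b).re) := by
  refine (N.smul_Y α hα _).trans ?_
  congr 1
  funext b _
  rw [N.smul_re α hα b, h]

lemma stableSet_eq : stableSet A = N.Y (fun b _ => (N.lam b).re < 0) := by
  ext x
  constructor
  · intro hx b j hj
    refine N.top_ind b (fun K hK => ?_) j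
    have h1 : Tendsto (fun t : ℝ => ‖N.c b K (linFlow A t x)‖) atTop (𝓝 0) := by
      have := ((N.continuous_c b K).tendsto 0).comp hx
      rw [map_zero] at this
      simpa using this.norm
    have h2 : ∀ᶠ t : ℝ in atTop, ‖N.c b K x‖ ≤ ‖N.c b K (linFlow A t x)‖ := by
      filter_upwards [eventually_ge_atTop 0] with t ht
      rw [N.flow_top b K hK, norm_mul, Complex.norm_exp, Complex.re_mul_ofReal]
      refine le_mul_of_one_le_left (norm_nonneg _) (Real.one_le_exp (mul_nonneg (not_lt.1 hj) ht))
    have := ge_of_tendsto h1 h2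
    exact norm_eq_zero.1 (le_antisymm this (norm_nonneg _))
  · intro hx
    show Tendsto (fun t : ℝ => linFlow A t x) atTop (𝓝 0)
    rw [N.tendsto_iff]
    intro b j hj
    rw [map_zero]
    by_cases hre : (N.lam b).re < 0
    · have e : ∀ t : ℝ, N.c b j (linFlow A t x) = Complex.exp (N.lam b * t) * jet (N.m b) t (fun i => N.c b i x) j :=
        fun t => N.flow_jet b j (N.m b) t x (fun i hi => N.c_top b i x hi)
      rw [tendsto_iff_seq_tendsto]
      intro s hs
      simp only [Function.comp_def, e]
      obtain ⟨C, hC, hcb⟩ := N.c_bound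
      exact exp_jet_tendsto (N.lam b) (N.m b) j s (fun _ i => N.c b i x) (C * ‖x‖) (fun n i => hcb b i x)
        (hs.const_mul_atTop_of_neg hre)
    · have e : ∀ t : ℝ, N.c b j (linFlow A t x) = 0 := by
        intro t
        rw [N.flow_top b j (fun i _ => hx b i hre), hx b j hre, mul_zero]
      simp only [e]; exact tendsto_const_nhds

lemma XS_eq : XS A = N.Y (fun b _ => (N.lam b).re < 0) := by
  rw [XS, N.stableSet_eq, Submodule.span_eq]

lemma unstableSet_eq : unstableSet A = N.Y (fun b _ => 0 < (N.lam b).re) := by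
  have h1 : unstableSet A = stableSet ((-1:ℝ) • A) := by
    ext x
    show Tendsto _ _ _ ↔ Tendsto _ _ _
    have : (fun t : ℝ => linFlow ((-1:ℝ) • A) t x) = (fun t : ℝ => linFlow A t x) ∘ (fun t => -t) := by
      funext t; simp [linFlow_neg_left]
    rw [this, ← tendsto_map'_iff, map_neg_atTop]
  rw [h1, (N.smul (-1) (by norm_num)).stableSet_eq]
  exact congrArg _ (N.smul_Y_re (p := fun r => r < 0) (q := fun r => 0 < r) _ (by simp))

lemma XU_eq : XU A = N.Y (fun b _ => 0 < (N.lam b).re) := by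
  rw [XU, N.unstableSet_eq, Submodule.span_eq]

lemma centralSet_eq : centralSet A = N.Y (fun b _ => (N.lam b).re = 0) := by
  ext x
  constructor
  · intro hx b j hj
    refine N.top_ind b (fun K hK => ?_) j
    have hj : (N.lam b).re ≠ 0 := hj
    have hlim : ∀ L : Filter ℝ, L.NeBot → L ≤ atBot ⊔ atTop → (∀ᶠ t in L, |(N.lam b).re| * |t| = (N.lam b).re * t) → N.c b K x = 0 := by
      intro L hne hL hev
      have h0 := (hx _ (abs_pos.2 hj)).mono_left hL
      have h1 : Tendsto (fun t : ℝ => ‖N.c b K (Real.exp (-(|(N.lam b).re| * |t|)) • linFlow A t x)‖) L (𝓝 0) := by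
        have := ((N.continuous_c b K).tendsto 0).comp h0
        rw [map_zero] at this
        simpa using this.norm
      have h2 : ∀ᶠ t : ℝ in L, ‖N.c b K x‖ ≤ ‖N.c b K (Real.exp (-(|(N.lam b).re| * |t|)) • linFlow A t x)‖ := by
        filter_upwards [hev] with t ht
        rw [map_smul, N.flow_top b K hK, norm_smul, norm_mul, Complex.norm_exp, Complex.re_mul_ofReal, ht, Real.norm_eq_abs, Real.abs_exp, ← mul_assoc, ← Real.exp_add]
        simp
      have := ge_of_tendsto h1 h2
      exact norm_eq_zero.1 (le_antisymm this (norm_nonneg _))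
    rcases lt_or_gt_of_ne hj with h | h
    · refine hlim atBot inferInstance le_sup_left ?_
      filter_upwards [eventually_le_atBot 0] with t ht
      rw [abs_of_neg h, abs_of_nonpos ht]; ring
    · refine hlim atTop inferInstance le_sup_right ?_
      filter_upwards [eventually_ge_atTop 0] with t ht
      rw [abs_of_pos h, abs_of_nonneg ht]
  · intro hx ε hε
    rw [N.tendsto_iff]
    intro b j hj
    rw [map_zero]
    by_cases hre : (N.lam b).re = 0
    · rw [tendsto_iff_seq_tendsto]
      intro s hs
      obtain ⟨C, hC, hcb⟩ := N.c_bound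
      have e : ∀ t : ℝ, N.c b j (linFlow A t x) = Complex.exp (N.lam b * t) * jet (N.m b) t (fun i => N.c b i x) j :=
        fun t => N.flow_jet b j (N.m b) t x (fun i hi => N.c_top b i x hi)
      have hsa : Tendsto (fun n => |s n|) atTop atTop := by
        have : Tendsto (fun t : ℝ => |t|) (atBot ⊔ atTop) atTop := tendsto_sup.2 ⟨tendsto_abs_atBot_atTop, tendsto_abs_atTop_atTop⟩
        exact this.comp hs
      -- bound by the jet with absolute values
      have h3 := exp_jet_tendsto ((-ε : ℝ) : ℂ) (N.m b) 0 (fun n => |s n|) (fun _ i => ((C * ‖x‖ : ℝ) : ℂ)) (C * ‖x‖)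
        (fun n i => by rw [Complex.norm_real, Real.norm_of_nonneg (by positivity)]) (by
          simp only [Complex.ofReal_re]
          exact hsa.const_mul_atTop_of_neg (by linarith))
      have h3n := h3.norm
      rw [norm_zero] at h3n
      refine squeeze_zero_norm (fun n => ?_) h3n
      simp only [Function.comp_apply]
      rw [map_smul, norm_smul, e, norm_mul, N.norm_exp_central b hre, one_mul, norm_mul, Complex.norm_exp, Real.norm_eq_abs, Real.abs_exp]
      have e5 : ((((-ε : ℝ) : ℂ)) * ((|s n| : ℝ) : ℂ)).re = -(ε * |s n|) := by rw [Complex.re_mul_ofReal, Complex.ofReal_re]; ring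
      rw [e5]
      gcongr
      have e6 : jet (N.m b) |s n| (fun i => ((C * ‖x‖ : ℝ) : ℂ)) 0 = ((∑ i ∈ Finset.range (N.m b), |s n|^i / (i.factorial : ℝ) * (C * ‖x‖) : ℝ) : ℂ) := by
        rw [jet]; push_cast; rfl
      rw [e6, Complex.norm_real]
      refine le_trans ?_ (le_abs_self _)
      rw [jet]
      refine (norm_sum_le _ _).trans (Finset.sum_le_sum fun i _ => ?_)
      rw [norm_mul, norm_div, norm_pow, Complex.norm_real, Real.norm_eq_abs, Complex.norm_natCast]
      gcongr
      exact hcb b _ x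
    · have e : ∀ t : ℝ, N.c b j (linFlow A t x) = 0 := by
        intro t
        rw [N.flow_top b j (fun i _ => hx b i hre), hx b j hre, mul_zero]
      simp only [map_smul, e, smul_zero]; exact tendsto_const_nhds

lemma XC_eq : XC A = N.Y (fun b _ => (N.lam b).re = 0) := by
  rw [XC, N.centralSet_eq, Submodule.span_eq]

end NF

/-- central similarity by ambient linear maps -/
def CS (A B : Matrix (Fin d) (Fin d) ℝ) (α : ℝ) : Prop :=
  ∃ Q R : Euc d →ₗ[ℝ] Euc d, (∀ x ∈ XC A, Q x ∈ XC B ∧ R (Q x) = x ∧ Q (opA A x) = α • opA B (Q x)) ∧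
    (∀ y ∈ XC B, R y ∈ XC A ∧ Q (R y) = y)

lemma XC_inv (A : Matrix (Fin d) (Fin d) ℝ) : ∀ x ∈ XC A, Matrix.toEuclideanLin A x ∈ XC A := by
  obtain ⟨N⟩ := exists_NF (A := A)
  rw [N.XC_eq]
  intro x hx b j hj
  show N.c b j (opA A x) = 0
  rw [N.c_A, hx b j hj, hx b (j+1) hj]; simp

lemma CS_iff {α : ℝ} : IsCentralSimilar A B α ↔ CS A B α := by
  constructor
  · rintro ⟨hA, hB, Q, h⟩
    obtain ⟨Q', hQ⟩ := LinearMap.exists_extend ((XC B).subtype.comp Q.toLinearMap)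
    obtain ⟨R', hR⟩ := LinearMap.exists_extend ((XC A).subtype.comp Q.symm.toLinearMap)
    have hQ' : ∀ x : XC A, Q' x = Q x := fun x => LinearMap.congr_fun hQ x
    have hR' : ∀ x : XC B, R' x = Q.symm x := fun x => LinearMap.congr_fun hR x
    refine ⟨Q', R', fun x hx => ?_, fun y hy => ?_⟩
    · have e := hQ' ⟨x, hx⟩
      simp only at e
      refine ⟨by rw [e]; exact (Q _).2, by rw [e, hR']; simp, ?_⟩
      have e2 := hQ' ⟨_, hA x hx⟩
      have e3 := congrArg (Subtype.val) (h ⟨x, hx⟩)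
      rw [e]
      exact e2.trans e3
    · have e := hR' ⟨y, hy⟩
      simp only at e
      refine ⟨by rw [e]; exact (Q.symm _).2, by rw [e, hQ']; simp⟩
  · rintro ⟨Q, R, h1, h2⟩
    refine ⟨XC_inv A, XC_inv B, LinearEquiv.ofLinearMap (Q.restrict fun x hx => (h1 x hx).1) (R.restrict fun x hx => (h2 x hx).1) ?_ ?_, ?_⟩
    · ext1 y; exact Subtype.ext (h2 y y.2).2
    · ext1 x; exact Subtype.ext (h1 x x.2).2.1
    · intro x; exact Subtype.ext (h1 x x.2).2.2

lemma XC_smul {α : ℝ} (hα : α ≠ 0) : XC (α • A) = XC A := by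
  obtain ⟨N⟩ := exists_NF (A := A)
  rw [N.XC_eq, (N.smul α hα).XC_eq]
  exact N.smul_Y_re (p := fun r => r = 0) (q := fun r => r = 0) _ (by simp [hα])

lemma XC_neg : XC (-A) = XC A := by
  rw [← XC_smul (A := A) (α := -1) (by norm_num)]; simp

lemma XS_smul_pos {α : ℝ} (hα : 0 < α) : XS (α • A) = XS A := by
  obtain ⟨N⟩ := exists_NF (A := A)
  rw [N.XS_eq, (N.smul α hα.ne').XS_eq]
  exact N.smul_Y_re (p := fun r => r < 0) (q := fun r => r < 0) _ (by simp [mul_neg_iff, hα, hα.le, not_lt.2 hα.le])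

lemma XS_neg : XS (-A) = XU A := by
  obtain ⟨N⟩ := exists_NF (A := A)
  have e : -A = (-1:ℝ) • A := by simp
  rw [e, N.XU_eq, (N.smul (-1) (by norm_num)).XS_eq]
  exact N.smul_Y_re (p := fun r => r < 0) (q := fun r => 0 < r) _ (by simp)

lemma XU_neg : XU (-A) = XS A := by rw [← XS_neg, neg_neg]

lemma CS.of_smul {α β : ℝ} (hα : α ≠ 0) (h : CS A (α • B) β) : CS A B (β * α) := by
  obtain ⟨Q, R, h1, h2⟩ := h
  rw [XC_smul hα] at h1 h2
  refine ⟨Q, R, fun x hx => ⟨(h1 x hx).1, (h1 x hx).2.1, ?_⟩, h2⟩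
  rw [(h1 x hx).2.2, mul_smul]; simp [opA]

lemma CS.smul_right {α β : ℝ} (hα : α ≠ 0) (h : CS A B (β * α)) : CS A (α • B) β := by
  obtain ⟨Q, R, h1, h2⟩ := h
  refine ⟨Q, R, fun x hx => ?_, fun y hy => ?_⟩
  · rw [XC_smul hα]
    refine ⟨(h1 x hx).1, (h1 x hx).2.1, ?_⟩
    rw [(h1 x hx).2.2, mul_smul]; simp [opA]
  · rw [XC_smul hα] at hy
    exact h2 y hy

lemma CS.smul_left {α β : ℝ} (hα : α ≠ 0) (h : CS (α • A) B β) : CS A B (β / α) := by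
  obtain ⟨Q, R, h1, h2⟩ := h
  rw [XC_smul hα] at h1 h2
  refine ⟨Q, R, fun x hx => ⟨(h1 x hx).1, (h1 x hx).2.1, ?_⟩, h2⟩
  have := (h1 x hx).2.2
  have e : opA (α • A) x = α • opA A x := by simp [opA]
  rw [e, map_smul] at this
  rw [div_eq_inv_mul, mul_smul, ← this, smul_smul, inv_mul_cancel₀ hα, one_smul]
end

section
open Filter Topology
attribute [local irreducible] linFlow
variable {d : ℕ} {A B : Matrix (Fin d) (Fin d) ℝ} {h : Euc d ≃ₜ Euc d}

/-- compatible pairs of flags -/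
def Good (N : NF A) (N' : NF B) (h : Euc d ≃ₜ Euc d) (k : N.β → ℕ) (k' : N'.β → ℕ) : Prop :=
  (∀ b, k b ≤ N.m b) ∧ (∀ b, k' b ≤ N'.m b) ∧ h '' (N.Yk k) = N'.Yk k'

def Lev (N : NF A) (j : ℕ) (k l : N.β → ℕ) : Prop :=
  ∀ b, ((N.lam b).re < 0 → l b = k b) ∧ ((N.lam b).re = 0 → (1 ≤ l b ↔ j ≤ k b)) ∧ (0 < (N.lam b).re → 2 ≤ j → l b = 0)

lemma kW_le (N : NF A) (k : N.β → ℕ) (b : N.β) : N.kW k b ≤ k b := by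
  rw [NF.kW]; split_ifs <;> omega
lemma kE_le (N : NF A) (k : N.β → ℕ) (b : N.β) : N.kE k b ≤ k b := by
  rw [NF.kE]; split_ifs <;> omega

lemma Lev_E (N : NF A) {i j : ℕ} (hj : j = 2 * i) {k l : N.β → ℕ} (hl : Lev N i (N.kE k) l) (hle : ∀ b, l b ≤ N.kE k b) : Lev N j k l := by
  intro b
  obtain ⟨h1, h2, h3⟩ := hl b
  have hb := hle b
  simp only [NF.kE] at h1 h2 h3 hb
  refine ⟨fun h => ?_, fun h => ?_, fun h hj => ?_⟩
  · rw [h1 h, if_pos h]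
  · rw [h2 h, if_neg (by linarith), if_neg (by linarith)]; omega
  · rw [if_neg (by linarith), if_pos h] at hb; omega

lemma Lev_W (N : NF A) {i j : ℕ} (hj : j + 1 = 2 * i) {k l : N.β → ℕ} (hl : Lev N i (N.kW k) l) (hle : ∀ b, l b ≤ N.kW k b) : Lev N j k l := by
  intro b
  obtain ⟨h1, h2, h3⟩ := hl b
  have hb := hle b
  simp only [NF.kW] at h1 h2 h3 hb
  refine ⟨fun h => ?_, fun h => ?_, fun h hj => ?_⟩
  · rw [h1 h, if_pos h]
  · rw [h2 h, if_neg (by linarith), if_neg (by linarith)]; omega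
  · rw [if_neg (by linarith), if_pos h] at hb; omega

lemma good_rec (N : NF A) (N' : NF B) (h0 : h 0 = 0) {hO : IsOrbitEquiv A B h} {L : Filter ℝ} (hL : GoodL hO L)
    (hUA : L ≤ atTop ∨ ∀ b, 0 < (N.lam b).re → N.m b = 0) (hUB : L ≤ atTop ∨ ∀ b, 0 < (N'.lam b).re → N'.m b = 0) :
    ∀ j, 1 ≤ j → ∀ k k', Good N N' h k k' → ∃ l l', Good N N' h l l' ∧ (∀ b, l b ≤ k b) ∧ (∀ b, l' b ≤ k' b) ∧ Lev N j k l ∧ Lev N' j k' l' := by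
  intro j
  induction j using Nat.strong_induction_on with
  | _ j ih =>
    intro hj k k' hk
    obtain ⟨hk1, hk2, hk3⟩ := hk
    have hUA' : L ≤ atTop ∨ ∀ b, 0 < (N.lam b).re → k b = 0 := hUA.imp id fun h b hb => by have := h b hb; have := hk1 b; omega
    have hUB' : L ≤ atTop ∨ ∀ b, 0 < (N'.lam b).re → k' b = 0 := hUB.imp id fun h b hb => by have := h b hb; have := hk2 b; omega
    have gE : Good N N' h (N.kE k) (N'.kE k') := by
      refine ⟨fun b => (kE_le N k b).trans (hk1 b), fun b => (kE_le N' k' b).trans (hk2 b), ?_⟩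
      rw [← N.opE_Yk hL.atTop_le hL.le_cocompact k hk1 hUA', ← N'.opE_Yk hL.atTop_le hL.le_cocompact k' hk2 hUB', opE_image h0 hL, hk3]
    have gW : Good N N' h (N.kW k) (N'.kW k') := by
      refine ⟨fun b => (kW_le N k b).trans (hk1 b), fun b => (kW_le N' k' b).trans (hk2 b), ?_⟩
      rw [← N.opW_Yk hL.atTop_le hL.le_cocompact k hk1 hUA', ← N'.opW_Yk hL.atTop_le hL.le_cocompact k' hk2 hUB', opW_image hL, hk3]
    rcases Nat.lt_or_ge j 2 with h2 | h2
    · refine ⟨k, k', ⟨hk1, hk2, hk3⟩, fun _ => le_rfl, fun _ => le_rfl, ?_, ?_⟩ <;>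
      · intro b
        refine ⟨fun _ => rfl, fun _ => by omega, fun _ => by omega⟩
    · rcases Nat.even_or_odd' j with ⟨i, hi | hi⟩
      · obtain ⟨l, l', g, hl, hl', v, v'⟩ := ih i (by omega) (by omega) _ _ gE
        exact ⟨l, l', g, fun b => (hl b).trans (kE_le N k b), fun b => (hl' b).trans (kE_le N' k' b), Lev_E N hi v hl, Lev_E N' hi v' hl'⟩
      · obtain ⟨l, l', g, hl, hl', v, v'⟩ := ih (i+1) (by omega) (by omega) _ _ gW
        exact ⟨l, l', g, fun b => (hl b).trans (kW_le N k b), fun b => (hl' b).trans (kW_le N' k' b), Lev_W N (by omega) v hl, Lev_W N' (by omega) v' hl'⟩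

lemma good_top (N : NF A) (N' : NF B) : Good N N' h N.m N'.m := by
  refine ⟨fun _ => le_rfl, fun _ => le_rfl, ?_⟩
  have h1 : (N.Yk N.m : Set (Euc d)) = Set.univ := Set.eq_univ_of_forall fun x => N.mem_Yk.2 fun b j hj => N.c_top b j x hj
  have h2 : (N'.Yk N'.m : Set (Euc d)) = Set.univ := Set.eq_univ_of_forall fun x => N'.mem_Yk.2 fun b j hj => N'.c_top b j x hj
  rw [h1, h2, Set.image_univ, h.surjective.range_eq]

lemma good_level (N : NF A) (N' : NF B) (h0 : h 0 = 0) {hO : IsOrbitEquiv A B h} {L : Filter ℝ} (hL : GoodL hO L)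
    (hUA : L ≤ atTop ∨ ∀ b, 0 < (N.lam b).re → N.m b = 0) (hUB : L ≤ atTop ∨ ∀ b, 0 < (N'.lam b).re → N'.m b = 0) (j : ℕ) (hj : 1 ≤ j) :
    ∃ l l', Good N N' h l l' ∧ Lev N j N.m l ∧ Lev N' j N'.m l' := by
  obtain ⟨l, l', g, -, -, v, v'⟩ := good_rec N N' h0 hL hUA hUB j hj _ _ (good_top N N')
  exact ⟨l, l', g, v, v'⟩

lemma Good.mem {N : NF A} {N' : NF B} {k : N.β → ℕ} {k' : N'.β → ℕ} (g : Good N N' h k k') (x : Euc d) : x ∈ N.Yk k ↔ h x ∈ N'.Yk k' := by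
  have := g.2.2
  constructor
  · intro hx
    have : h x ∈ (N'.Yk k' : Set (Euc d)) := by rw [← this]; exact ⟨x, hx, rfl⟩
    exact this
  · intro hx
    have : h x ∈ h '' (N.Yk k : Set (Euc d)) := by rw [this]; exact hx
    obtain ⟨y, hy, e⟩ := this
    rwa [← h.injective e]

lemma Yk_stable (N : NF A) {j : ℕ} (hj : ∀ b, N.m b < j) (h2 : 2 ≤ j) {l : N.β → ℕ} (v : Lev N j N.m l) : N.Yk l = XS A := by
  rw [N.XS_eq]
  ext x
  rw [N.mem_Yk, N.mem_Y]
  refine forall_congr' fun b => ⟨fun hx i hi => ?_, fun hx i hi => ?_⟩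
  · refine hx i ?_
    rcases (not_lt.1 hi).lt_or_eq with h | h
    · rw [(v b).2.2 h h2]; omega
    · have := (v b).2.1 h.symm
      have := hj b; omega
  · by_cases hre : (N.lam b).re < 0
    · rw [(v b).1 hre] at hi; exact N.c_top b i x hi
    · exact hx i hre

theorem dimS_eq (N : NF A) (N' : NF B) (h0 : h 0 = 0) {hO : IsOrbitEquiv A B h} {L : Filter ℝ} (hL : GoodL hO L)
    (hUA : L ≤ atTop ∨ ∀ b, 0 < (N.lam b).re → N.m b = 0) (hUB : L ≤ atTop ∨ ∀ b, 0 < (N'.lam b).re → N'.m b = 0) :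
    dimS A = dimS B := by
  obtain ⟨j, hj1, hj2, hj3⟩ : ∃ j, 2 ≤ j ∧ (∀ b, N.m b < j) ∧ (∀ b, N'.m b < j) := by
    refine ⟨(∑ b, N.m b) + (∑ b, N'.m b) + 2, by omega, fun b => ?_, fun b => ?_⟩
    · have := Finset.single_le_sum (f := N.m) (fun i _ => Nat.zero_le _) (Finset.mem_univ b); omega
    · have := Finset.single_le_sum (f := N'.m) (fun i _ => Nat.zero_le _) (Finset.mem_univ b); omega
  obtain ⟨l, l', g, v, v'⟩ := good_level N N' h0 hL hUA hUB j (by omega)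
  rw [dimS, dimS, ← Yk_stable N hj2 hj1 v, ← Yk_stable N' hj3 hj1 v']
  exact finrank_eq_of_image _ _ h g.mem

/-- number of central blocks of size ≥ j and frequency w -/
def cnt (N : NF A) (j : ℕ) (w : ℝ) : ℕ := by
  classical exact (Finset.univ.filter fun b => (N.lam b).re = 0 ∧ j ≤ N.m b ∧ (N.lam b).im = w).card

/-- frequency lattice condition -/
def res (w T : ℝ) : Prop := ∃ n : ℤ, w * T = n * (2 * Real.pi)

lemma exp_one_iff {l : ℂ} {T : ℝ} (hT : T ≠ 0) : Complex.exp (l * T) = 1 ↔ l.re = 0 ∧ res l.im T := by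
  constructor
  · intro h
    have h1 := NF.exp_one_re hT h
    refine ⟨h1, ?_⟩
    obtain ⟨n, hn⟩ := Complex.exp_eq_one_iff.1 h
    refine ⟨n, ?_⟩
    have := congrArg Complex.im hn
    simpa using this
  · rintro ⟨h1, n, hn⟩
    rw [Complex.exp_eq_one_iff]
    refine ⟨n, ?_⟩
    apply Complex.ext
    · simp [h1]
    · simpa using hn

open Classical in
lemma finrank_PY (N : NF A) {T : ℝ} (hT : T ≠ 0) {j : ℕ} (hj : 1 ≤ j) {l : N.β → ℕ} (v : ∀ b, (N.lam b).re = 0 → (1 ≤ l b ↔ j ≤ N.m b)) :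
    Module.finrank ℝ (N.Y (fun b i => (i = 0 ∧ Complex.exp (N.lam b * T) = 1) ∧ i < l b) : Submodule ℝ (Euc d)) =
      ∑ b, if (N.lam b).re = 0 ∧ j ≤ N.m b ∧ res (N.lam b).im T then ed (N.lam b) else 0 := by
  rw [N.finrank_Y]
  refine Finset.sum_congr rfl fun b _ => ?_
  by_cases hc : (N.lam b).re = 0 ∧ j ≤ N.m b ∧ res (N.lam b).im T
  · rw [if_pos hc]
    rw [Finset.card_eq_one.2 ⟨0, ?_⟩, mul_one]
    · ext i
      simp only [Finset.mem_filter, Finset.mem_range, Finset.mem_singleton]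
      constructor
      · intro h; exact h.2.1.1
      · rintro rfl
        have h1 := (v b hc.1).2 hc.2.1
        exact ⟨by omega, ⟨rfl, (exp_one_iff hT).2 ⟨hc.1, hc.2.2⟩⟩, by omega⟩
  · rw [if_neg hc]
    rw [Finset.card_eq_zero.2 ?_, mul_zero]
    · ext i
      simp only [Finset.mem_filter, Finset.mem_range, Finset.notMem_empty, iff_false]
      rintro ⟨h1, ⟨h2, h3⟩, h4⟩
      have h5 := (exp_one_iff hT).1 h3
      exact hc ⟨h5.1, (v b h5.1).1 (by omega), h5.2⟩

/-- arithmetic: weighted sums over lattices determine the weights -/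
lemma lattice_zero (Ω : Finset ℝ) (g : ℝ → ℤ) (hΩ : ∀ w ∈ Ω, 0 ≤ w) (hg : ∀ w, w ∉ Ω → g w = 0)
    (hs : ∀ T : ℝ, 0 < T → ∑ w ∈ Ω, (open Classical in if res w T then g w else 0) = 0) : ∀ w, g w = 0 := by
  classical
  by_contra hne
  push Not at hne
  let S := Ω.filter fun w => g w ≠ 0
  have hS : S.Nonempty := by
    obtain ⟨w, hw⟩ := hne
    exact ⟨w, Finset.mem_filter.2 ⟨by by_contra h; exact hw (hg w h), hw⟩⟩
  set M := S.max' hS with hM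
  have hMS : M ∈ S := S.max'_mem hS
  have hM0 : 0 ≤ M := hΩ M (Finset.mem_filter.1 hMS).1
  have hMg : g M ≠ 0 := (Finset.mem_filter.1 hMS).2
  have hmax : ∀ w ∈ Ω, g w ≠ 0 → w ≤ M := fun w hw h => S.le_max' w (Finset.mem_filter.2 ⟨hw, h⟩)
  have hpi := Real.pi_pos
  -- a general consequence
  have key : ∀ T : ℝ, 0 < T → ∀ w₀ ∈ Ω, (∀ w ∈ Ω, g w ≠ 0 → (res w T ↔ w = w₀)) → g w₀ = 0 := by
    intro T hT w₀ hw₀ hiff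
    have := hs T hT
    rw [Finset.sum_eq_single w₀] at this
    · by_contra hne
      rw [if_pos ((hiff w₀ hw₀ hne).2 rfl)] at this
      exact hne this
    · intro w hw hne
      split_ifs with hr
      · by_contra h; exact hne ((hiff w hw h).1 hr)
      · rfl
    · intro h; exact absurd hw₀ h
  have hg0 : g 0 = 0 := by
    by_cases h0 : (0:ℝ) ∈ Ω
    · refine key (Real.pi / (M + 1)) (by positivity) 0 h0 fun w hw hwg => ⟨?_, ?_⟩
      · rintro ⟨n, hn⟩
        have h1 : 0 ≤ w * (Real.pi / (M+1)) := mul_nonneg (hΩ w hw) (by positivity)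
        have h2 : w * (Real.pi / (M+1)) < 2 * Real.pi := by
          rw [mul_div_assoc', div_lt_iff₀ (by positivity)]
          nlinarith [hmax w hw hwg]
        rw [hn] at h1 h2
        have hn0 : (0:ℝ) ≤ n := by by_contra h; push Not at h; nlinarith
        have hn1 : (n:ℝ) < 1 := by by_contra h; push Not at h; nlinarith
        have : n = 0 := by
          have a : (0:ℤ) ≤ n := by exact_mod_cast hn0
          have b : n < 1 := by exact_mod_cast hn1
          omega
        rw [this, Int.cast_zero, zero_mul] at hn
        have hpp : 0 < Real.pi / (M + 1) := by positivity
        exact (mul_eq_zero.1 hn).resolve_right hpp.ne'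
      · rintro rfl; exact ⟨0, by simp⟩
    · exact hg 0 h0
  have hMpos : 0 < M := lt_of_le_of_ne hM0 fun h => hMg (h ▸ hg0)
  refine hMg (key (2 * Real.pi / M) (by positivity) M (Finset.mem_filter.1 hMS).1 fun w hw hwg => ⟨?_, ?_⟩)
  · rintro ⟨n, hn⟩
    have e : w = n * M := by
      field_simp at hn
      linarith
    have hwM := hmax w hw hwg
    have hw0 := hΩ w hw
    have hwne : w ≠ 0 := fun h => hwg (h ▸ hg0)
    have hwp : 0 < w := lt_of_le_of_ne hw0 hwne.symm
    have a : (0:ℝ) < n := by by_contra h; push Not at h; nlinarith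
    have b : (n:ℝ) ≤ 1 := by by_contra h; push Not at h; nlinarith
    have : n = 1 := by
      have a : (0:ℤ) < n := by exact_mod_cast a
      have b : n ≤ 1 := by exact_mod_cast b
      omega
    rw [e, this]; simp
  · rintro rfl; exact ⟨1, by push_cast; field_simp⟩

lemma sum_cnt (N : NF A) (j : ℕ) (T : ℝ) (Ω : Finset ℝ) (hΩ : ∀ b, (N.lam b).im ∈ Ω) :
    (∑ b, (open Classical in if (N.lam b).re = 0 ∧ j ≤ N.m b ∧ res (N.lam b).im T then ed (N.lam b) else 0)) =
      ∑ w ∈ Ω, (open Classical in if res w T then (if w = 0 then 1 else 2) * cnt N j w else 0) := by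
  classical
  rw [← Finset.sum_fiberwise_of_maps_to (s := Finset.univ) (t := Ω) (g := fun b => (N.lam b).im) (fun b _ => hΩ b)]
  refine Finset.sum_congr rfl fun w _ => ?_
  split_ifs with hr hw
  · rw [cnt, Finset.card_filter, Finset.sum_filter, Finset.mul_sum]
    refine Finset.sum_congr rfl fun b _ => ?_
    by_cases h1 : (N.lam b).im = w
    · by_cases h2 : (N.lam b).re = 0 ∧ j ≤ N.m b
      · rw [if_pos h1, if_pos ⟨h2.1, h2.2, by rw [h1]; exact hr⟩, if_pos ⟨h2.1, h2.2, h1⟩]; simp [ed, h1, hw]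
      · rw [if_pos h1, if_neg (fun h => h2 ⟨h.1, h.2.1⟩), if_neg (fun h => h2 ⟨h.1, h.2.1⟩), mul_zero]
    · simp [h1]
  · rw [cnt, Finset.card_filter, Finset.sum_filter, Finset.mul_sum]
    refine Finset.sum_congr rfl fun b _ => ?_
    by_cases h1 : (N.lam b).im = w
    · by_cases h2 : (N.lam b).re = 0 ∧ j ≤ N.m b
      · rw [if_pos h1, if_pos ⟨h2.1, h2.2, by rw [h1]; exact hr⟩, if_pos ⟨h2.1, h2.2, h1⟩]; simp [ed, h1, hw]
      · rw [if_pos h1, if_neg (fun h => h2 ⟨h.1, h.2.1⟩), if_neg (fun h => h2 ⟨h.1, h.2.1⟩), mul_zero]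
    · simp [h1]
  · refine Finset.sum_eq_zero fun b hb => ?_
    rw [if_neg]
    rintro ⟨-, -, h⟩
    rw [(Finset.mem_filter.1 hb).2] at h
    exact hr h

lemma cnt_eq (N : NF A) (N' : NF B) {j : ℕ} (hj : 1 ≤ j) {l : N.β → ℕ} {l' : N'.β → ℕ}
    (v : ∀ b, (N.lam b).re = 0 → (1 ≤ l b ↔ j ≤ N.m b)) (v' : ∀ b, (N'.lam b).re = 0 → (1 ≤ l' b ↔ j ≤ N'.m b))
    (g : ∀ x, x ∈ N.Yk l ↔ h x ∈ N'.Yk l') (hP : ∀ T : ℝ, 0 < T → ∀ x, linFlow A T x = x ↔ linFlow B T (h x) = h x) :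
    ∀ w, cnt N j w = cnt N' j w := by
  classical
  let Ω : Finset ℝ := (Finset.univ.image fun b => (N.lam b).im) ∪ (Finset.univ.image fun b => (N'.lam b).im)
  have h1 : ∀ b, (N.lam b).im ∈ Ω := fun b => Finset.mem_union_left _ (Finset.mem_image_of_mem _ (Finset.mem_univ b))
  have h2 : ∀ b, (N'.lam b).im ∈ Ω := fun b => Finset.mem_union_right _ (Finset.mem_image_of_mem _ (Finset.mem_univ b))
  have hsum : ∀ T : ℝ, 0 < T → ∑ w ∈ Ω, (if res w T then (if w = 0 then 1 else 2) * cnt N j w else 0) = ∑ w ∈ Ω, (if res w T then (if w = 0 then 1 else 2) * cnt N' j w else 0) := by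
    intro T hT
    rw [← sum_cnt N j T Ω h1, ← sum_cnt N' j T Ω h2, ← finrank_PY N hT.ne' hj v, ← finrank_PY N' hT.ne' hj v']
    refine finrank_eq_of_image _ _ h fun x => ?_
    have e : ∀ {A : Matrix (Fin d) (Fin d) ℝ} (N : NF A) (l : N.β → ℕ) (x : Euc d), x ∈ N.Y (fun b i => (i = 0 ∧ Complex.exp (N.lam b * T) = 1) ∧ i < l b) ↔ linFlow A T x = x ∧ x ∈ N.Yk l := by
      intro A N l x
      rw [N.mem_P hT.ne', NF.mem_Y, NF.mem_Y, NF.mem_Y]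
      constructor
      · intro h
        exact ⟨fun b j hb => h b j (fun h => hb h.1), fun b j hb => h b j (fun h => hb h.2)⟩
      · rintro ⟨k1, k2⟩ b j hb
        by_cases h3 : j < l b
        · exact k1 b j fun h => hb ⟨h, h3⟩
        · exact k2 b j h3
    rw [e, e, hP T hT, g]
  have hz : ∀ {A : Matrix (Fin d) (Fin d) ℝ} (N : NF A), (∀ b, (N.lam b).im ∈ Ω) → ∀ w, w ∉ Ω → cnt N j w = 0 := by
    intro A N hN w hw
    rw [cnt, Finset.card_eq_zero, Finset.filter_eq_empty_iff]
    rintro b - ⟨-, -, hb⟩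
    exact hw (hb ▸ hN b)
  have := lattice_zero Ω (fun w => (if w = 0 then 1 else 2) * ((cnt N j w : ℤ) - cnt N' j w)) (by
    intro w hw
    rcases Finset.mem_union.1 hw with hw | hw <;> obtain ⟨b, -, rfl⟩ := Finset.mem_image.1 hw
    · exact N.im_nonneg b
    · exact N'.im_nonneg b) (fun w hw => by simp only [hz N h1 w hw, hz N' h2 w hw]; simp) (by
    intro T hT
    have := congrArg (Nat.cast : ℕ → ℤ) (hsum T hT)
    push_cast at this
    rw [← sub_eq_zero, ← Finset.sum_sub_distrib] at this
    refine Eq.trans ?_ this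
    refine Finset.sum_congr rfl fun w _ => ?_
    split_ifs <;> ring)
  intro w
  have h3 := this w
  have h4 := (mul_eq_zero.1 h3).resolve_left (by split_ifs <;> norm_num)
  omega

/-- index type of nontrivial central blocks -/
def CB (N : NF A) := {b : N.β // (N.lam b).re = 0 ∧ 1 ≤ N.m b}
instance (N : NF A) : Finite (CB N) := by unfold CB; infer_instance

lemma exists_block_equiv (N : NF A) (N' : NF B) (hc : ∀ j, 1 ≤ j → ∀ w, cnt N j w = cnt N' j w) :
    ∃ e : CB N ≃ CB N', ∀ b, N'.lam (e b).1 = N.lam b.1 ∧ N'.m (e b).1 = N.m b.1 := by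
  classical
  have hcard : ∀ {A : Matrix (Fin d) (Fin d) ℝ} (N : NF A) (p : ℝ × ℕ), 1 ≤ p.2 →
      Nat.card {b : CB N // ((N.lam b.1).im, N.m b.1) = p} + cnt N (p.2 + 1) p.1 = cnt N p.2 p.1 := by
    intro A N p hp
    have e1 : Nat.card {b : CB N // ((N.lam b.1).im, N.m b.1) = p} =
        (Finset.univ.filter fun b => (N.lam b).re = 0 ∧ N.m b = p.2 ∧ (N.lam b).im = p.1).card := by
      rw [← Fintype.card_subtype, ← Nat.card_eq_fintype_card]
      refine Nat.card_congr ⟨fun b => ⟨b.1.1, b.1.2.1, (Prod.ext_iff.1 b.2).2, (Prod.ext_iff.1 b.2).1⟩,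
        fun b => ⟨⟨b.1, b.2.1, by rw [b.2.2.1]; exact hp⟩, Prod.ext b.2.2.2 b.2.2.1⟩, fun _ => rfl, fun _ => rfl⟩
    rw [e1, cnt, cnt, ← Finset.card_union_of_disjoint]
    · congr 1
      ext b
      simp only [Finset.mem_union, Finset.mem_filter, Finset.mem_univ, true_and]
      constructor
      · rintro (⟨a, b, c⟩ | ⟨a, b, c⟩)
        · exact ⟨a, by omega, c⟩
        · exact ⟨a, by omega, c⟩
      · rintro ⟨a, b, c⟩
        rcases b.lt_or_eq with h | h
        · exact Or.inr ⟨a, by omega, c⟩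
        · exact Or.inl ⟨a, by omega, c⟩
    · rw [Finset.disjoint_left]
      intro b h1 h2
      simp only [Finset.mem_filter] at h1 h2
      omega
  have heq : ∀ p : ℝ × ℕ, Nonempty ({b : CB N // ((N.lam b.1).im, N.m b.1) = p} ≃ {b : CB N' // ((N'.lam b.1).im, N'.m b.1) = p}) := by
    intro p
    by_cases hp : 1 ≤ p.2
    · have h1 := hcard N p hp
      have h2 := hcard N' p hp
      rw [hc _ hp, hc _ (by omega)] at h1
      exact Finite.card_eq.1 (by omega)
    · have : ∀ {A : Matrix (Fin d) (Fin d) ℝ} (N : NF A), IsEmpty {b : CB N // ((N.lam b.1).im, N.m b.1) = p} := by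
        intro A N
        refine ⟨fun b => hp ?_⟩
        rw [← b.2]; exact b.1.2.2
      have := this N; have := ‹∀ {A : Matrix (Fin d) (Fin d) ℝ} (N : NF A), IsEmpty _› N'
      exact ⟨Equiv.equivOfIsEmpty _ _⟩
  let e : CB N ≃ CB N' := (Equiv.sigmaFiberEquiv fun b : CB N => ((N.lam b.1).im, N.m b.1)).symm.trans
    ((Equiv.sigmaCongrRight fun p => Classical.choice (heq p)).trans (Equiv.sigmaFiberEquiv fun b : CB N' => ((N'.lam b.1).im, N'.m b.1)))
  refine ⟨e, fun b => ?_⟩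
  have := (Classical.choice (heq ((N.lam b.1).im, N.m b.1)) ⟨b, rfl⟩).2
  have h2 : ((N'.lam (e b).1).im, N'.m (e b).1) = ((N.lam b.1).im, N.m b.1) := this
  refine ⟨Complex.ext ?_ (Prod.ext_iff.1 h2).1, (Prod.ext_iff.1 h2).2⟩
  rw [(e b).2.1, b.2.1]

/-- one-sided intertwiner -/
lemma block_map (N : NF A) (N' : NF B) (f : CB N' → CB N) (hf : ∀ b, N.lam (f b).1 = N'.lam b.1 ∧ N.m (f b).1 = N'.m b.1) :
    ∃ Q : Euc d →ₗ[ℝ] Euc d, (∀ x, Q x ∈ XC B) ∧ (∀ x (b : CB N') j, N'.c b.1 j (Q x) = N.c (f b).1 j x) ∧ (∀ x, Q (opA A x) = opA B (Q x)) := by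
  classical
  have hx : ∀ x, ∃ y, ∀ b j, j < N'.m b → N'.c b j y = if hb : (N'.lam b).re = 0 ∧ 1 ≤ N'.m b then N.c (f ⟨b, hb⟩).1 j x else 0 := by
    intro x
    refine N'.surj _ fun b j h0 => ?_
    split_ifs with hb
    · exact N.c_real _ _ _ (by rw [(hf ⟨b, hb⟩).1]; exact h0)
    · simp
  choose F hF using hx
  have hF' : ∀ x b j, N'.c b j (F x) = if hb : (N'.lam b).re = 0 ∧ 1 ≤ N'.m b then N.c (f ⟨b, hb⟩).1 j x else 0 := by
    intro x b j
    by_cases hj : j < N'.m b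
    · exact hF x b j hj
    · rw [N'.c_top b j _ (not_lt.1 hj)]
      split_ifs with hb
      · rw [N.c_top _ _ _ (by rw [(hf ⟨b, hb⟩).2]; exact not_lt.1 hj)]
      · rfl
  refine ⟨{ toFun := F, map_add' := ?_, map_smul' := ?_ }, ?_, ?_, ?_⟩
  · intro x y; refine N'.ext_c fun b j hj => ?_
    rw [map_add, hF', hF', hF']; split_ifs <;> simp
  · intro a x; refine N'.ext_c fun b j hj => ?_
    simp only [RingHom.id_apply]
    rw [map_smul, hF', hF']; split_ifs <;> simp
  · intro x
    rw [N'.XC_eq]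
    intro b j hb
    show N'.c b j (F x) = 0
    rw [hF', dif_neg]
    rintro ⟨h1, -⟩; exact hb h1
  · intro x b j
    show N'.c b.1 j (F x) = _
    rw [hF', dif_pos b.2]; rfl
  · intro x; refine N'.ext_c fun b j hj => ?_
    show N'.c b j (F _) = N'.c b j (opA B (F x))
    rw [N'.c_A, hF', hF', hF']
    split_ifs with hb
    · rw [N.c_A, (hf ⟨b, hb⟩).1]
    · simp

lemma CS_of_equiv (N : NF A) (N' : NF B) (e : CB N ≃ CB N') (he : ∀ b, N'.lam (e b).1 = N.lam b.1 ∧ N'.m (e b).1 = N.m b.1) : CS A B 1 := by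
  obtain ⟨Q, q1, q2, q3⟩ := block_map N N' e.symm (fun b => by have := he (e.symm b); rw [e.apply_symm_apply] at this; exact ⟨this.1.symm, this.2.symm⟩)
  obtain ⟨R, r1, r2, r3⟩ := block_map N' N e he
  have hext : ∀ {A : Matrix (Fin d) (Fin d) ℝ} (N : NF A) {x y : Euc d}, x ∈ XC A → y ∈ XC A → (∀ (b : CB N) j, N.c b.1 j x = N.c b.1 j y) → x = y := by
    intro A N x y hx hy hxy
    rw [N.XC_eq] at hx hy
    refine N.ext_c fun b j hj => ?_
    by_cases hb : (N.lam b).re = 0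
    · exact hxy ⟨b, hb, by omega⟩ j
    · rw [hx b j hb, hy b j hb]
  refine ⟨Q, R, fun x hx => ⟨q1 x, hext N (r1 _) hx fun b j => ?_, by rw [q3, one_smul]⟩, fun y hy => ⟨r1 y, hext N' (q1 _) hy fun b j => ?_⟩⟩
  · rw [r2, q2, e.symm_apply_apply]
  · rw [q2, r2, e.apply_symm_apply]

theorem CS_of_good (N : NF A) (N' : NF B) (h0 : h 0 = 0) {hO : IsOrbitEquiv A B h} {L : Filter ℝ} (hL : GoodL hO L)
    (hUA : L ≤ atTop ∨ ∀ b, 0 < (N.lam b).re → N.m b = 0) (hUB : L ≤ atTop ∨ ∀ b, 0 < (N'.lam b).re → N'.m b = 0)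
    {α : ℝ} (hα : α ≠ 0) (hP : ∀ T : ℝ, 0 < T → ∀ x, linFlow A T x = x ↔ linFlow B (α * T) (h x) = h x) : CS A B α := by
  have key : ∀ j, 1 ≤ j → ∀ w, cnt N j w = cnt (N'.smul α hα) j w := by
    intro j hj
    obtain ⟨l, l', g, v, v'⟩ := good_level N N' h0 hL hUA hUB j hj
    refine cnt_eq (h := h) N (N'.smul α hα) (l := l) (l' := l') hj (fun b => (v b).2.1) (fun b hb => ?_) (fun x => ?_) fun T hT x => ?_
    · have : (N'.lam b).re = 0 := by
        rw [N'.smul_re α hα b] at hb; exact (mul_eq_zero.1 hb).resolve_left hα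
      exact (v' b).2.1 this
    · rw [g.mem]
      have := N'.smul_Y α hα (fun b j => j < l' b)
      exact (congrArg (fun S => h x ∈ S) this.symm).to_iff
    · rw [hP T hT, linFlow_smul_left]
  obtain ⟨e, he⟩ := exists_block_equiv N (N'.smul α hα) key
  have := (CS_of_equiv N (N'.smul α hα) e he).of_smul hα
  rwa [one_mul] at this
end

section
open Filter Topology
attribute [local irreducible] linFlow
variable {d : ℕ} {A B : Matrix (Fin d) (Fin d) ℝ} {h : Euc d ≃ₜ Euc d}

lemma Bd_image_aux (N : NF A) (N' : NF B) (hO : IsOrbitEquiv A B h) {x : Euc d} (hx : x ∈ N.Bd) : h x ∈ N'.Bd := by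
  rw [NF.mem_Bd] at hx ⊢
  rw [← hO x]
  exact ((hx.isCompact_closure.image h.continuous).isBounded).subset (Set.image_mono subset_closure)

/-- `T` is a `δ`-almost period on bounded orbits. -/
def AP (N : NF A) (δ T : ℝ) : Prop := ∀ w ∈ N.Bd, ‖linFlow A T w - w‖ ≤ δ * ‖w‖

def RelR (N : NF A) (hO : IsOrbitEquiv A B h) (x y : Euc d) : Prop :=
  ∀ ε > 0, ∃ δ > 0, ∀ T, AP N δ T → ∀ k : ℕ, |tau hO x (k * T) - tau hO y (k * T)| ≤ k * ε

lemma AP.mono {N : NF A} {δ δ' T : ℝ} (hT : AP N δ T) (hd : δ ≤ δ') : AP N δ' T :=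
  fun w hw => (hT w hw).trans (by gcongr)

lemma RelR.symm {N : NF A} {hO : IsOrbitEquiv A B h} {x y : Euc d} (hR : RelR N hO x y) : RelR N hO y x := by
  intro ε hε
  obtain ⟨δ, hδ, H⟩ := hR ε hε
  exact ⟨δ, hδ, fun T hT k => by rw [abs_sub_comm]; exact H T hT k⟩

lemma RelR.trans {N : NF A} {hO : IsOrbitEquiv A B h} {x y z : Euc d} (h1 : RelR N hO x y) (h2 : RelR N hO y z) :
    RelR N hO x z := by
  intro ε hε
  obtain ⟨δ, hδ, H⟩ := h1 (ε/2) (by positivity)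
  obtain ⟨δ', hδ', H'⟩ := h2 (ε/2) (by positivity)
  refine ⟨min δ δ', lt_min hδ hδ', fun T hT k => ?_⟩
  have a := H T (hT.mono (min_le_left _ _)) k
  have b := H' T (hT.mono (min_le_right _ _)) k
  have := abs_sub_le (tau hO x (k * T)) (tau hO y (k * T)) (tau hO z (k * T))
  linarith

lemma osc_lemma {F : ℝ → ℝ} (hF : ContinuousOn F (Set.Icc 0 1)) {e : ℝ} (he : 0 < e) (hlt : e < |F 0 - F 1|) :
    ∃ s ∈ Set.Icc (0:ℝ) 1, ∃ s' ∈ Set.Icc (0:ℝ) 1, F s' = F s + e := by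
  rcases le_total (F 0) (F 1) with h1 | h1
  · rw [abs_of_nonpos (by linarith)] at hlt
    obtain ⟨s', hs', e'⟩ := intermediate_value_Icc zero_le_one hF (show F 0 + e ∈ Set.Icc (F 0) (F 1) from ⟨by linarith, by linarith⟩)
    exact ⟨0, ⟨le_rfl, zero_le_one⟩, s', hs', e'⟩
  · rw [abs_of_nonneg (by linarith)] at hlt
    obtain ⟨s', hs', e'⟩ := intermediate_value_Icc' zero_le_one hF (show F 1 + e ∈ Set.Icc (F 1) (F 0) from ⟨by linarith, by linarith⟩)
    exact ⟨1, ⟨zero_le_one, le_rfl⟩, s', hs', e'⟩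

lemma tau_mul_le (hO : IsOrbitEquiv A B h) {x y : Euc d} (hx : opA A x ≠ 0) (hy : opA A y ≠ 0) {T ε : ℝ}
    (H : ∀ t, |tau hO (linFlow A t x) T - tau hO (linFlow A t y) T| ≤ ε) (k : ℕ) :
    |tau hO x (k * T) - tau hO y (k * T)| ≤ k * ε := by
  induction k with
  | zero => simp
  | succ k ih =>
    have e : ((k + 1 : ℕ) : ℝ) * T = k * T + T := by push_cast; ring
    rw [e, tau_cocycle hO hx, tau_cocycle hO hy]
    have := H (k * T)
    rw [abs_le] at *
    push_cast
    constructor <;> linarith [ih.1, ih.2, this.1, this.2]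

lemma exp_ne {e : ℝ} (h0 : 0 < e) (h1 : e ≤ 1) : Complex.exp (Complex.I * e) ≠ 1 := by
  intro h
  have := congrArg Complex.im h
  rw [mul_comm, Complex.exp_ofReal_mul_I_im, Complex.one_im] at this
  have h2 := Real.sin_pos_of_pos_of_lt_pi h0 (by linarith [Real.pi_gt_three])
  linarith

lemma path_nonfixed (N' : NF B) {b : N'.β} {x : Euc d} (hω : 0 < (N'.lam b).im) (hb : x ∈ N'.Bd)
    (hl : N'.c b 0 x ≠ 0) : opA B x ≠ 0 := by
  intro h0
  have := N'.c_A b 0 x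
  rw [h0, map_zero, hb b 1 (by omega), add_zero] at this
  rcases mul_eq_zero.1 this.symm with h1 | h1
  · rw [h1] at hω; simp at hω
  · exact hl h1

lemma path_RelR (N : NF A) (N' : NF B) (hO : IsOrbitEquiv A B h) (p : ℝ → Euc d) (hp : Continuous p) (b : N'.β)
    (hre : (N'.lam b).re = 0) (hω : 0 < (N'.lam b).im) (hB : ∀ s, p s ∈ N'.Bd)
    (hl : ∀ s ∈ Set.Icc (0:ℝ) 1, N'.c b 0 (p s) ≠ 0) : RelR N hO (h.symm (p 0)) (h.symm (p 1)) := by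
  set z : ℝ → Euc d := fun s => h.symm (p s) with hz
  have hzc : Continuous z := h.symm.continuous.comp hp
  have hzB : ∀ s, z s ∈ N.Bd := fun s => Bd_image_aux N' N hO.symm (hB s)
  have hzn : ∀ s ∈ Set.Icc (0:ℝ) 1, opA A (z s) ≠ 0 := fun s hs => by
    rw [hz, Ne, hO.symm.fixed_iff]; exact path_nonfixed N' hω (hB s) (hl s hs)
  obtain ⟨c, hc, hcl⟩ : ∃ c > 0, ∀ s ∈ Set.Icc (0:ℝ) 1, c ≤ ‖N'.c b 0 (p s)‖ := by
    obtain ⟨s0, hs0, hm⟩ := isCompact_Icc.exists_isMinOn (Set.nonempty_Icc.2 zero_le_one)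
      (((N'.continuous_c b 0).comp hp).norm.continuousOn (s := Set.Icc (0:ℝ) 1))
    exact ⟨_, norm_pos_iff.2 (hl s0 hs0), fun s hs => hm hs⟩
  obtain ⟨C, hC, hCb⟩ := N.Bd_bound
  obtain ⟨C', hC', hcb'⟩ := N'.c_bound
  obtain ⟨ρ0, hρ0⟩ := (isCompact_Icc.image_of_continuousOn (hzc.continuousOn (s := Set.Icc (0:ℝ) 1))).isBounded.exists_norm_le
  set ρ := C * |ρ0| + 1 with hρ
  have hρp : 0 < ρ := by positivity
  have hw : ∀ s ∈ Set.Icc (0:ℝ) 1, ∀ t, ‖linFlow A t (z s)‖ ≤ ρ := by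
    intro s hs t
    have h1 := hρ0 _ ⟨s, hs, rfl⟩
    calc _ ≤ C * ‖z s‖ := hCb _ (hzB s) t
      _ ≤ C * |ρ0| := by gcongr; exact h1.trans (le_abs_self _)
      _ ≤ ρ := by linarith
  intro ε hε
  set ω := (N'.lam b).im with hωd
  set e := min (ω * ε) 1 with he
  have he0 : 0 < e := lt_min (by positivity) one_pos
  set κ := ‖Complex.exp (Complex.I * e) - 1‖ / 3 with hκ
  have hκ0 : 0 < κ := by
    have := norm_pos_iff.2 (sub_ne_zero.2 (exp_ne he0 (min_le_right _ _)))
    positivity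
  have huc := (isCompact_closedBall (0 : Euc d) (2*ρ)).uniformContinuousOn_of_continuous h.continuous.continuousOn
  rw [Metric.uniformContinuousOn_iff] at huc
  obtain ⟨δ0, hδ0, hδ⟩ := huc (κ * c / C') (by positivity)
  refine ⟨δ0 / (2 * ρ), by positivity, fun T hT => ?_⟩
  refine tau_mul_le hO (hzn 0 (by simp)) (hzn 1 (by simp)) fun t => ?_
  have hexp : ∀ s ∈ Set.Icc (0:ℝ) 1, ‖Complex.exp (Complex.I * (ω * tau hO (linFlow A t (z s)) T : ℝ)) - 1‖ ≤ κ := by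
    intro s hs
    set w := linFlow A t (z s) with hwd
    have hwB : w ∈ N.Bd := N.flow_mem_Bd (hzB s) t
    have h1 : ‖linFlow A T w - w‖ < δ0 := by
      refine (hT w hwB).trans_lt ?_
      calc δ0 / (2 * ρ) * ‖w‖ ≤ δ0 / (2 * ρ) * ρ := by gcongr; exact hw s hs t
        _ = δ0 / 2 := by field_simp
        _ < δ0 := by linarith
    have h2 : dist (h (linFlow A T w)) (h w) < κ * c / C' := by
      refine hδ _ ?_ _ ?_ (by rw [dist_eq_norm]; exact h1)
      · rw [mem_closedBall_zero_iff, hwd, ← linFlow_add]; linarith [hw s hs (T + t)]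
      · rw [mem_closedBall_zero_iff]; linarith [hw s hs t]
    have hhw : h w ∈ N'.Bd := Bd_image_aux N N' hO hwB
    have h3 : ‖N'.c b 0 (h w)‖ = ‖N'.c b 0 (p s)‖ := by
      rw [hwd, tau_spec hO, N'.norm_flow_Bd]
      · simp [hz]
      · simpa [hz] using hB s
    have h4 : N'.c b 0 (h (linFlow A T w) - h w) = (Complex.exp (Complex.I * (ω * tau hO w T : ℝ)) - 1) * N'.c b 0 (h w) := by
      rw [map_sub, tau_spec hO, N'.flow_Bd hhw, sub_mul, one_mul]
      congr 3
      apply Complex.ext <;> simp [hre, hωd]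
    have h5 : ‖N'.c b 0 (h (linFlow A T w) - h w)‖ ≤ κ * c := by
      refine (hcb' b 0 _).trans ?_
      rw [← dist_eq_norm]
      calc C' * dist (h (linFlow A T w)) (h w) ≤ C' * (κ * c / C') := by gcongr
        _ = κ * c := by field_simp
    rw [h4, norm_mul, h3] at h5
    have := hcl s hs
    refine le_of_mul_le_mul_right (h5.trans' ?_) hc
    gcongr
  by_contra hlt
  push Not at hlt
  have hF : ContinuousOn (fun s => ω * tau hO (linFlow A t (z s)) T) (Set.Icc 0 1) := by
    refine continuousOn_const.mul fun s hs => ContinuousAt.continuousWithinAt ?_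
    exact ContinuousAt.comp (f := fun s => linFlow A t (z s)) (g := fun y => tau hO y T)
      (tau_contAt_x hO (flow_opA_ne (hzn s hs) t) T) ((continuous_linFlow_x A t).comp hzc).continuousAt
  obtain ⟨s, hs, s', hs', hss⟩ := osc_lemma hF he0 (by
    show e < |ω * tau hO (linFlow A t (z 0)) T - ω * tau hO (linFlow A t (z 1)) T|
    rw [← mul_sub, abs_mul, abs_of_pos hω]
    exact (min_le_left _ _).trans_lt (by gcongr))
  have a := hexp s hs
  have a' := hexp s' hs'
  rw [hss] at a'
  set θ := ω * tau hO (linFlow A t (z s)) T with hθ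
  have e1 : Complex.exp (Complex.I * e) - 1 = Complex.exp (-(Complex.I * θ)) * ((Complex.exp (Complex.I * (θ + e : ℝ)) - 1) - (Complex.exp (Complex.I * θ) - 1)) := by
    rw [sub_sub_sub_cancel_right, mul_sub, ← Complex.exp_add, ← Complex.exp_add, neg_add_cancel, Complex.exp_zero]
    congr 2
    push_cast; ring
  have e2 : ‖Complex.exp (Complex.I * e) - 1‖ ≤ κ + κ := by
    rw [e1, norm_mul, Complex.norm_exp]
    simp only [Complex.neg_re, Complex.mul_re, Complex.I_re, Complex.I_im, Complex.ofReal_im, Complex.ofReal_re, zero_mul, mul_zero, sub_zero, neg_zero, Real.exp_zero, one_mul]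
    exact (norm_sub_le _ _).trans (add_le_add a' a)
  have : ‖Complex.exp (Complex.I * e) - 1‖ = 3 * κ := by rw [hκ]; ring
  linarith

lemma exists_Bd_vec (N' : NF B) (a : N'.β → ℂ) (ha : ∀ b, (N'.lam b).im = 0 → (a b).im = 0) :
    ∃ x ∈ N'.Bd, ∀ b, (N'.lam b).re = 0 → 0 < N'.m b → N'.c b 0 x = a b := by
  classical
  obtain ⟨x, hx⟩ := N'.surj (fun b j => if j = 0 ∧ (N'.lam b).re = 0 then a b else 0) (fun b j hb => by
    split_ifs
    · exact ha b hb
    · rfl)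
  refine ⟨x, fun b j hj => ?_, fun b hb hm => ?_⟩
  · by_cases hm : j < N'.m b
    · rw [hx b j hm, if_neg hj]
    · exact N'.c_top b j x (by omega)
  · rw [hx b 0 hm, if_pos ⟨rfl, hb⟩]

lemma seg_RelR (N : NF A) (N' : NF B) (hO : IsOrbitEquiv A B h) {u v : Euc d} (hu : u ∈ N'.Bd) (hv : v ∈ N'.Bd) (b : N'.β)
    (hre : (N'.lam b).re = 0) (hω : 0 < (N'.lam b).im)
    (hl : ∀ s : ℝ, 0 ≤ s → s ≤ 1 → (1 - s) • N'.c b 0 u + s • N'.c b 0 v ≠ 0) : RelR N hO (h.symm u) (h.symm v) := by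
  have := path_RelR N N' hO (fun s => (1 - s) • u + s • v) (by fun_prop) b hre hω
    (fun s => N'.Bd.add_mem (N'.Bd.smul_mem _ hu) (N'.Bd.smul_mem _ hv)) (fun s hs => by
      rw [map_add, map_smul, map_smul]; exact hl s hs.1 hs.2)
  simpa using this

lemma all_RelR (N : NF A) (N' : NF B) (hO : IsOrbitEquiv A B h) : ∃ z : Euc d, ∀ x ∈ N.Bd, opA A x ≠ 0 → RelR N hO x z := by
  obtain ⟨z, hzB, hz⟩ := exists_Bd_vec N' (fun _ => 1) (fun b _ => by simp)
  refine ⟨h.symm z, fun x hx hxn => ?_⟩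
  have huB : h x ∈ N'.Bd := Bd_image_aux N N' hO hx
  have hun : opA B (h x) ≠ 0 := by rwa [Ne, hO.fixed_iff]
  obtain ⟨b, hb, hω, hl⟩ : ∃ b, (N'.lam b).re = 0 ∧ 0 < (N'.lam b).im ∧ N'.c b 0 (h x) ≠ 0 := by
    by_contra hcon
    push Not at hcon
    apply hun
    apply N'.inj
    intro b j _
    rw [N'.c_A, huB b (j+1) (by omega), add_zero]
    by_cases hj : j = 0 ∧ (N'.lam b).re = 0
    · rw [hj.1]
      rcases (N'.im_nonneg b).lt_or_eq with h1 | h1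
      · rw [hcon b hj.2 h1, mul_zero]
      · rw [show N'.lam b = 0 from Complex.ext hj.2 h1.symm, zero_mul]
    · rw [huB b j hj, mul_zero]
  have hm : 0 < N'.m b := by
    by_contra h0
    exact hl (N'.c_top b 0 _ (by omega))
  have key : ∀ u ∈ N'.Bd, N'.c b 0 u ∈ Complex.slitPlane → RelR N hO (h.symm u) (h.symm z) := by
    intro u hu hul
    refine seg_RelR N N' hO hu hzB b hb hω fun s hs0 hs1 => ?_
    rw [hz b hb hm, add_comm]
    exact Complex.slitPlane_ne_zero (Complex.starConvex_one_slitPlane hul hs0 (by linarith) (by ring))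
  by_cases hsl : N'.c b 0 (h x) ∈ Complex.slitPlane
  · simpa using key (h x) huB hsl
  · obtain ⟨w, hwB, hw⟩ := exists_Bd_vec N' (fun b => if (N'.lam b).im = 0 then 0 else Complex.I) (fun b hb => by simp [hb])
    have hwb := hw b hb hm
    rw [if_neg hω.ne'] at hwb
    have h2 := key w hwB (by rw [hwb, Complex.mem_slitPlane_iff]; right; simp)
    have h1 : RelR N hO (h.symm (h x)) (h.symm w) := by
      refine seg_RelR N N' hO huB hwB b hb hω fun s hs0 hs1 h0 => ?_
      rw [Complex.mem_slitPlane_iff] at hsl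
      push Not at hsl
      rw [hwb] at h0
      have e1 := congrArg Complex.im h0
      have e2 := congrArg Complex.re h0
      simp [hsl.2] at e1 e2
      rcases e2 with e2 | e2
      · linarith
      · exact hl (Complex.ext e2 hsl.2)
    simpa using h1.trans h2

lemma exists_AP (N : NF A) {δ : ℝ} (hδ : 0 < δ) : ∃ T, 1 ≤ T ∧ AP N δ T := by
  obtain ⟨C, hC, h1⟩ := N.c_bound
  obtain ⟨C', hC', h2⟩ := N.norm_bound
  let f : ℕ → (N.β → ℂ) := fun n b => Complex.exp (((N.lam b).im * n : ℝ) * Complex.I)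
  have hf : ∀ n, f n ∈ Metric.closedBall (0 : N.β → ℂ) 1 := by
    intro n
    rw [mem_closedBall_zero_iff, pi_norm_le_iff_of_nonneg zero_le_one]
    intro b
    exact (Complex.norm_exp_ofReal_mul_I _).le
  obtain ⟨a, -, φ, hφ, hlim⟩ := (isCompact_closedBall (0 : N.β → ℂ) 1).tendsto_subseq hf
  have hcau := hlim.cauchySeq
  rw [Metric.cauchySeq_iff'] at hcau
  obtain ⟨n, hn⟩ := hcau (δ / (C' * C)) (by positivity)
  have h3 := hn (n+1) (by omega)
  have hlt : φ n < φ (n+1) := hφ (by omega)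
  refine ⟨(φ (n+1) : ℝ) - φ n, ?_, fun w hw => ?_⟩
  · have : (φ n : ℝ) + 1 ≤ φ (n+1) := by exact_mod_cast hlt
    linarith
  have e : ∀ b, (N.lam b).re = 0 → ‖Complex.exp (N.lam b * ((φ (n+1) : ℝ) - φ n : ℝ)) - 1‖ ≤ δ / (C' * C) := by
    intro b hb
    have h4 := (dist_le_pi_dist _ _ b).trans h3.le
    rw [dist_eq_norm] at h4
    refine h4.trans' (le_of_eq ?_)
    have e1 : Complex.exp (N.lam b * ((φ (n+1) : ℝ) - φ n : ℝ)) - 1 = Complex.exp (-(((N.lam b).im * φ n : ℝ) * Complex.I)) *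
        (f (φ (n+1)) b - f (φ n) b) := by
      rw [mul_sub, ← Complex.exp_add, ← Complex.exp_add, neg_add_cancel, Complex.exp_zero]
      congr 2
      apply Complex.ext <;> simp [hb]
      ring
    rw [e1, norm_mul, ← neg_mul, ← Complex.ofReal_neg, Complex.norm_exp_ofReal_mul_I, one_mul]
    rfl
  have := h2 (linFlow A ((φ (n+1) : ℝ) - φ n) w - w) (δ / (C' * C) * (C * ‖w‖)) (by positivity) (fun b j _ => by
    by_cases hj : j = 0 ∧ (N.lam b).re = 0
    · rw [hj.1, map_sub, N.flow_Bd hw, ← sub_one_mul, norm_mul]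
      gcongr
      · exact e b hj.2
      · exact h1 b 0 w
    · rw [map_sub, N.flow_mem_Bd hw _ b j hj, hw b j hj]; simp; positivity)
  refine this.trans (le_of_eq ?_)
  field_simp

lemma tau_periodic (hO : IsOrbitEquiv A B h) {x : Euc d} (hx : opA A x ≠ 0) {p : ℝ} (hp : 0 < p) (hper : linFlow A p x = x) :
    ∃ M, ∀ s, |tau hO x s - tau hO x p / p * s| ≤ M := by
  set g : ℝ → ℝ := fun s => tau hO x s - tau hO x p / p * s with hg
  have hgc : Continuous g := (tau_continuous hO x).sub (by fun_prop)
  have hgp : Function.Periodic g p := by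
    intro s
    simp only [hg]
    rw [add_comm, tau_cocycle hO hx, hper]
    field_simp
    ring
  obtain ⟨M, hM⟩ := (isCompact_Icc.image_of_continuousOn (hgc.continuousOn (s := Set.Icc (0:ℝ) p))).isBounded.exists_norm_le
  refine ⟨M, fun s => ?_⟩
  obtain ⟨y, hy, e⟩ := hgp.exists_mem_Ico₀ hp s
  show |g s| ≤ M
  rw [e]
  exact hM _ ⟨y, ⟨hy.1, hy.2.le⟩, rfl⟩

lemma periodic_Bd (N : NF A) {x : Euc d} {p : ℝ} (hp : 0 < p) (hper : linFlow A p x = x) : x ∈ N.Bd := by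
  rw [NF.mem_Bd]
  have hP : Function.Periodic (fun t => linFlow A t x) p := by
    intro s
    show linFlow A (s + p) x = linFlow A s x
    rw [linFlow_add, hper]
  have hc : Continuous (fun t => linFlow A t x) := continuous_linFlow_t A x
  refine ((isCompact_Icc (a := (0:ℝ)) (b := p)).image hc).isBounded.subset ?_
  rintro _ ⟨t, rfl⟩
  obtain ⟨y, hy, e⟩ := hP.exists_mem_Ico₀ hp t
  exact ⟨y, ⟨hy.1, hy.2.le⟩, e.symm⟩

lemma slope_const (N : NF A) (N' : NF B) (hO : IsOrbitEquiv A B h) {x y : Euc d} (hx : opA A x ≠ 0) (hy : opA A y ≠ 0) {p q : ℝ} (hp : 0 < p)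
    (hper : linFlow A p x = x) (hq : 0 < q) (hqer : linFlow A q y = y) : tau hO x p / p = tau hO y q / q := by
  obtain ⟨z, hz⟩ := all_RelR N N' hO
  have hR := (hz x (periodic_Bd N hp hper) hx).trans (hz y (periodic_Bd N hq hqer) hy).symm
  obtain ⟨M, hM⟩ := tau_periodic hO hx hp hper
  obtain ⟨M', hM'⟩ := tau_periodic hO hy hq hqer
  set α := tau hO x p / p
  set β := tau hO y q / q
  by_contra hne
  have hpos : 0 < |α - β| := abs_pos.2 (sub_ne_zero.2 hne)
  obtain ⟨δ, hδ, H⟩ := hR (|α - β| / 2) (by positivity)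
  obtain ⟨T, hT1, hT⟩ := exists_AP N hδ
  obtain ⟨k, hk⟩ := exists_nat_gt ((M + M') / (|α - β| / 2))
  rw [div_lt_iff₀ (by positivity)] at hk
  have a := H T hT k
  have b := hM (k * T)
  have b' := hM' (k * T)
  have e : (α - β) * (k * T) = (tau hO x (k*T) - tau hO y (k*T)) - (tau hO x (k*T) - α * (k*T)) + (tau hO y (k*T) - β * (k*T)) := by ring
  have e2 : |α - β| * (k * T) ≤ k * (|α - β| / 2) + M + M' := by
    have : |(α - β) * (k * T)| = |α - β| * (k * T) := by
      rw [abs_mul, abs_of_nonneg (by positivity : 0 ≤ (k:ℝ) * T)]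
    rw [← this, e]
    refine (abs_add_le _ _).trans (add_le_add ((abs_sub _ _).trans (add_le_add a b)) b')
  have : |α - β| * k * 1 ≤ |α - β| * k * T := by gcongr
  linarith

theorem exists_alpha (hO : IsOrbitEquiv A B h) : ∃ α : ℝ, α ≠ 0 ∧
    ∀ T : ℝ, 0 < T → ∀ x, linFlow A T x = x ↔ linFlow B (α * T) (h x) = h x := by
  obtain ⟨N⟩ := exists_NF A
  obtain ⟨N'⟩ := exists_NF B
  obtain ⟨α, hα, H⟩ : ∃ α : ℝ, α ≠ 0 ∧ ∀ x, opA A x ≠ 0 → ∀ p, 0 < p → linFlow A p x = x → tau hO x p = α * p := by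
    by_cases hE : ∃ x, opA A x ≠ 0 ∧ ∃ p, 0 < p ∧ linFlow A p x = x
    · obtain ⟨x, hx, p, hp, hper⟩ := hE
      refine ⟨tau hO x p / p, ?_, fun y hy q hq hqer => ?_⟩
      · intro h0
        have h1 : tau hO x p = 0 := by
          rcases div_eq_zero_iff.1 h0 with h1 | h1
          · exact h1
          · exact absurd h1 hp.ne'
        have := tau_inv hO hO.symm hx p
        rw [h1, tau_zero] at this
        exact hp.ne this
      · rw [slope_const N N' hO hx hy hp hper hq hqer]; field_simp
    · exact ⟨1, one_ne_zero, fun x hx p hp hper => absurd ⟨x, hx, p, hp, hper⟩ hE⟩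
  refine ⟨α, hα, fun T hT x => ?_⟩
  by_cases hx : opA A x = 0
  · have hx' := hO.fixed hx
    exact ⟨fun _ => (isFixedPt_iff B _).2 hx' _, fun _ => (isFixedPt_iff A _).2 hx _⟩
  constructor
  · intro hper
    rw [← H x hx T hT hper, ← tau_spec, hper]
  · intro hper
    set q := tau hO.symm (h x) (α * T) with hq
    have h1 : linFlow A q x = x := by
      have := tau_spec hO.symm (h x) (α * T)
      rw [hper, h.symm_apply_apply] at this
      exact this.symm
    have h2 : tau hO x q = α * T := tau_inv' hO hO.symm hx _
    have h3 : tau hO x q = α * q := by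
      rcases lt_trichotomy q 0 with hq0 | hq0 | hq0
      · have hn : linFlow A (-q) x = x := by
          conv_lhs => rw [← h1]
          rw [linFlow_neg_cancel]
        have h4 := H x hx (-q) (by linarith) hn
        have h5 := tau_cocycle hO hx q (-q)
        rw [h1, add_neg_cancel, tau_zero] at h5
        linarith
      · rw [hq0]; simp
      · exact H x hx q hq0 h1
    have : q = T := mul_left_cancel₀ hα (h3.symm.trans h2)
    rwa [← this]
end

section
open Filter Topology
attribute [local irreducible] linFlow
variable {d : ℕ} {A B : Matrix (Fin d) (Fin d) ℝ} {h : Euc d ≃ₜ Euc d}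

/-- condition (iii) -/
def Cond3 (A B : Matrix (Fin d) (Fin d) ℝ) : Prop :=
  ({dimS A, dimU A} : Multiset ℕ) = ({dimS B, dimU B} : Multiset ℕ) ∧ ∃ α : ℝ, α ≠ 0 ∧ CS A B α

lemma dimS_neg : dimS (-A) = dimU A := by rw [dimS, dimU, XS_neg]
lemma dimU_neg : dimU (-A) = dimS A := by rw [dimS, dimU, XU_neg]

lemma Cond3.negA (H : Cond3 (-A) B) : Cond3 A B := by
  obtain ⟨h1, α, hα, h2⟩ := H
  rw [dimS_neg, dimU_neg, Multiset.pair_comm] at h1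
  refine ⟨h1, α / (-1), by simpa using hα, ?_⟩
  exact CS.smul_left (by norm_num) (by simpa using h2)

lemma Cond3.negB (H : Cond3 A (-B)) : Cond3 A B := by
  obtain ⟨h1, α, hα, h2⟩ := H
  rw [dimS_neg, dimU_neg, Multiset.pair_comm (dimU B)] at h1
  refine ⟨h1, α * (-1), by simpa using hα, ?_⟩
  exact CS.of_smul (by norm_num) (by simpa using h2)

lemma dims_sum (A : Matrix (Fin d) (Fin d) ℝ) : dimS A + Module.finrank ℝ (XC A) + dimU A = d := by
  classical
  obtain ⟨N⟩ := exists_NF A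
  have ht : N.Y (fun _ _ => True) = ⊤ := by
    rw [eq_top_iff]; intro x _ b j hj; exact absurd trivial hj
  have h1 : Module.finrank ℝ (N.Y (fun _ _ => True)) = d := by
    rw [ht, finrank_top]; simp
  rw [dimS, dimU, N.XS_eq, N.XC_eq, N.XU_eq]
  conv_rhs => rw [← h1]
  rw [N.finrank_Y, N.finrank_Y, N.finrank_Y, N.finrank_Y, ← Finset.sum_add_distrib, ← Finset.sum_add_distrib]
  refine Finset.sum_congr rfl fun b _ => ?_
  rcases lt_trichotomy (N.lam b).re 0 with h | h | h
  · simp [h, h.ne, not_lt.2 h.le]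
  · simp [h]
  · simp [h, h.ne', not_lt.2 h.le]

lemma CS.finrank_eq {α : ℝ} (hc : CS A B α) : Module.finrank ℝ (XC A) = Module.finrank ℝ (XC B) := by
  obtain ⟨_, _, Q, _⟩ := CS_iff.2 hc
  exact Q.finrank_eq

lemma Cond3_of_good (N : NF A) (N' : NF B) (h0 : h 0 = 0) {hO : IsOrbitEquiv A B h} {L : Filter ℝ} (hL : GoodL hO L)
    (hUA : L ≤ atTop ∨ ∀ b, 0 < (N.lam b).re → N.m b = 0) (hUB : L ≤ atTop ∨ ∀ b, 0 < (N'.lam b).re → N'.m b = 0) :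
    Cond3 A B := by
  obtain ⟨α, hα, hP⟩ := exists_alpha hO
  have h1 := dimS_eq N N' h0 hL hUA hUB
  have h2 := CS_of_good N N' h0 hL hUA hUB hα hP
  have h3 := h2.finrank_eq
  have h4 := dims_sum A
  have h5 := dims_sum B
  have h6 : dimU A = dimU B := by omega
  exact ⟨by rw [h1, h6], α, hα, h2⟩

lemma orbit_neg (x : Euc d) : flowOrbit (-A) x = flowOrbit A x := by
  ext y
  constructor
  · rintro ⟨t, rfl⟩; exact ⟨-t, by simp [linFlow_neg_left]⟩
  · rintro ⟨t, rfl⟩; exact ⟨-t, by simp [linFlow_neg_left]⟩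

lemma IsOrbitEquiv.negB (hO : IsOrbitEquiv A B h) : IsOrbitEquiv A (-B) h := fun x => by rw [hO x, orbit_neg]
lemma IsOrbitEquiv.negA (hO : IsOrbitEquiv A B h) : IsOrbitEquiv (-A) B h := fun x => by rw [← hO x, orbit_neg]

lemma IsOrbitEquiv.normalize (hO : IsOrbitEquiv A B h) : ∃ h' : Euc d ≃ₜ Euc d, h' 0 = 0 ∧ IsOrbitEquiv A B h' := by
  have hv : opA B (h 0) = 0 := hO.fixed (by simp)
  have hv' := (isFixedPt_iff B _).2 hv
  refine ⟨h.trans (Homeomorph.addRight (-(h 0))), by simp, fun x => ?_⟩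
  have e : ∀ y, (h.trans (Homeomorph.addRight (-(h 0)))) y = h y - h 0 := fun y => by simp [sub_eq_add_neg]
  rw [e]
  ext y
  constructor
  · rintro ⟨z, hz, rfl⟩
    rw [e]
    obtain ⟨t, ht⟩ : h z ∈ flowOrbit B (h x) := by rw [← hO x]; exact ⟨z, hz, rfl⟩
    refine ⟨t, ?_⟩
    simp only at ht ⊢
    rw [linFlow_map_sub, ht, hv' t]
  · rintro ⟨t, rfl⟩
    obtain ⟨z, hz, e2⟩ : linFlow B t (h x) ∈ h '' flowOrbit A x := by rw [hO x]; exact ⟨t, rfl⟩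
    refine ⟨z, hz, ?_⟩
    simp only
    rw [e, linFlow_map_sub, e2, hv' t]

lemma tau_negB (hO : IsOrbitEquiv A B h) {x : Euc d} (hx : opA A x ≠ 0) (t : ℝ) : tau hO.negB x t = - tau hO x t := by
  refine tau_uniqueOn hO.negB hx Set.univ isPreconnected_univ trivial (fun t => - tau hO x t)
    (tau_continuous hO x).neg.continuousOn (by simp) (fun s _ => ?_) (Set.mem_univ t)
  rw [tau_spec hO, linFlow_neg_left, neg_neg]

lemma U_zero (N : NF A) (hU : dimU A = 0) : ∀ b, 0 < (N.lam b).re → N.m b = 0 := by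
  classical
  intro b hb
  rw [dimU, N.XU_eq, N.finrank_Y, Finset.sum_eq_zero_iff] at hU
  have := hU b (Finset.mem_univ b)
  simp only [hb, Finset.filter_true, Finset.card_range, mul_eq_zero] at this
  rcases this with h1 | h1
  · unfold ed at h1; split_ifs at h1
  · exact h1

lemma hyp_le (A : Matrix (Fin d) (Fin d) ℝ) : dimS A + dimU A + Module.finrank ℝ (LinearMap.ker (opA A)) ≤ d := by
  obtain ⟨N⟩ := exists_NF A
  have hle : LinearMap.ker (opA A) ≤ XC A := by
    intro x hx
    rw [LinearMap.mem_ker, N.mem_ker] at hx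
    rw [N.XC_eq]
    intro b j hj
    exact hx b j fun h => hj (by show (N.lam b).re = 0; rw [show N.lam b = 0 from h.2]; rfl)
  have := Submodule.finrank_mono hle
  have := dims_sum A
  omega

lemma flip_U {A : Matrix (Fin d) (Fin d) ℝ} (hle : dimS A + dimU A ≤ 1) : dimU A = 0 ∨ dimU (-A) = 0 := by
  rw [dimU_neg]; omega

theorem ii_iii (hO : IsOrbitEquiv A B h) : Cond3 A B := by
  obtain ⟨h, h0, hO⟩ := hO.normalize
  obtain ⟨N⟩ := exists_NF A
  obtain ⟨N'⟩ := exists_NF B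
  by_cases hz : ∀ x, opA A x = 0
  · exact Cond3_of_good N N' h0 (hO := hO) (L := atTop) (Or.inl ⟨rfl, fun x hx => absurd (hz x) hx⟩) (Or.inl le_rfl) (Or.inl le_rfl)
  have hker : Module.finrank ℝ (LinearMap.ker (opA A)) = Module.finrank ℝ (LinearMap.ker (opA B)) :=
    finrank_eq_of_image _ _ h fun x => by rw [LinearMap.mem_ker, LinearMap.mem_ker, hO.fixed_iff]
  have hq : Module.finrank ℝ (Euc d ⧸ LinearMap.ker (opA A)) + Module.finrank ℝ (LinearMap.ker (opA A)) = d := by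
    rw [Submodule.finrank_quotient_add_finrank]; simp
  by_cases hcod : 1 < Module.finrank ℝ (Euc d ⧸ LinearMap.ker (opA A))
  · have hconn := isConnected_compl_of_one_lt_codim (E := LinearMap.ker (opA A))
      (by rw [← Module.finrank_eq_rank]; exact_mod_cast hcod)
    have hpre : IsPreconnected {x : Euc d | opA A x ≠ 0} := by
      have e : {x : Euc d | opA A x ≠ 0} = (LinearMap.ker (opA A) : Set (Euc d))ᶜ := by ext x; simp
      rw [e]; exact hconn.isPreconnected
    have hsg : (∀ x, opA A x ≠ 0 → 0 < tau hO x 1) ∨ (∀ x, opA A x ≠ 0 → tau hO x 1 < 0) := by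
      by_contra hcon
      push Not at hcon
      obtain ⟨⟨x, hx, hx1⟩, ⟨y, hy, hy1⟩⟩ := hcon
      have hx1 := lt_of_le_of_ne hx1 (tau_one_ne hO hx)
      have hy1 := lt_of_le_of_ne hy1 (tau_one_ne hO hy).symm
      have hU : IsOpen {z : Euc d | opA A z ≠ 0 ∧ 0 < tau hO z 1} := by
        rw [isOpen_iff_mem_nhds]
        rintro z ⟨hz1, hz2⟩
        filter_upwards [tau_sign hO hz1] with w hw
        exact ⟨hw.2, hw.1.2 hz2⟩
      have hV : IsOpen {z : Euc d | opA A z ≠ 0 ∧ tau hO z 1 < 0} := by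
        rw [isOpen_iff_mem_nhds]
        rintro z ⟨hz1, hz2⟩
        filter_upwards [tau_sign hO hz1] with w hw
        refine ⟨hw.2, lt_of_le_of_ne (not_lt.1 fun h => ?_) (tau_one_ne hO hw.2)⟩
        exact absurd (hw.1.1 h) (not_lt.2 hz2.le)
      obtain ⟨z, -, hz1, hz2⟩ := hpre _ _ hU hV (fun z hz => by
        rcases lt_or_gt_of_ne (tau_one_ne hO hz) with h | h
        · exact Or.inr ⟨hz, h⟩
        · exact Or.inl ⟨hz, h⟩) ⟨y, hy, hy, hy1⟩ ⟨x, hx, hx, hx1⟩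
      exact absurd hz1.2 (not_lt.2 hz2.2.le)
    rcases hsg with hs | hs
    · exact Cond3_of_good N N' h0 (hO := hO) (L := atTop) (Or.inl ⟨rfl, hs⟩) (Or.inl le_rfl) (Or.inl le_rfl)
    · obtain ⟨N''⟩ := exists_NF (-B)
      exact (Cond3_of_good N N'' h0 (hO := hO.negB) (L := atTop) (Or.inl ⟨rfl, fun x hx => by
        rw [tau_negB hO hx]; linarith [hs x hx]⟩) (Or.inl le_rfl) (Or.inl le_rfl)).negB
  · have hA := hyp_le A
    have hB := hyp_le B
    have key : ∀ {A B : Matrix (Fin d) (Fin d) ℝ}, IsOrbitEquiv A B h → dimU A = 0 → dimU B = 0 → Cond3 A B := by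
      intro A B hO hA hB
      obtain ⟨N⟩ := exists_NF A
      obtain ⟨N'⟩ := exists_NF B
      exact Cond3_of_good N N' h0 (hO := hO) (L := cocompact ℝ) (Or.inr rfl) (Or.inr (U_zero N hA)) (Or.inr (U_zero N' hB))
    rcases flip_U (A := A) (by omega) with a | a <;> rcases flip_U (A := B) (by omega) with b | b
    · exact key hO a b
    · exact (key hO.negB a b).negB
    · exact (key hO.negA a b).negA
    · exact (key hO.negA.negB a b).negB.negA
end

section
open Filter Topology
attribute [local irreducible] linFlow
variable {d : ℕ} {A B : Matrix (Fin d) (Fin d) ℝ}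

lemma mem_XS {x : Euc d} : x ∈ XS A ↔ Tendsto (fun t : ℝ => linFlow A t x) atTop (𝓝 0) := by
  obtain ⟨N⟩ := exists_NF A
  have h1 : (x ∈ XS A) ↔ x ∈ stableSet A := by rw [N.XS_eq, N.stableSet_eq]; rfl
  rw [h1]; rfl

lemma flow_mem_XS {x : Euc d} (hx : x ∈ XS A) (t : ℝ) : linFlow A t x ∈ XS A := by
  rw [mem_XS] at hx ⊢
  have : (fun s : ℝ => linFlow A s (linFlow A t x)) = (fun s => linFlow A s x) ∘ (fun s => s + t) := by
    funext s; simp [linFlow_add]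
  rw [this]
  exact hx.comp (tendsto_atTop_add_const_right _ _ tendsto_id)

lemma exists_contract (A : Matrix (Fin d) (Fin d) ℝ) : ∃ T : ℝ, 0 < T ∧ ∀ x ∈ XS A, ‖linFlow A T x‖ ≤ (1/2) * ‖x‖ := by
  let b := Module.finBasis ℝ (XS A)
  have hex : ∀ i, ∃ D : ℝ, 0 ≤ D ∧ ∀ x : XS A, ‖b.coord i x‖ ≤ D * ‖x‖ := fun i =>
    ⟨_, ContinuousLinearMap.opNorm_nonneg (LinearMap.toContinuousLinearMap (b.coord i)), (LinearMap.toContinuousLinearMap (b.coord i)).le_opNorm⟩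
  choose Di hDi0 hDi1 using hex
  let D : ℝ := ∑ i, Di i + 1
  have hD : 0 < D := by have := Finset.sum_nonneg (fun i (_ : i ∈ Finset.univ) => hDi0 i); simp only [D]; linarith
  have hDi : ∀ i, Di i ≤ D := by
    intro i
    have := Finset.single_le_sum (f := Di) (fun j _ => hDi0 j) (Finset.mem_univ i)
    simp only [D]; linarith
  have h1 : Tendsto (fun t : ℝ => D * ∑ i, ‖linFlow A t (b i)‖) atTop (𝓝 0) := by
    have : Tendsto (fun t : ℝ => ∑ i, ‖linFlow A t (b i)‖) atTop (𝓝 (∑ i : Fin (Module.finrank ℝ (XS A)), (0:ℝ))) := by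
      refine tendsto_finset_sum _ fun i _ => ?_
      have := (mem_XS.1 (b i).2).norm
      rwa [norm_zero] at this
    simpa using this.const_mul D
  obtain ⟨T, hT0, hT⟩ := ((h1.eventually (gt_mem_nhds (show (0:ℝ) < 1/2 by norm_num))).and (eventually_gt_atTop 0)).exists
  refine ⟨T, hT, fun x hx => ?_⟩
  have hrep : x = ∑ i, b.repr ⟨x, hx⟩ i • (b i : Euc d) := by
    have := congrArg (Subtype.val) (b.sum_repr ⟨x, hx⟩)
    simp only [Submodule.coe_sum, Submodule.coe_smul] at this
    exact this.symm
  have hfl : linFlow A T x = ∑ i, b.repr ⟨x, hx⟩ i • linFlow A T (b i : Euc d) := by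
    conv_lhs => rw [hrep]
    have := map_sum (flowL A T) (fun i => b.repr ⟨x, hx⟩ i • (b i : Euc d)) Finset.univ
    simp only [map_smul, flowL_apply] at this
    exact this
  rw [hfl]
  calc ‖∑ i, b.repr ⟨x, hx⟩ i • linFlow A T (b i : Euc d)‖ ≤ ∑ i, (D * ‖x‖) * ‖linFlow A T (b i : Euc d)‖ := by
        refine norm_sum_le_of_le _ fun i _ => ?_
        rw [norm_smul]
        gcongr
        refine ((hDi1 i ⟨x, hx⟩).trans ?_)
        exact mul_le_mul_of_nonneg_right (hDi i) (norm_nonneg _)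
    _ = (D * ∑ i, ‖linFlow A T (b i : Euc d)‖) * ‖x‖ := by rw [← Finset.mul_sum]; ring
    _ ≤ 1/2 * ‖x‖ := by gcongr

/-- adapted norm on the stable subspace -/
structure SN (A : Matrix (Fin d) (Fin d) ℝ) where
  n : Euc d → ℝ
  m : ℝ
  C : ℝ
  m_pos : 0 < m
  C_one : 1 ≤ C
  le_n : ∀ x ∈ XS A, ‖x‖ ≤ n x
  n_le : ∀ x ∈ XS A, n x ≤ C * ‖x‖
  tri : ∀ x ∈ XS A, ∀ y ∈ XS A, n (x + y) ≤ n x + n y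
  hom : ∀ (a : ℝ), ∀ x ∈ XS A, n (a • x) = |a| * n x
  dec : ∀ x ∈ XS A, ∀ t, 0 ≤ t → n (linFlow A t x) ≤ Real.exp (-(m * t)) * n x

theorem exists_SN (A : Matrix (Fin d) (Fin d) ℝ) : Nonempty (SN A) := by
  obtain ⟨T, hT, hc⟩ := exists_contract A
  obtain ⟨K, hK, hb⟩ := flow_bound A
  set m := Real.log 2 / T with hm
  have hlog : 0 < Real.log 2 := Real.log_pos (by norm_num)
  have hm0 : 0 < m := by positivity
  have hmT : Real.exp (m * T) = 2 := by
    rw [hm, div_mul_cancel₀ _ hT.ne', Real.exp_log (by norm_num)]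
  let φ : Euc d → ℝ → ℝ := fun x t => Real.exp (m * t) * ‖linFlow A t x‖
  set C := 2 * Real.exp (K * T) with hC
  have hφ1 : ∀ x ∈ XS A, ∀ k : ℕ, ∀ t, φ x (k * T + t) ≤ φ x t := by
    intro x hx k
    induction k with
    | zero => intro t; simp
    | succ k ih =>
      intro t
      have e : ((k+1 : ℕ) : ℝ) * T + t = T + (k * T + t) := by push_cast; ring
      refine le_trans ?_ (ih t)
      rw [e]
      simp only [φ]
      rw [mul_add, Real.exp_add, hmT, linFlow_add]
      have := hc _ (flow_mem_XS hx (k * T + t))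
      nlinarith [Real.exp_pos (m * (k * T + t))]
  have hφ2 : ∀ x ∈ XS A, ∀ t, 0 ≤ t → φ x t ≤ C * ‖x‖ := by
    intro x hx t ht
    have e : t = (⌊t/T⌋₊ : ℕ) * T + (t - ⌊t/T⌋₊ * T) := by ring
    have h1 := Nat.floor_le (show 0 ≤ t/T by positivity)
    have h2 := Nat.lt_floor_add_one (t/T)
    rw [le_div_iff₀ hT] at h1
    rw [div_lt_iff₀ hT] at h2
    rw [e]
    refine (hφ1 x hx _ _).trans ?_
    set r := t - ⌊t/T⌋₊ * T
    have hr0 : 0 ≤ r := by simp only [r]; linarith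
    have hr1 : r ≤ T := by simp only [r]; linarith
    simp only [φ]
    have h3 : Real.exp (m * r) ≤ 2 := by rw [← hmT]; gcongr
    have h4 : ‖linFlow A r x‖ ≤ Real.exp (K * T) * ‖x‖ := by
      refine (hb r x).trans ?_
      rw [abs_of_nonneg hr0]; gcongr
    rw [hC, mul_assoc]
    gcongr
  have hbdd : ∀ x ∈ XS A, BddAbove (Set.range fun t : Set.Ici (0:ℝ) => φ x t) := fun x hx =>
    ⟨C * ‖x‖, by rintro _ ⟨t, rfl⟩; exact hφ2 x hx t t.2⟩
  have : Nonempty (Set.Ici (0:ℝ)) := ⟨⟨0, Set.self_mem_Ici⟩⟩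
  refine ⟨{ n := fun x => ⨆ t : Set.Ici (0:ℝ), φ x t, m := m, C := C, m_pos := hm0, C_one := ?_, le_n := ?_, n_le := ?_, tri := ?_, hom := ?_, dec := ?_ }⟩
  · have : 1 ≤ Real.exp (K * T) := Real.one_le_exp (by positivity)
    linarith
  · intro x hx
    have := le_ciSup (hbdd x hx) ⟨0, Set.self_mem_Ici⟩
    simpa [φ] using this
  · intro x hx
    exact ciSup_le fun t => hφ2 x hx t t.2
  · intro x hx y hy
    refine ciSup_le fun t => ?_
    refine le_trans ?_ (add_le_add (le_ciSup (hbdd x hx) t) (le_ciSup (hbdd y hy) t))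
    simp only [φ]
    rw [linFlow_map_add, ← mul_add]
    gcongr
    exact norm_add_le _ _
  · intro a x hx
    rw [Real.mul_iSup_of_nonneg (abs_nonneg a)]
    congr 1
    funext t
    simp only [φ]
    rw [linFlow_map_smul, norm_smul, Real.norm_eq_abs]; ring
  · intro x hx t ht
    refine ciSup_le fun s => ?_
    have := le_ciSup (hbdd x hx) ⟨s + t, Set.mem_Ici.2 (add_nonneg (Set.mem_Ici.1 s.2) ht)⟩
    have e : φ (linFlow A t x) s = Real.exp (-(m*t)) * φ x (s + t) := by
      simp only [φ]
      rw [linFlow_add, mul_add, Real.exp_add, Real.exp_neg]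
      field_simp
    rw [e]
    gcongr

namespace SN
variable (S : SN A)

lemma n_nonneg {x : Euc d} (hx : x ∈ XS A) : 0 ≤ S.n x := (norm_nonneg x).trans (S.le_n x hx)
lemma n_pos {x : Euc d} (hx : x ∈ XS A) (h0 : x ≠ 0) : 0 < S.n x := (norm_pos_iff.2 h0).trans_le (S.le_n x hx)

lemma n_sub_le {x y : Euc d} (hx : x ∈ XS A) (hy : y ∈ XS A) : S.n x ≤ S.n y + S.n (x - y) := by
  have := S.tri y hy (x - y) (sub_mem hx hy)
  simpa using this

lemma n_symm {x y : Euc d} (hx : x ∈ XS A) (hy : y ∈ XS A) : S.n (x - y) = S.n (y - x) := by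
  have := S.hom (-1) (y - x) (sub_mem hy hx)
  simpa using this

lemma n_lip {x y : Euc d} (hx : x ∈ XS A) (hy : y ∈ XS A) : |S.n x - S.n y| ≤ S.C * ‖x - y‖ := by
  have a := S.n_sub_le hx hy
  have b := S.n_sub_le hy hx
  rw [S.n_symm hy hx] at b
  have c := S.n_le _ (sub_mem hx hy)
  rw [abs_le]; constructor <;> linarith

lemma dec' {x : Euc d} (hx : x ∈ XS A) {s t : ℝ} (hst : s ≤ t) :
    S.n (linFlow A t x) ≤ Real.exp (-(S.m * (t - s))) * S.n (linFlow A s x) := by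
  have := S.dec _ (flow_mem_XS hx s) (t - s) (by linarith)
  rwa [← linFlow_add, sub_add_cancel] at this

lemma cont_n {x : Euc d} (hx : x ∈ XS A) : Continuous fun t => S.n (linFlow A t x) := by
  rw [continuous_iff_continuousAt]
  intro t
  have h1 : Tendsto (fun s => S.C * ‖linFlow A s x - linFlow A t x‖) (𝓝 t) (𝓝 0) := by
    have : Continuous fun s => S.C * ‖linFlow A s x - linFlow A t x‖ :=
      continuous_const.mul ((continuous_linFlow_t A x).sub continuous_const).norm
    simpa using this.tendsto t
  rw [ContinuousAt, tendsto_iff_dist_tendsto_zero]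
  refine squeeze_zero (fun _ => dist_nonneg) (fun s => ?_) h1
  rw [Real.dist_eq]
  exact S.n_lip (flow_mem_XS hx s) (flow_mem_XS hx t)

lemma tm_ex {x : Euc d} (hx : x ∈ XS A) (h0 : x ≠ 0) : ∃ t, S.n (linFlow A t x) = 1 := by
  have hp := S.n_pos hx h0
  have hm := S.m_pos
  set T := |Real.log (S.n x)| / S.m with hT
  have hT0 : 0 ≤ T := by positivity
  have hmT : S.m * T = |Real.log (S.n x)| := by rw [hT]; field_simp
  have a : S.n (linFlow A T x) ≤ 1 := by
    have := S.dec x hx T hT0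
    refine this.trans ?_
    rw [hmT]
    nth_rw 2 [← Real.exp_log hp]
    rw [← Real.exp_add, Real.exp_le_one_iff]
    linarith [le_abs_self (Real.log (S.n x))]
  have b : 1 ≤ S.n (linFlow A (-T) x) := by
    have := S.dec' hx (s := -T) (t := 0) (by linarith)
    rw [linFlow_zero, zero_sub, neg_neg, hmT, Real.exp_neg, ← div_eq_inv_mul, le_div_iff₀ (Real.exp_pos _)] at this
    refine this.trans' ?_
    nth_rw 1 [← Real.exp_log hp]
    rw [← Real.exp_add, Real.one_le_exp_iff]
    linarith [neg_abs_le (Real.log (S.n x))]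
  obtain ⟨t, -, ht⟩ := intermediate_value_Icc' (show -T ≤ T by linarith) (S.cont_n hx).continuousOn ⟨a, b⟩
  exact ⟨t, ht⟩

open Classical in
/-- hitting time of the unit sphere -/
def tm (x : Euc d) : ℝ := if h : ∃ t, S.n (linFlow A t x) = 1 then h.choose else 0

lemma tm_spec {x : Euc d} (hx : x ∈ XS A) (h0 : x ≠ 0) : S.n (linFlow A (S.tm x) x) = 1 := by
  have h := S.tm_ex hx h0
  rw [tm, dif_pos h]; exact h.choose_spec

lemma lt_of {x : Euc d} (hx : x ∈ XS A) {s t : ℝ} (hst : s < t) (hs : 0 < S.n (linFlow A s x)) : S.n (linFlow A t x) < S.n (linFlow A s x) := by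
  have h1 := S.dec' hx hst.le
  have h2 : Real.exp (-(S.m * (t - s))) < 1 := by
    rw [Real.exp_lt_one_iff]
    have := mul_pos S.m_pos (sub_pos.2 hst); linarith
  nlinarith

lemma tm_eq {x : Euc d} (hx : x ∈ XS A) {t : ℝ} (ht : S.n (linFlow A t x) = 1) : S.tm x = t := by
  have h : ∃ t, S.n (linFlow A t x) = 1 := ⟨t, ht⟩
  have h1 : S.n (linFlow A (S.tm x) x) = 1 := by rw [tm, dif_pos h]; exact h.choose_spec
  rcases lt_trichotomy (S.tm x) t with h2 | h2 | h2
  · have := S.lt_of hx h2 (by rw [h1]; norm_num); linarith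
  · exact h2
  · have := S.lt_of hx h2 (by rw [ht]; norm_num); linarith

lemma tm_flow {x : Euc d} (hx : x ∈ XS A) (h0 : x ≠ 0) (t : ℝ) : S.tm (linFlow A t x) = S.tm x - t := by
  refine S.tm_eq (flow_mem_XS hx t) ?_
  rw [← linFlow_add, sub_add_cancel, S.tm_spec hx h0]

end SN

/-- radial projection of `L u` -/
def gS (S' : SN B) (L : Euc d →ₗ[ℝ] Euc d) (u : Euc d) : Euc d := (S'.n (L u))⁻¹ • L u

/-- conjugacy on the stable part -/
def fS (S : SN A) (S' : SN B) (L : Euc d →ₗ[ℝ] Euc d) (x : Euc d) : Euc d :=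
  linFlow B (-(S.tm x)) (gS S' L (linFlow A (S.tm x) x))

/-- linear iso of stable subspaces, ambient form -/
structure LI (A B : Matrix (Fin d) (Fin d) ℝ) where
  L : Euc d →ₗ[ℝ] Euc d
  R : Euc d →ₗ[ℝ] Euc d
  L_mem : ∀ x ∈ XS A, L x ∈ XS B
  R_mem : ∀ x ∈ XS B, R x ∈ XS A
  RL : ∀ x ∈ XS A, R (L x) = x
  LR : ∀ x ∈ XS B, L (R x) = x

def LI.symm (P : LI A B) : LI B A := ⟨P.R, P.L, P.R_mem, P.L_mem, P.LR, P.RL⟩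

lemma exists_LI (hd : dimS A = dimS B) : Nonempty (LI A B) := by
  have Q : XS A ≃ₗ[ℝ] XS B := LinearEquiv.ofFinrankEq _ _ hd
  obtain ⟨Q', hQ⟩ := LinearMap.exists_extend ((XS B).subtype.comp Q.toLinearMap)
  obtain ⟨R', hR⟩ := LinearMap.exists_extend ((XS A).subtype.comp Q.symm.toLinearMap)
  have hQ' : ∀ x : XS A, Q' x = Q x := fun x => LinearMap.congr_fun hQ x
  have hR' : ∀ x : XS B, R' x = Q.symm x := fun x => LinearMap.congr_fun hR x
  refine ⟨⟨Q', R', fun x hx => ?_, fun x hx => ?_, fun x hx => ?_, fun x hx => ?_⟩⟩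
  · rw [hQ' ⟨x, hx⟩]; exact (Q _).2
  · rw [hR' ⟨x, hx⟩]; exact (Q.symm _).2
  · rw [hQ' ⟨x, hx⟩, hR']; simp
  · rw [hR' ⟨x, hx⟩, hQ']; simp

section
variable (S : SN A) (S' : SN B) (P : LI A B)

lemma L_ne {x : Euc d} (hx : x ∈ XS A) (h0 : x ≠ 0) : P.L x ≠ 0 := by
  intro h
  apply h0
  rw [← P.RL x hx, h, map_zero]

lemma gS_mem {u : Euc d} (hu : u ∈ XS A) : gS S' P.L u ∈ XS B := (XS B).smul_mem _ (P.L_mem u hu)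

lemma n_gS {u : Euc d} (hu : u ∈ XS A) (h0 : u ≠ 0) : S'.n (gS S' P.L u) = 1 := by
  have hp := S'.n_pos (P.L_mem u hu) (L_ne P hu h0)
  rw [gS, S'.hom _ _ (P.L_mem u hu), abs_of_pos (by positivity)]
  field_simp

lemma fS_zero : fS S S' P.L 0 = 0 := by
  simp [fS, gS]

lemma fS_mem {x : Euc d} (hx : x ∈ XS A) : fS S S' P.L x ∈ XS B :=
  flow_mem_XS (gS_mem S' P (flow_mem_XS hx _)) _

lemma flow_ne {x : Euc d} (h0 : x ≠ 0) (t : ℝ) : linFlow A t x ≠ 0 := by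
  intro h
  apply h0
  rw [← linFlow_neg_cancel A t x, h, linFlow_map_zero]

lemma fS_flow {x : Euc d} (hx : x ∈ XS A) (t : ℝ) : fS S S' P.L (linFlow A t x) = linFlow B t (fS S S' P.L x) := by
  by_cases h0 : x = 0
  · rw [h0, linFlow_map_zero, fS_zero, linFlow_map_zero]
  · rw [fS, fS, S.tm_flow hx h0, ← linFlow_add, ← linFlow_add, sub_add_cancel]
    congr 1; ring

lemma fS_inv {x : Euc d} (hx : x ∈ XS A) : fS S' S P.R (fS S S' P.L x) = x := by
  by_cases h0 : x = 0
  · rw [h0, fS_zero]; exact fS_zero S' S P.symm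
  set u := linFlow A (S.tm x) x with hu
  have huS : u ∈ XS A := flow_mem_XS hx _
  have hu0 : u ≠ 0 := flow_ne h0 _
  have h1 : linFlow B (S.tm x) (fS S S' P.L x) = gS S' P.L u := by rw [fS, linFlow_cancel_neg]
  have h2 : S'.tm (fS S S' P.L x) = S.tm x := S'.tm_eq (fS_mem S S' P hx) (by rw [h1, n_gS S' P huS hu0])
  have hp := S'.n_pos (P.L_mem u huS) (L_ne P huS hu0)
  have h3 : gS S P.R (gS S' P.L u) = u := by
    rw [gS, gS, map_smul, P.RL u huS, S.hom _ _ huS, S.tm_spec hx h0, abs_of_pos (by positivity), smul_smul]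
    rw [mul_one, inv_inv, mul_inv_cancel₀ hp.ne', one_smul]
  rw [fS, h2, h1, h3, hu, linFlow_neg_cancel]

lemma gS_lip : ∃ K : ℝ, 0 ≤ K ∧ ∀ u ∈ XS A, ∀ v ∈ XS A, S.n u = 1 → S.n v = 1 → ‖gS S' P.L u - gS S' P.L v‖ ≤ K * ‖u - v‖ := by
  set NL := ‖LinearMap.toContinuousLinearMap P.L‖ with hNL
  set NR := ‖LinearMap.toContinuousLinearMap P.R‖ with hNR
  have hL : ∀ x, ‖P.L x‖ ≤ NL * ‖x‖ := fun x => (LinearMap.toContinuousLinearMap P.L).le_opNorm x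
  have hR : ∀ x, ‖P.R x‖ ≤ NR * ‖x‖ := fun x => (LinearMap.toContinuousLinearMap P.R).le_opNorm x
  have hC := S.C_one
  have hC' := S'.C_one
  refine ⟨S.C * NR * (NL * (1 + S'.C)), by positivity, fun u hu v hv hu1 hv1 => ?_⟩
  have hu0 : u ≠ 0 := by rintro rfl; have := S.n_le 0 hu; rw [hu1] at this; norm_num at this
  have hv0 : v ≠ 0 := by rintro rfl; have := S.n_le 0 hv; rw [hv1] at this; norm_num at this
  have ha := S'.n_pos (P.L_mem u hu) (L_ne P hu hu0)
  have hb := S'.n_pos (P.L_mem v hv) (L_ne P hv hv0)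
  have hlip := S'.n_lip (P.L_mem u hu) (P.L_mem v hv)
  have hbv := S'.le_n _ (P.L_mem v hv)
  have hau := S'.le_n _ (P.L_mem u hu)
  have hN : ‖P.L u - P.L v‖ ≤ NL * ‖u - v‖ := by rw [← map_sub]; exact hL _
  have hinv : (S'.n (P.L u))⁻¹ ≤ S.C * NR := by
    rw [inv_le_iff_one_le_mul₀ ha]
    have h1 := S.n_le u hu
    have h2 := hR (P.L u)
    rw [P.RL u hu] at h2
    have hNR0 : 0 ≤ NR := norm_nonneg _
    calc (1:ℝ) ≤ S.C * ‖u‖ := by rw [← hu1]; exact h1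
      _ ≤ S.C * (NR * S'.n (P.L u)) := by gcongr; exact h2.trans (by gcongr)
      _ = _ := by ring
  unfold gS
  set a := S'.n (P.L u) with haa
  set b := S'.n (P.L v) with hbb
  have e : a⁻¹ • P.L u - b⁻¹ • P.L v = a⁻¹ • ((P.L u - P.L v) + ((b - a) / b) • P.L v) := by
    rw [smul_add, smul_sub, smul_smul]
    have : a⁻¹ * ((b - a) / b) = a⁻¹ - b⁻¹ := by field_simp
    rw [this, sub_smul]; abel
  rw [e, norm_smul, norm_inv, Real.norm_eq_abs, abs_of_pos ha]
  have h2 : ‖((b - a) / b) • P.L v‖ ≤ S'.C * (NL * ‖u - v‖) := by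
    rw [norm_smul, norm_div, Real.norm_eq_abs, Real.norm_eq_abs, abs_of_pos hb, div_mul_eq_mul_div, div_le_iff₀ hb, abs_sub_comm]
    have : |a - b| ≤ S'.C * (NL * ‖u - v‖) := hlip.trans (by gcongr)
    exact mul_le_mul this hbv (norm_nonneg _) (by positivity)
  calc a⁻¹ * ‖(P.L u - P.L v) + ((b - a) / b) • P.L v‖ ≤ (S.C * NR) * (NL * ‖u - v‖ + S'.C * (NL * ‖u - v‖)) := by
        gcongr
        exact (norm_add_le _ _).trans (add_le_add hN h2)
    _ = _ := by ring

lemma flow_small (A : Matrix (Fin d) (Fin d) ℝ) (T : ℝ) : ∃ K : ℝ, 0 ≤ K ∧ ∀ t, |t| ≤ T → ∀ x, ‖linFlow A t x - x‖ ≤ K * |t| * ‖x‖ := by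
  obtain ⟨K, hK, hb⟩ := flow_bound A
  set NA := ‖LinearMap.toContinuousLinearMap (opA A)‖ with hNA
  have hA : ∀ x, ‖opA A x‖ ≤ NA * ‖x‖ := fun x => (LinearMap.toContinuousLinearMap (opA A)).le_opNorm x
  have hNA0 : 0 ≤ NA := norm_nonneg _
  refine ⟨NA * Real.exp (K * T), by positivity, fun t ht x => ?_⟩
  have h := (convex_Icc (-|t|) |t|).norm_image_sub_le_of_norm_hasDerivWithin_le (f := fun s => linFlow A s x)
    (f' := fun s => opA A (linFlow A s x)) (C := NA * Real.exp (K * T) * ‖x‖) (x := 0) (y := t)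
    (fun s _ => (hasDerivAt_linFlow A s x).hasDerivWithinAt) (fun s hs => ?_) (by simp) (abs_le.1 le_rfl)
  · simp only [linFlow_zero, sub_zero, Real.norm_eq_abs] at h
    linarith
  · refine (hA _).trans ?_
    rw [mul_assoc]
    gcongr
    refine (hb s x).trans ?_
    gcongr
    exact (abs_le.2 hs).trans ht

lemma fS_lip : ∃ K : ℝ, 0 ≤ K ∧ ∀ u ∈ XS A, ∀ v ∈ XS A, S.n u = 1 → S.n (v - u) ≤ 1/2 →
    ‖fS S S' P.L u - fS S S' P.L v‖ ≤ K * ‖u - v‖ := by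
  obtain ⟨Kg, hKg, hg⟩ := gS_lip S S' P
  obtain ⟨K1, hK1, h1⟩ := flow_small A (1 / S.m)
  obtain ⟨K1', hK1', h1'⟩ := flow_small B (1 / S.m)
  obtain ⟨K, hK, hb⟩ := flow_bound A
  obtain ⟨K', hK', hb'⟩ := flow_bound B
  have hm := S.m_pos
  have hC := S.C_one
  set c := 2 * S.C / S.m with hc
  have hc0 : 0 ≤ c := by positivity
  refine ⟨Real.exp (K' * (1/S.m)) * (Kg * (Real.exp (K * (1/S.m)) + K1 * c)) + K1' * c, by positivity, fun u hu v hv hu1 huv => ?_⟩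
  have hvu : v - u ∈ XS A := sub_mem hv hu
  set e := S.n (v - u) with he
  have he0 : 0 ≤ e := S.n_nonneg hvu
  have heδ : e ≤ S.C * ‖u - v‖ := by rw [norm_sub_rev]; exact S.n_le _ hvu
  have hu0 : u ≠ 0 := by rintro rfl; have := S.n_le 0 hu; rw [hu1] at this; norm_num at this
  have hnv1 : S.n v ≤ 1 + e := by have := S.n_sub_le hv hu; rw [hu1] at this; exact this
  have hnv2 : 1 - e ≤ S.n v := by
    have := S.n_sub_le hu hv
    rw [hu1, S.n_symm hu hv] at this; linarith
  have hv0 : v ≠ 0 := by rintro rfl; have := S.n_le 0 hv; rw [norm_zero, mul_zero] at this; linarith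
  set t := S.tm v with ht
  have hw1 : S.n (linFlow A t v) = 1 := S.tm_spec hv hv0
  have htm : S.m * |t| ≤ 2 * e := by
    rcases le_total 0 t with h | h
    · have := S.dec v hv t h
      rw [hw1] at this
      rw [abs_of_nonneg h]
      have h2 : Real.exp (S.m * t) ≤ 1 + e := by
        rw [Real.exp_neg, ← div_eq_inv_mul, le_div_iff₀ (Real.exp_pos _), one_mul] at this
        linarith
      have := Real.add_one_le_exp (S.m * t)
      linarith
    · have := S.dec' hv (s := t) (t := 0) h
      rw [linFlow_zero, hw1, mul_one, zero_sub] at this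
      rw [abs_of_nonpos h]
      have h2 : 1 - e ≤ Real.exp (-(S.m * -t)) := hnv2.trans this
      rw [Real.exp_neg, ← one_div, le_div_iff₀ (Real.exp_pos _)] at h2
      have := Real.add_one_le_exp (S.m * -t)
      have h4 : 0 ≤ S.m * -t := mul_nonneg hm.le (by linarith)
      nlinarith
  have htc : |t| ≤ c * ‖u - v‖ := by
    rw [hc, div_mul_eq_mul_div, le_div_iff₀ hm]; nlinarith
  have htT : |t| ≤ 1 / S.m := by
    rw [le_div_iff₀ hm]; linarith
  have hwS : linFlow A t v ∈ XS A := flow_mem_XS hv t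
  have hfu : fS S S' P.L u = gS S' P.L u := by
    have : S.tm u = 0 := S.tm_eq hu (by rw [linFlow_zero]; exact hu1)
    rw [fS, this]; simp
  have hfv : fS S S' P.L v = linFlow B (-t) (gS S' P.L (linFlow A t v)) := rfl
  have hun : ‖u‖ ≤ 1 := hu1 ▸ S.le_n u hu
  have hwu : ‖u - linFlow A t v‖ ≤ (Real.exp (K * (1/S.m)) + K1 * c) * ‖u - v‖ := by
    have e1 : u - linFlow A t v = linFlow A t (u - v) - (linFlow A t u - u) := by rw [linFlow_map_sub]; abel
    rw [e1]
    refine (norm_sub_le _ _).trans ?_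
    have a1 : ‖linFlow A t (u - v)‖ ≤ Real.exp (K * (1/S.m)) * ‖u - v‖ := (hb t _).trans (by gcongr)
    have a2 : ‖linFlow A t u - u‖ ≤ K1 * (c * ‖u - v‖) * 1 := (h1 t htT u).trans (by gcongr)
    linarith
  have hgu : ‖gS S' P.L u‖ ≤ 1 := by
    rw [← n_gS S' P hu hu0]; exact S'.le_n _ (gS_mem S' P hu)
  rw [hfu, hfv]
  have e2 : gS S' P.L u - linFlow B (-t) (gS S' P.L (linFlow A t v)) =
    linFlow B (-t) (gS S' P.L u - gS S' P.L (linFlow A t v)) - (linFlow B (-t) (gS S' P.L u) - gS S' P.L u) := by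
    rw [linFlow_map_sub]; abel
  rw [e2]
  refine (norm_sub_le _ _).trans ?_
  have b1 : ‖linFlow B (-t) (gS S' P.L u - gS S' P.L (linFlow A t v))‖ ≤
      Real.exp (K' * (1/S.m)) * (Kg * ((Real.exp (K * (1/S.m)) + K1 * c) * ‖u - v‖)) := by
    refine (hb' (-t) _).trans ?_
    rw [abs_neg]
    gcongr
    refine (hg u hu _ hwS hu1 hw1).trans ?_
    gcongr
  have b2 : ‖linFlow B (-t) (gS S' P.L u) - gS S' P.L u‖ ≤ K1' * (c * ‖u - v‖) * 1 := by
    refine (h1' (-t) (by rwa [abs_neg]) _).trans ?_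
    rw [abs_neg]
    gcongr
  linarith

lemma fS_holder : ∃ γ : ℝ, 0 < γ ∧ γ ≤ 1 ∧ ∃ r : ℝ, 0 < r ∧ ∃ K : ℝ, ∀ x ∈ XS A, ∀ y ∈ XS A, ‖x‖ < r → ‖y‖ < r →
    ‖fS S S' P.L x - fS S S' P.L y‖ ≤ K * ‖x - y‖ ^ γ := by
  obtain ⟨K2, hK2, hlip⟩ := fS_lip S S' P
  obtain ⟨K, hK, hb⟩ := flow_bound A
  have hm := S'.m_pos
  have hC := S.C_one
  have hC' := S'.C_one
  set γ := min (S'.m / (2 * K)) (1/2) with hγ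
  have hγ0 : 0 < γ := lt_min (by positivity) (by norm_num)
  have htm : ∀ x ∈ XS A, x ≠ 0 → S.n x ≤ 1 → S.tm x ≤ 0 := by
    intro x hx h0 h1
    by_contra h
    push Not at h
    have := S.lt_of hx h (by rw [linFlow_zero]; exact S.n_pos hx h0)
    rw [S.tm_spec hx h0, linFlow_zero] at this
    linarith
  have hf : ∀ x ∈ XS A, S.n x ≤ 1 → ∀ σ, (x ≠ 0 → σ ≤ -S.tm x) → ‖fS S S' P.L x‖ ≤ Real.exp (-(S'.m * σ)) := by
    intro x hx h1 σ hσ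
    by_cases h0 : x = 0
    · rw [h0, fS_zero, norm_zero]; positivity
    · have huS := flow_mem_XS hx (S.tm x)
      have hgm := gS_mem S' P huS
      refine (S'.le_n _ (fS_mem S S' P hx)).trans ?_
      refine (S'.dec _ hgm _ (by linarith [htm x hx h0 h1])).trans ?_
      rw [n_gS S' P huS (flow_ne h0 _), mul_one]
      have := hσ h0
      gcongr
  set r := 1 / (8 * S.C^2) with hr
  have hr0 : 0 < r := by positivity
  have hCr : S.C * r ≤ 1 := by
    rw [hr, mul_one_div, div_le_one (by positivity)]; nlinarith
  refine ⟨γ, hγ0, (min_le_right _ _).trans (by norm_num), r, hr0, 2 + S'.C * K2, fun x hx y hy hxr hyr => ?_⟩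
  by_cases hxy : x = y
  · rw [hxy]; simp [Real.zero_rpow hγ0.ne']
  set δ := ‖x - y‖ with hδ
  have hδ0 : 0 < δ := norm_pos_iff.2 (sub_ne_zero.2 hxy)
  have hδr : δ ≤ 1 / (4 * S.C^2) := by
    have h2 : (1:ℝ) / (4 * S.C^2) = r + r := by rw [hr]; field_simp; norm_num
    rw [h2]
    exact (norm_sub_le _ _).trans (by linarith)
  have hδ1 : δ ≤ 1 := hδr.trans (by rw [div_le_one (by positivity)]; nlinarith)
  have hsq : S.C * δ ^ (1/2 : ℝ) ≤ 1/2 := by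
    have : δ ^ (1/2:ℝ) ≤ (1 / (4 * S.C^2)) ^ (1/2 : ℝ) := by gcongr
    have e : (1 / (4 * S.C^2)) ^ (1/2 : ℝ) = 1 / (2 * S.C) := by
      rw [← Real.sqrt_eq_rpow, show 1 / (4 * S.C^2) = (1 / (2 * S.C))^2 by field_simp; norm_num, Real.sqrt_sq (by positivity)]
    rw [e] at this
    calc S.C * δ ^ (1/2 : ℝ) ≤ S.C * (1 / (2 * S.C)) := by gcongr
      _ = 1/2 := by field_simp
  have hnx : S.n x ≤ 1 := (S.n_le x hx).trans (le_trans (by gcongr) hCr)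
  have hny : S.n y ≤ 1 := (S.n_le y hy).trans (le_trans (by gcongr) hCr)
  set σ := - Real.log δ / (2 * K) with hσ
  have hx2 : δ ^ (1/2:ℝ) ≤ δ ^ γ := Real.rpow_le_rpow_of_exponent_ge hδ0 hδ1 (min_le_right _ _)
  have hx1 : Real.exp (-(S'.m * σ)) ≤ δ ^ γ := by
    have : Real.exp (-(S'.m * σ)) = δ ^ (S'.m / (2 * K)) := by
      rw [Real.rpow_def_of_pos hδ0, hσ]; congr 1; field_simp
    rw [this]
    exact Real.rpow_le_rpow_of_exponent_ge hδ0 hδ1 (min_le_left _ _)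
  have case2 : ∀ x ∈ XS A, ∀ y ∈ XS A, ‖x - y‖ = δ → S.n x ≤ 1 → x ≠ 0 → -S.tm x < σ →
      ‖fS S S' P.L x - fS S S' P.L y‖ ≤ S'.C * (K2 * δ ^ (1/2:ℝ)) := by
    intro x hx y hy hxy hnx h0 hs
    set s := -S.tm x with hsd
    have hs0 : 0 ≤ s := by have := htm x hx h0 hnx; linarith
    have ets : S.tm x = -s := by rw [hsd]; ring
    have hu1 : S.n (linFlow A (-s) x) = 1 := by rw [← ets]; exact S.tm_spec hx h0
    have hus := flow_mem_XS hx (-s)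
    have hvs := flow_mem_XS hy (-s)
    have huv : ‖linFlow A (-s) x - linFlow A (-s) y‖ ≤ δ ^ (1/2:ℝ) := by
      rw [← linFlow_map_sub]
      refine (hb (-s) _).trans ?_
      rw [abs_neg, abs_of_nonneg hs0, hxy]
      calc Real.exp (K * s) * δ ≤ Real.exp (K * σ) * δ := by gcongr
        _ = δ ^ (1/2:ℝ) := by
          have e5 : Real.exp (K*σ) * δ = Real.exp (K*σ + Real.log δ) := by rw [Real.exp_add, Real.exp_log hδ0]
          rw [e5, Real.rpow_def_of_pos hδ0, hσ]; congr 1; field_simp; ring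
    have h3 := hlip _ hus _ hvs hu1 (by
      refine (S.n_le _ (sub_mem hvs hus)).trans (le_trans ?_ hsq)
      rw [norm_sub_rev]
      gcongr)
    rw [fS_flow S S' P hx, fS_flow S S' P hy, ← linFlow_map_sub] at h3
    set z := linFlow B (-s) (fS S S' P.L x - fS S S' P.L y) with hz
    have hzS : z ∈ XS B := flow_mem_XS (sub_mem (fS_mem S S' P hx) (fS_mem S S' P hy)) _
    have e4 : fS S S' P.L x - fS S S' P.L y = linFlow B s z := by rw [hz, linFlow_cancel_neg]
    rw [e4]
    calc ‖linFlow B s z‖ ≤ S'.n (linFlow B s z) := S'.le_n _ (flow_mem_XS hzS s)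
      _ ≤ Real.exp (-(S'.m * s)) * S'.n z := S'.dec z hzS s hs0
      _ ≤ 1 * S'.n z := by
        gcongr
        · exact S'.n_nonneg hzS
        · rw [Real.exp_le_one_iff]; nlinarith
      _ ≤ S'.C * ‖z‖ := by rw [one_mul]; exact S'.n_le z hzS
      _ ≤ S'.C * (K2 * δ ^ (1/2:ℝ)) := by gcongr; exact h3.trans (by gcongr)
  have hδγ : 0 ≤ δ ^ γ := by positivity
  have hfin2 : S'.C * (K2 * δ ^ (1/2:ℝ)) ≤ (2 + S'.C * K2) * δ ^ γ := by
    calc S'.C * (K2 * δ ^ (1/2:ℝ)) ≤ S'.C * (K2 * δ ^ γ) := by gcongr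
      _ ≤ _ := by nlinarith
  by_cases c1 : x ≠ 0 ∧ -S.tm x < σ
  · exact (case2 x hx y hy rfl hnx c1.1 c1.2).trans hfin2
  by_cases c2 : y ≠ 0 ∧ -S.tm y < σ
  · rw [norm_sub_rev]
    exact (case2 y hy x hx (norm_sub_rev _ _) hny c2.1 c2.2).trans hfin2
  push Not at c1 c2
  have a1 := hf x hx hnx σ c1
  have a2 := hf y hy hny σ c2
  have : 0 ≤ S'.C * K2 * δ ^ γ := by positivity
  calc _ ≤ ‖fS S S' P.L x‖ + ‖fS S S' P.L y‖ := norm_sub_le _ _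
    _ ≤ (2 + S'.C * K2) * δ ^ γ := by linarith

end
end

section
open Filter Topology
attribute [local irreducible] linFlow
variable {d : ℕ} {A B : Matrix (Fin d) (Fin d) ℝ}

/-- some-Hölder near zero -/
def HN (f : Euc d → Euc d) : Prop := ∃ γ : ℝ, 0 < γ ∧ HolderNearZero γ f

/-- some-Hölder near zero on a subspace -/
def HolOn (V : Submodule ℝ (Euc d)) (f : Euc d → Euc d) : Prop :=
  ∃ γ : ℝ, 0 < γ ∧ ∃ r : ℝ, 0 < r ∧ ∃ K : ℝ, ∀ x ∈ V, ∀ y ∈ V, ‖x‖ < r → ‖y‖ < r → ‖f x - f y‖ ≤ K * ‖x - y‖ ^ γ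

lemma HolderNearZero.mono {f : Euc d → Euc d} {γ γ' : ℝ} (h : HolderNearZero γ f) (h1 : γ' ≤ γ) (h0 : 0 < γ') :
    HolderNearZero γ' f := by
  obtain ⟨r, hr, K, hK⟩ := h
  refine ⟨min r (1/2), lt_min hr (by norm_num), |K|, fun x hx y hy => ?_⟩
  rw [Metric.mem_ball, lt_min_iff] at hx hy
  refine (hK x hx.1 y hy.1).trans ?_
  by_cases hxy : x = y
  · subst hxy
    rw [dist_self, Real.zero_rpow h0.ne', Real.zero_rpow (h0.trans_le h1).ne']; simp
  have hd : dist x y ≤ 1 := by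
    have := dist_triangle_right x y 0
    linarith [hx.2, hy.2]
  have hp := dist_pos.2 hxy
  have := Real.rpow_le_rpow_of_exponent_ge hp hd h1
  exact mul_le_mul (le_abs_self K) this (by positivity) (abs_nonneg K)

lemma HN.add {f g : Euc d → Euc d} (hf : HN f) (hg : HN g) : HN (fun x => f x + g x) := by
  obtain ⟨a, ha, hf⟩ := hf
  obtain ⟨b, hb, hg⟩ := hg
  have h0 : 0 < min a b := lt_min ha hb
  obtain ⟨r, hr, K, hK⟩ := hf.mono (min_le_left a b) h0
  obtain ⟨r', hr', K', hK'⟩ := hg.mono (min_le_right a b) h0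
  refine ⟨min a b, h0, min r r', lt_min hr hr', K + K', fun x hx y hy => ?_⟩
  rw [Metric.mem_ball, lt_min_iff] at hx hy
  refine (dist_add_add_le _ _ _ _).trans ?_
  rw [add_mul]
  exact add_le_add (hK x hx.1 y hy.1) (hK' x hx.2 y hy.2)

lemma HN.zero : HN (fun _ : Euc d => (0 : Euc d)) :=
  ⟨1, one_pos, 1, one_pos, 0, fun x _ y _ => by simp⟩

lemma HN.sum {ι : Type*} (s : Finset ι) (f : ι → Euc d → Euc d) (h : ∀ i, HN (f i)) : HN (fun x => ∑ i ∈ s, f i x) := by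
  classical
  induction s using Finset.induction_on with
  | empty => simpa using HN.zero
  | insert i s hi ih =>
    simp only [Finset.sum_insert hi]
    exact (h i).add ih

lemma HolOn.comp {V : Submodule ℝ (Euc d)} {f : Euc d → Euc d} (hf : HolOn V f) (P : Euc d →ₗ[ℝ] Euc d) (hP : ∀ x, P x ∈ V) :
    HN (fun x => f (P x)) := by
  obtain ⟨γ, hγ, r, hr, K, hK⟩ := hf
  obtain ⟨C, hC, hPC⟩ : ∃ C : ℝ, 0 < C ∧ ∀ x, ‖P x‖ ≤ C * ‖x‖ :=
    ⟨‖LinearMap.toContinuousLinearMap P‖ + 1, by positivity, fun x =>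
      ((LinearMap.toContinuousLinearMap P).le_opNorm x).trans (by gcongr; linarith)⟩
  refine ⟨γ, hγ, r / C, by positivity, |K| * C ^ γ, fun x hx y hy => ?_⟩
  rw [mem_ball_zero_iff, lt_div_iff₀ hC] at hx hy
  rw [dist_eq_norm, dist_eq_norm]
  refine (hK _ (hP x) _ (hP y) ((hPC x).trans_lt (by linarith)) ((hPC y).trans_lt (by linarith))).trans ?_
  rw [← map_sub, mul_assoc, ← Real.mul_rpow hC.le (norm_nonneg _)]
  have : ‖P (x - y)‖ ^ γ ≤ (C * ‖x - y‖) ^ γ := Real.rpow_le_rpow (norm_nonneg _) (hPC _) hγ.le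
  exact mul_le_mul (le_abs_self K) this (by positivity) (abs_nonneg K)

/-- conjugacy between flow-invariant subspaces -/
structure Piece (A B : Matrix (Fin d) (Fin d) ℝ) (V V' : Submodule ℝ (Euc d)) where
  f : Euc d → Euc d
  g : Euc d → Euc d
  inv : ∀ x ∈ V, ∀ t, linFlow A t x ∈ V
  f_mem : ∀ x ∈ V, f x ∈ V'
  g_mem : ∀ x ∈ V', g x ∈ V
  gf : ∀ x ∈ V, g (f x) = x
  fg : ∀ x ∈ V', f (g x) = x
  conj : ∀ x ∈ V, ∀ t, f (linFlow A t x) = linFlow B t (f x)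
  f0 : f 0 = 0
  cf : ContinuousOn f V
  cg : ContinuousOn g V'
  hf : HolOn V f
  hg : HolOn V' g

structure Dec {ι : Type} [Fintype ι] (V : ι → Submodule ℝ (Euc d)) where
  P : ι → Euc d →ₗ[ℝ] Euc d
  mem : ∀ i x, P i x ∈ V i
  sum : ∀ x, ∑ i, P i x = x
  id : ∀ i, ∀ x ∈ V i, P i x = x
  zero : ∀ i j, i ≠ j → ∀ x ∈ V j, P i x = 0

lemma Dec.P_sum {ι : Type} [Fintype ι] {V : ι → Submodule ℝ (Euc d)} (D : Dec V) (y : ι → Euc d) (hy : ∀ i, y i ∈ V i) (i : ι) :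
    D.P i (∑ j, y j) = y i := by
  classical
  rw [map_sum, Finset.sum_eq_single i]
  · exact D.id i _ (hy i)
  · intro j _ hj; exact D.zero i j hj.symm _ (hy j)
  · simp

theorem glue {ι : Type} [Fintype ι] {V V' : ι → Submodule ℝ (Euc d)} (D : Dec V) (D' : Dec V')
    (F : ∀ i, Piece A B (V i) (V' i)) :
    ∃ h : Euc d ≃ₜ Euc d, MemH0plus h ∧ ∀ t x, h (linFlow A t x) = linFlow B t (h x) := by
  have hP : ∀ t x i, D.P i (linFlow A t x) = linFlow A t (D.P i x) := by
    intro t x i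
    have h1 : linFlow A t x = ∑ j, linFlow A t (D.P j x) := by
      conv_lhs => rw [← D.sum x]
      have := map_sum (flowL A t) (fun j => D.P j x) Finset.univ
      simp only [flowL_apply] at this
      exact this
    rw [h1]
    exact D.P_sum (fun j => linFlow A t (D.P j x)) (fun j => (F j).inv _ (D.mem j x) t) i
  let h : Euc d ≃ₜ Euc d :=
    { toFun := fun x => ∑ i, (F i).f (D.P i x)
      invFun := fun y => ∑ i, (F i).g (D'.P i y)
      left_inv := by
        intro x
        show ∑ i, (F i).g (D'.P i (∑ j, (F j).f (D.P j x))) = x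
        conv_rhs => rw [← D.sum x]
        refine Finset.sum_congr rfl fun i _ => ?_
        rw [D'.P_sum (fun j => (F j).f (D.P j x)) (fun j => (F j).f_mem _ (D.mem j x)) i]
        exact (F i).gf _ (D.mem i x)
      right_inv := by
        intro x
        show ∑ i, (F i).f (D.P i (∑ j, (F j).g (D'.P j x))) = x
        conv_rhs => rw [← D'.sum x]
        refine Finset.sum_congr rfl fun i _ => ?_
        rw [D.P_sum (fun j => (F j).g (D'.P j x)) (fun j => (F j).g_mem _ (D'.mem j x)) i]
        exact (F i).fg _ (D'.mem i x)
      continuous_toFun := by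
        refine continuous_finsetSum _ fun i _ => ?_
        exact (F i).cf.comp_continuous (LinearMap.continuous_of_finiteDimensional (D.P i)) (D.mem i)
      continuous_invFun := by
        refine continuous_finsetSum _ fun i _ => ?_
        exact (F i).cg.comp_continuous (LinearMap.continuous_of_finiteDimensional (D'.P i)) (D'.mem i) }
  have h1 : ∀ x, h x = ∑ i, (F i).f (D.P i x) := fun _ => rfl
  have h2 : ∀ x, h.symm x = ∑ i, (F i).g (D'.P i x) := fun _ => rfl
  refine ⟨h, ?_, fun t x => ?_⟩
  · have a1 : HN h := HN.sum Finset.univ (fun i x => (F i).f (D.P i x)) fun i => (F i).hf.comp (D.P i) (D.mem i)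
    have a2 : HN h.symm := HN.sum Finset.univ (fun i x => (F i).g (D'.P i x)) fun i => (F i).hg.comp (D'.P i) (D'.mem i)
    obtain ⟨a, ha, hf⟩ := a1
    obtain ⟨b, hb, hg⟩ := a2
    have h0 : 0 < min a b := lt_min ha hb
    refine ⟨min a b, h0, ?_, hf.mono (min_le_left _ _) h0, hg.mono (min_le_right _ _) h0⟩
    rw [h1]
    exact Finset.sum_eq_zero fun i _ => by rw [map_zero, (F i).f0]
  · rw [h1, h1]
    have := map_sum (flowL B t) (fun j => (F j).f (D.P j x)) Finset.univ
    simp only [flowL_apply] at this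
    rw [this]
    refine Finset.sum_congr rfl fun i _ => ?_
    rw [hP, (F i).conj _ (D.mem i x)]

/-- stable, central, unstable -/
def VV (A : Matrix (Fin d) (Fin d) ℝ) : Fin 3 → Submodule ℝ (Euc d) := ![XS A, XC A, XU A]

lemma exists_Dec (A : Matrix (Fin d) (Fin d) ℝ) : Nonempty (Dec (VV A)) := by
  obtain ⟨N⟩ := exists_NF A
  let I : Fin 3 → N.β → ℕ → Prop := ![fun b _ => (N.lam b).re < 0, fun b _ => (N.lam b).re = 0, fun b _ => 0 < (N.lam b).re]
  have hV : ∀ i, VV A i = N.Y (I i) := by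
    intro i
    fin_cases i
    · exact N.XS_eq
    · exact N.XC_eq
    · exact N.XU_eq
  have hI : ∀ i j b k, i ≠ j → I i b k → ¬ I j b k := by
    intro i j b k hij
    fin_cases i <;> fin_cases j <;> simp [I] at hij ⊢ <;> intro h <;> linarith
  have hex : ∀ b k, ∃ i, I i b k := by
    intro b k
    rcases lt_trichotomy ((N.lam b).re) 0 with h | h | h
    · exact ⟨0, h⟩
    · exact ⟨1, h⟩
    · exact ⟨2, h⟩
  choose P hP using fun i => N.exists_proj (I i)
  refine ⟨⟨P, fun i x => ?_, fun x => ?_, fun i x hx => ?_, fun i j hij x hx => ?_⟩⟩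
  · rw [hV, N.mem_Y]; exact fun b k hn => (hP i x b k).2 hn
  · refine N.ext_c fun b k _ => ?_
    obtain ⟨i, hi⟩ := hex b k
    rw [map_sum, Finset.sum_eq_single i]
    · exact (hP i x b k).1 hi
    · intro j _ hj; exact (hP j x b k).2 (hI i j b k hj.symm hi)
    · simp
  · rw [hV, N.mem_Y] at hx
    refine N.ext_c fun b k _ => ?_
    by_cases h : I i b k
    · exact (hP i x b k).1 h
    · rw [(hP i x b k).2 h, hx b k h]
  · rw [hV, N.mem_Y] at hx
    refine N.ext_c fun b k _ => ?_
    rw [map_zero]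
    by_cases h : I i b k
    · rw [(hP i x b k).1 h, hx b k (hI i j b k hij h)]
    · exact (hP i x b k).2 h

lemma fS_cont (S : SN A) (S' : SN B) (P : LI A B) : ContinuousOn (fS S S' P.L) (XS A) := by
  obtain ⟨γ, hγ, -, r, hr, K, hK⟩ := fS_holder S S' P
  intro x hx
  obtain ⟨T, hT⟩ := ((mem_XS.1 hx).eventually (Metric.ball_mem_nhds 0 hr)).exists
  rw [dist_zero_right] at hT
  have hev : ∀ᶠ y in 𝓝[XS A] x, ‖linFlow A T y‖ < r := by
    refine eventually_nhdsWithin_of_eventually_nhds ?_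
    exact (continuous_linFlow_x A T).norm.continuousAt.eventually (gt_mem_nhds hT)
  have h1 : Tendsto (fun y => fS S S' P.L (linFlow A T y)) (𝓝[XS A] x) (𝓝 (fS S S' P.L (linFlow A T x))) := by
    rw [tendsto_iff_norm_sub_tendsto_zero]
    have hz : Tendsto (fun y => K * ‖linFlow A T y - linFlow A T x‖ ^ γ) (𝓝[XS A] x) (𝓝 0) := by
      have : Continuous fun y => K * ‖linFlow A T y - linFlow A T x‖ ^ γ :=
        continuous_const.mul (Continuous.rpow_const ((continuous_linFlow_x A T).sub continuous_const).norm (fun _ => Or.inr hγ.le))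
      have h := this.tendsto x
      simp only [sub_self, norm_zero, Real.zero_rpow hγ.ne', mul_zero] at h
      exact h.mono_left nhdsWithin_le_nhds
    refine squeeze_zero' (Eventually.of_forall fun _ => norm_nonneg _) ?_ hz
    filter_upwards [hev, self_mem_nhdsWithin] with y hy hyS
    exact hK _ (flow_mem_XS hyS T) _ (flow_mem_XS hx T) hy hT
  have h2 := ((continuous_linFlow_x B (-T)).tendsto _).comp h1
  have e : ∀ y ∈ XS A, linFlow B (-T) (fS S S' P.L (linFlow A T y)) = fS S S' P.L y := by
    intro y hy; rw [fS_flow S S' P hy, linFlow_neg_cancel]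
  rw [e x hx] at h2
  refine h2.congr' ?_
  filter_upwards [self_mem_nhdsWithin] with y hyS
  exact e y hyS

lemma stable_piece (hd : dimS A = dimS B) : Nonempty (Piece A B (XS A) (XS B)) := by
  obtain ⟨S⟩ := exists_SN A
  obtain ⟨S'⟩ := exists_SN B
  obtain ⟨P⟩ := exists_LI hd
  obtain ⟨γ, hγ, -, h1⟩ := fS_holder S S' P
  obtain ⟨γ', hγ', -, h2⟩ := fS_holder S' S P.symm
  exact ⟨{ f := fS S S' P.L, g := fS S' S P.symm.L, inv := fun x hx t => flow_mem_XS hx t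
           f_mem := fun x hx => fS_mem S S' P hx, g_mem := fun x hx => fS_mem S' S P.symm hx
           gf := fun x hx => fS_inv S S' P hx, fg := fun x hx => fS_inv S' S P.symm hx
           conj := fun x hx t => fS_flow S S' P hx t, f0 := fS_zero S S' P
           cf := fS_cont S S' P, cg := fS_cont S' S P.symm, hf := ⟨γ, hγ, h1⟩, hg := ⟨γ', hγ', h2⟩ }⟩

lemma unstable_piece (hd : dimU A = dimU B) : Nonempty (Piece A B (XU A) (XU B)) := by
  rw [← dimS_neg, ← dimS_neg] at hd
  obtain ⟨Q⟩ := stable_piece hd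
  rw [XS_neg, XS_neg] at Q
  have e : ∀ (M : Matrix (Fin d) (Fin d) ℝ) t x, linFlow M t x = linFlow (-M) (-t) x := by
    intro M t x
    rw [linFlow_neg_left, neg_neg]
  exact ⟨{ f := Q.f, g := Q.g, inv := fun x hx t => by rw [e]; exact Q.inv x hx _
           f_mem := Q.f_mem, g_mem := Q.g_mem, gf := Q.gf, fg := Q.fg
           conj := fun x hx t => by rw [e, e B]; exact Q.conj x hx _
           f0 := Q.f0, cf := Q.cf, cg := Q.cg, hf := Q.hf, hg := Q.hg }⟩

lemma HolOn.linear (V : Submodule ℝ (Euc d)) (Q : Euc d →ₗ[ℝ] Euc d) : HolOn V Q := by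
  refine ⟨1, one_pos, 1, one_pos, ‖LinearMap.toContinuousLinearMap Q‖, fun x _ y _ _ _ => ?_⟩
  rw [Real.rpow_one, ← map_sub]
  exact (LinearMap.toContinuousLinearMap Q).le_opNorm (x - y)

lemma flow_mem_XC {x : Euc d} (hx : x ∈ XC A) (t : ℝ) : linFlow A t x ∈ XC A := by
  obtain ⟨N⟩ := exists_NF A
  rw [N.XC_eq, N.mem_Y] at hx ⊢
  intro b j hb
  refine N.top_ind b (fun K h => ?_) j
  rw [N.flow_top b K (fun j _ => hx b j hb), hx b K hb, mul_zero]

lemma CS.conj {Q : Euc d →ₗ[ℝ] Euc d} (hQ : ∀ x ∈ XC A, Q (opA A x) = opA B (Q x)) {x : Euc d} (hx : x ∈ XC A) (t : ℝ) :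
    Q (linFlow A t x) = linFlow B t (Q x) := by
  let T := LinearMap.toContinuousLinearMap (opA B)
  have hl : LipschitzWith ‖T‖₊ (opA B) := T.lipschitz
  have h1 : ∀ s, HasDerivAt (fun s => Q (linFlow A s x)) (opA B (Q (linFlow A s x))) s := by
    intro s
    have := (LinearMap.toContinuousLinearMap Q).hasFDerivAt.comp_hasDerivAt s (hasDerivAt_linFlow A s x)
    rw [← hQ _ (flow_mem_XC hx s)]
    exact this
  have h2 : ∀ s, HasDerivAt (fun s => linFlow B s (Q x)) (opA B (linFlow B s (Q x))) s := fun s => hasDerivAt_linFlow B s (Q x)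
  have := ODE_solution_unique_univ (v := fun _ => opA B) (s := fun _ => Set.univ) (K := ‖T‖₊) (t₀ := 0)
    (fun t => hl.lipschitzOnWith) (fun s => ⟨h1 s, trivial⟩) (fun s => ⟨h2 s, trivial⟩) (by simp [linFlow_zero])
  exact congrFun this t

lemma central_piece (h : CS A B 1) : Nonempty (Piece A B (XC A) (XC B)) := by
  obtain ⟨Q, R, h1, h2⟩ := h
  exact ⟨{ f := Q, g := R, inv := fun x hx t => flow_mem_XC hx t
           f_mem := fun x hx => (h1 x hx).1, g_mem := fun x hx => (h2 x hx).1
           gf := fun x hx => (h1 x hx).2.1, fg := fun x hx => (h2 x hx).2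
           conj := fun x hx t => CS.conj (fun x hx => by rw [(h1 x hx).2.2, one_smul]) hx t
           f0 := map_zero Q
           cf := (LinearMap.continuous_of_finiteDimensional Q).continuousOn
           cg := (LinearMap.continuous_of_finiteDimensional R).continuousOn
           hf := HolOn.linear _ Q, hg := HolOn.linear _ R }⟩

theorem conj_of (hS : dimS A = dimS B) (hU : dimU A = dimU B) (hC : CS A B 1) :
    ∃ h : Euc d ≃ₜ Euc d, MemH0plus h ∧ IsOrbitEquiv A B h := by
  obtain ⟨D⟩ := exists_Dec A
  obtain ⟨D'⟩ := exists_Dec B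
  have F : ∀ i, Nonempty (Piece A B (VV A i) (VV B i)) := by
    intro i
    fin_cases i
    · exact stable_piece hS
    · exact central_piece hC
    · exact unstable_piece hU
  obtain ⟨h, h1, h2⟩ := glue D D' (fun i => (F i).some)
  refine ⟨h, h1, fun x => ?_⟩
  rw [flowOrbit, flowOrbit, ← Set.range_comp]
  congr 1
  funext t
  exact h2 t x

/-- conjugation symmetry on the central part -/
lemma exists_J (B : Matrix (Fin d) (Fin d) ℝ) : ∃ J : Euc d →ₗ[ℝ] Euc d, ∀ x ∈ XC B, J x ∈ XC B ∧ J (J x) = x ∧ J (opA B x) = - opA B (J x) := by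
  classical
  obtain ⟨N⟩ := exists_NF B
  have h : ∀ x, ∃ y, ∀ b j, j < N.m b → N.c b j y = if (N.lam b).re = 0 then (-1)^j * (starRingEnd ℂ) (N.c b j x) else 0 := fun x => N.surj _ (by
    intro b j hl
    split_ifs
    · have := N.c_real b j x hl
      have h1 : ((-1:ℂ)^j).im = 0 := by
        rcases neg_one_pow_eq_or ℂ j with h | h <;> simp [h]
      simp [this, h1]
    · simp)
  choose J hJ using h
  have hJ' : ∀ x b j, N.c b j (J x) = if (N.lam b).re = 0 then (-1)^j * (starRingEnd ℂ) (N.c b j x) else 0 := by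
    intro x b j
    by_cases hj : j < N.m b
    · exact hJ x b j hj
    · rw [N.c_top b j _ (not_lt.1 hj), N.c_top b j _ (not_lt.1 hj)]; simp
  refine ⟨{ toFun := J, map_add' := fun x y => ?_, map_smul' := fun a x => ?_ }, fun x hx => ⟨?_, ?_, ?_⟩⟩
  · refine N.ext_c fun b j _ => ?_
    rw [map_add, hJ', hJ', hJ', map_add]
    split_ifs
    · rw [map_add]; ring
    · simp
  · refine N.ext_c fun b j _ => ?_
    rw [map_smul, hJ', hJ', map_smul]
    split_ifs
    · simp; ring
    · simp
  · rw [N.XC_eq, N.mem_Y]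
    intro b j hb
    show N.c b j (J x) = 0
    rw [hJ', if_neg hb]
  · rw [N.XC_eq, N.mem_Y] at hx
    refine N.ext_c fun b j _ => ?_
    show N.c b j (J (J x)) = _
    rw [hJ', hJ']
    split_ifs with hb
    · rw [map_mul, map_pow, map_neg, map_one, Complex.conj_conj, ← mul_assoc, ← mul_pow]; simp
    · exact (hx b j hb).symm
  · refine N.ext_c fun b j _ => ?_
    show N.c b j (J (opA B x)) = N.c b j (-opA B (J x))
    rw [map_neg, N.c_A, hJ', hJ', hJ', N.c_A]
    split_ifs with hb
    · have hl : (starRingEnd ℂ) (N.lam b) = - N.lam b := by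
        apply Complex.ext <;> simp [hb]
      rw [map_add, map_mul, hl]; ring
    · simp

lemma CS.neg {α : ℝ} (h : CS A B α) : CS A B (-α) := by
  obtain ⟨Q, R, h1, h2⟩ := h
  obtain ⟨J, hJ⟩ := exists_J B
  refine ⟨J.comp Q, R.comp J, fun x hx => ?_, fun y hy => ?_⟩
  · obtain ⟨a, b, c⟩ := h1 x hx
    obtain ⟨j1, j2, j3⟩ := hJ _ a
    refine ⟨j1, ?_, ?_⟩
    · simp only [LinearMap.comp_apply]; rw [j2, b]
    · simp only [LinearMap.comp_apply]; rw [c, map_smul, j3, smul_neg, neg_smul]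
  · obtain ⟨j1, j2, j3⟩ := hJ y hy
    obtain ⟨a, b⟩ := h2 _ j1
    refine ⟨a, ?_⟩
    simp only [LinearMap.comp_apply]; rw [b, j2]

lemma orbit_smul {α : ℝ} (hα : α ≠ 0) (x : Euc d) : flowOrbit (α • B) x = flowOrbit B x := by
  ext y
  simp only [flowOrbit, Set.mem_range]
  constructor
  · rintro ⟨t, rfl⟩; exact ⟨α * t, by rw [linFlow_smul_left]⟩
  · rintro ⟨t, rfl⟩; exact ⟨t / α, by rw [linFlow_smul_left]; field_simp⟩

lemma iii_pos {α : ℝ} (hS : dimS A = dimS B) (hU : dimU A = dimU B) (hα : 0 < α) (hC : CS A B α) :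
    ∃ h : Euc d ≃ₜ Euc d, MemH0plus h ∧ IsOrbitEquiv A B h := by
  have h1 : CS A (α • B) 1 := CS.smul_right hα.ne' (by rwa [one_mul])
  have h2 : dimS (α • B) = dimS B := by rw [dimS, dimS, XS_smul_pos hα]
  have h3 : dimU (α • B) = dimU B := by
    rw [← dimS_neg, ← dimS_neg, ← smul_neg, dimS, dimS, XS_smul_pos hα]
  obtain ⟨h, hh, hO⟩ := conj_of (hS.trans h2.symm) (hU.trans h3.symm) h1
  exact ⟨h, hh, fun x => by rw [hO x, orbit_smul hα.ne']⟩

lemma iii_direct {α : ℝ} (hS : dimS A = dimS B) (hU : dimU A = dimU B) (hα : α ≠ 0) (hC : CS A B α) :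
    ∃ h : Euc d ≃ₜ Euc d, MemH0plus h ∧ IsOrbitEquiv A B h := by
  rcases lt_or_gt_of_ne hα with h | h
  · exact iii_pos hS hU (neg_pos.2 h) hC.neg
  · exact iii_pos hS hU h hC

theorem iii_i (H : Cond3 A B) : ∃ h : Euc d ≃ₜ Euc d, MemH0plus h ∧ IsOrbitEquiv A B h := by
  obtain ⟨hm, α, hα, hC⟩ := H
  have hm' : (dimS A = dimS B ∧ dimU A = dimU B) ∨ (dimS A = dimU B ∧ dimU A = dimS B) := by
    have := hm
    rw [Multiset.insert_eq_cons, Multiset.insert_eq_cons, Multiset.cons_eq_cons] at this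
    simp only [Multiset.singleton_inj] at this
    rcases this with h | ⟨-, cs, h1, h2⟩
    · exact Or.inl h
    · rw [← Multiset.singleton_add, ← Multiset.cons_zero] at h1 h2
      have c1 : Multiset.card cs = 0 := by have := congrArg Multiset.card h1; simpa using this
      rw [Multiset.card_eq_zero] at c1
      subst c1
      simp at h1 h2
      exact Or.inr ⟨h2.symm, h1⟩
  rcases hm' with ⟨h1, h2⟩ | ⟨h1, h2⟩
  · exact iii_direct h1 h2 hα hC
  · have hC' : CS A (-B) (-α) := by
      have := CS.smul_right (α := -1) (β := -α) (A := A) (B := B) (by norm_num) (by simpa using hC)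
      simpa using this
    obtain ⟨h, hh, hO⟩ := iii_direct (B := -B) (by rw [h1, dimS_neg]) (by rw [h2, dimU_neg]) (neg_ne_zero.2 hα) hC'
    exact ⟨h, hh, fun x => by rw [hO x, orbit_neg]⟩
end

/-- **Topological classification of linear flows** (Theorem A).
For linear flows `Φ`, `Ψ` on `ℝ^d` (`d ≥ 1`), each of the following implies the other two:
(i) `Φ`, `Ψ` are some-Hölder equivalent; (ii) `Φ`, `Ψ` are equivalent (some homeomorphism maps
every `Φ`-orbit onto a `Ψ`-orbit); (iii) `{dim X_S^Φ, dim X_U^Φ} = {dim X_S^Ψ, dim X_U^Ψ}` and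
for some `α ≠ 0` the central-part generators `A^{Φ_C}`, `α A^{Ψ_C}` are similar. -/
theorem topological_classification {d : ℕ} (hd : 0 < d) (A B : Matrix (Fin d) (Fin d) ℝ) :
    ((∃ h : Euc d ≃ₜ Euc d, MemH0plus h ∧ IsOrbitEquiv A B h) ↔
      (∃ h : Euc d ≃ₜ Euc d, IsOrbitEquiv A B h)) ∧
    ((∃ h : Euc d ≃ₜ Euc d, IsOrbitEquiv A B h) ↔
      (({dimS A, dimU A} : Multiset ℕ) = ({dimS B, dimU B} : Multiset ℕ) ∧
        ∃ α : ℝ, α ≠ 0 ∧ IsCentralSimilar A B α)) := by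
  have h23 : (∃ h : Euc d ≃ₜ Euc d, IsOrbitEquiv A B h) → Cond3 A B := fun ⟨_, hO⟩ => ii_iii hO
  have h31 : Cond3 A B → ∃ h : Euc d ≃ₜ Euc d, MemH0plus h ∧ IsOrbitEquiv A B h := iii_i
  have h12 : (∃ h : Euc d ≃ₜ Euc d, MemH0plus h ∧ IsOrbitEquiv A B h) → ∃ h : Euc d ≃ₜ Euc d, IsOrbitEquiv A B h :=
    fun ⟨h, _, hO⟩ => ⟨h, hO⟩
  refine ⟨⟨h12, fun h => h31 (h23 h)⟩, fun h => ?_, fun h => ?_⟩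
  · obtain ⟨h1, α, hα, h2⟩ := h23 h
    exact ⟨h1, α, hα, CS_iff.2 h2⟩
  · obtain ⟨h1, α, hα, h2⟩ := h
    exact h12 (h31 ⟨h1, α, hα, CS_iff.1 h2⟩)
end LF
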